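/- arXiv:1405.5414 — 5 statements merged into one kernel-verified Lean document; each statement's English description precedes it below -/
import Mathlib

section
/- Let A be a C*-algebra and let φ₁, φ₂ be two norm-one continuous linear functionals on A which are L-orthogonal, i.e. ‖φ₁ + φ₂‖ = ‖φ₁ − φ₂‖ = 2. Then for every ε > 0 there exist elements a, b in A with ‖a‖ = ‖b‖ = 1, a ⊥ b (that is, a·b* = 0 and b*·a = 0), Re φ₁(a) > 1 − ε and Re φ₂(b) > 1 − ε. -/
theorem aux_unital {B : Type*} [CStarAlgebra B] [PartialOrder B] [StarOrderedRing B]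
    (x y w : B) (hx : ‖x‖ ≤ 1) (hy : ‖y‖ ≤ 1) (hw : ‖w‖ ≤ 1) (t : ℝ) :
    ‖(2 : ℝ) • (x + y) + t • ((2 : ℝ) • w - (x * star y + y * star x) * w)‖ ^ 2
      ≤ 16 * (1 + t ^ 2) := by
  have key : ∀ u : B, ‖u‖ ≤ 1 → u * star u ≤ 1 := by
    intro u hu
    rw [← CStarAlgebra.norm_le_one_iff_of_nonneg _ (mul_star_self_nonneg u),
      CStarRing.norm_self_mul_star]
    nlinarith [norm_nonneg u]
  set H := x * star y + y * star x with hH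
  have hHs : star H = H := by simp [hH, add_comm]
  have hHn : ‖((1/2 : ℝ) • H)‖ ≤ 1 := by
    have e1 : ‖x * star y‖ ≤ 1 := (norm_mul_le _ _).trans (by
      rw [norm_star]; exact mul_le_one₀ hx (norm_nonneg _) hy)
    have e2 : ‖y * star x‖ ≤ 1 := (norm_mul_le _ _).trans (by
      rw [norm_star]; exact mul_le_one₀ hy (norm_nonneg _) hx)
    rw [norm_smul]
    have := norm_add_le (x * star y) (y * star x)
    norm_num
    linarith
  have hH2 : H * H ≤ (4 : ℝ) • 1 := by
    have h := key _ hHn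
    have h' := smul_le_smul_of_nonneg_left h (show (0 : ℝ) ≤ 4 by norm_num)
    refine le_trans (le_of_eq ?_) h'
    simp only [star_smul, hHs, smul_mul_smul_comm, smul_smul]
    norm_num
  set Z := (2 : ℝ) • w - H * w with hZ
  set C : B := (2 : ℝ) • 1 - H with hC
  have hCs : star C = C := by simp [hC, hHs]
  have hZC : Z = C * w := by simp [hZ, hC, sub_mul]
  have hZZ : Z * star Z ≤ C * C := by
    have := star_right_conjugate_le_conjugate (key w hw) C
    rw [hCs, mul_one] at this
    rw [hZC, star_mul, hCs]
    simpa only [mul_assoc] using this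
  have hCC : C * C = (4 : ℝ) • 1 - (4 : ℝ) • H + H * H := by
    simp only [hC, sub_mul, mul_sub, smul_mul_assoc, mul_smul_comm, one_mul, mul_one]
    module
  have hSS : (x + y) * star (x + y) ≤ (2 : ℝ) • 1 + H := by
    have e : (x + y) * star (x + y) = x * star x + y * star y + H := by
      simp only [star_add, mul_add, add_mul, hH]; abel
    rw [e, two_smul]
    gcongr
    · exact key x hx
    · exact key y hy
  set S := x + y
  have h16 : (4 : ℝ) • (S * star S) + Z * star Z ≤ (16 : ℝ) • 1 := by
    calc _ ≤ (4 : ℝ) • ((2 : ℝ) • 1 + H) + ((4 : ℝ) • 1 - (4 : ℝ) • H + (4 : ℝ) • 1) := by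
          refine add_le_add (smul_le_smul_of_nonneg_left hSS (by norm_num)) (hZZ.trans ?_)
          rw [hCC]; gcongr
      _ = _ := by module
  set V := (2 : ℝ) • S + t • Z with hV
  set U := (2 * t : ℝ) • S - Z with hU
  have hid : V * star V + U * star U
      = (1 + t ^ 2) • ((4 : ℝ) • (S * star S) + Z * star Z) := by
    simp only [hV, hU, star_add, star_sub, star_smul, mul_add, add_mul, sub_mul, mul_sub,
      smul_mul_assoc, mul_smul_comm, star_trivial]
    module
  have hle : V * star V ≤ algebraMap ℝ B (16 * (1 + t ^ 2)) := by
    calc V * star V ≤ V * star V + U * star U := le_add_of_nonneg_right (mul_star_self_nonneg U)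
      _ ≤ (1 + t ^ 2) • ((16 : ℝ) • 1) := by
        rw [hid]; exact smul_le_smul_of_nonneg_left h16 (by positivity)
      _ = _ := by rw [Algebra.algebraMap_eq_smul_one, smul_smul, mul_comm]
  have := (CStarAlgebra.norm_le_iff_le_algebraMap _ (by positivity)
    (mul_star_self_nonneg V)).2 hle
  rwa [CStarRing.norm_self_mul_star, ← sq] at this

theorem aux_nonunital {A : Type*} [NonUnitalCStarAlgebra A]
    (x y w : A) (hx : ‖x‖ ≤ 1) (hy : ‖y‖ ≤ 1) (hw : ‖w‖ ≤ 1) (t : ℝ) :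
    ‖(2 : ℝ) • (x + y) + t • ((2 : ℝ) • w - (x * star y + y * star x) * w)‖ ^ 2
      ≤ 16 * (1 + t ^ 2) := by
  let _ : PartialOrder (Unitization ℂ A) := CStarAlgebra.spectralOrder _
  have : StarOrderedRing (Unitization ℂ A) := CStarAlgebra.spectralOrderedRing _
  have := aux_unital (x : Unitization ℂ A) y w
    (by rwa [Unitization.norm_inr]) (by rwa [Unitization.norm_inr])
    (by rwa [Unitization.norm_inr]) t
  rw [← Unitization.norm_inr (𝕜 := ℂ)]
  simpa using this

theorem aux_left {A : Type*} [NonUnitalCStarAlgebra A] (f : A →ₗ[ℝ] ℝ) (hf : ∀ a, f a ≤ ‖a‖)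
    (x y w : A) (hx : ‖x‖ ≤ 1) (hy : ‖y‖ ≤ 1) (hw : ‖w‖ ≤ 1) (t : ℝ) (ht : 0 < t)
    (fx : 1 - t ^ 2 / 2 ≤ f x) (fy : 1 - t ^ 2 / 2 ≤ f y) :
    f (w - ((1/2 : ℝ) • (x * star y + y * star x)) * w) ≤ 2 * t := by
  have h1 := aux_nonunital x y w hx hy hw t
  have h2 := hf ((2 : ℝ) • (x + y) + t • ((2 : ℝ) • w - (x * star y + y * star x) * w))
  simp only [map_add, map_sub, map_smul, smul_eq_mul, smul_mul_assoc] at h2 ⊢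
  set N := ‖(2 : ℝ) • (x + y) + t • ((2 : ℝ) • w - (x * star y + y * star x) * w)‖
  have h3 : N ≤ 4 * (1 + t ^ 2 / 2) := by
    apply le_of_sq_le_sq _ (by positivity)
    nlinarith [sq_nonneg (t ^ 2)]
  have h4 : t * (2 * f w - f ((x * star y + y * star x) * w)) ≤ t * (4 * t) := by nlinarith
  have h5 := le_of_mul_le_mul_left h4 ht
  linarith

theorem aux_neg {A : Type*} [NonUnitalCStarAlgebra A] (h : A) (hh : IsSelfAdjoint h) :
    ∃ g : A, ‖g‖ ≤ 1 ∧ h⁻ = g - h * g := by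
  have hc : Continuous (fun s : ℝ => s⁻ / (1 + s⁻)) := by
    refine Continuous.div (by fun_prop) (by fun_prop) fun s => ?_
    have := negPart_nonneg s
    positivity
  have h0 : (fun s : ℝ => s⁻ / (1 + s⁻)) 0 = 0 := by simp
  refine ⟨cfcₙ (fun s : ℝ => s⁻ / (1 + s⁻)) h, ?_, ?_⟩
  · refine norm_cfcₙ_le fun s _ => ?_
    have := negPart_nonneg s
    rw [Real.norm_of_nonneg (by positivity), div_le_one (by positivity)]
    linarith
  · rw [CFC.negPart_def]
    nth_rw 3 [← cfcₙ_id' ℝ h hh]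
    rw [← cfcₙ_mul (fun s : ℝ => s) _ h continuous_id.continuousOn rfl hc.continuousOn h0,
      ← cfcₙ_sub _ (fun s : ℝ => s * (s⁻ / (1 + s⁻))) h hc.continuousOn h0 (continuous_id.mul hc).continuousOn (by simp)]
    congr 1
    ext s
    have := negPart_nonneg s
    field_simp
    rcases le_total s 0 with hs | hs
    · rw [negPart_of_nonpos hs]; ring
    · rw [negPart_of_nonneg hs]; ring

theorem aux_left_pos {A : Type*} [NonUnitalCStarAlgebra A] (f : A →ₗ[ℝ] ℝ) (hf : ∀ a, f a ≤ ‖a‖)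
    (x y w : A) (hx : ‖x‖ ≤ 1) (hy : ‖y‖ ≤ 1) (hw : ‖w‖ ≤ 1) (t : ℝ) (ht : 0 < t)
    (fx : 1 - t ^ 2 / 2 ≤ f x) (fy : 1 - t ^ 2 / 2 ≤ f y) :
    f w - 4 * t ≤ f (((1/2 : ℝ) • (x * star y + y * star x))⁺ * w) := by
  set h := (1/2 : ℝ) • (x * star y + y * star x) with hh
  have hs : IsSelfAdjoint h := by
    simp [hh, IsSelfAdjoint, add_comm]
  obtain ⟨g, hg, e⟩ := aux_neg h hs
  have h1 := aux_left f hf x y w hx hy hw t ht fx fy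
  have h2 := aux_left f hf x y (-(g * w)) hx hy
    (by rw [norm_neg]; exact (norm_mul_le _ _).trans (mul_le_one₀ hg (norm_nonneg _) hw)) t ht fx fy
  rw [← hh] at h1 h2
  have e2 : h⁺ = h + (g - h * g) := by
    rw [← e]; nth_rw 2 [← CFC.posPart_sub_negPart h hs]; abel
  rw [e2]
  simp only [add_mul, sub_mul, map_add, map_sub, map_neg, mul_neg, mul_assoc] at h1 h2 ⊢
  linarith

theorem aux_both {A : Type*} [NonUnitalCStarAlgebra A] (f : A →ₗ[ℝ] ℝ) (hf : ∀ a, f a ≤ ‖a‖)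
    (x y : A) (hx : ‖x‖ ≤ 1) (hy : ‖y‖ ≤ 1) (t : ℝ) (ht : 0 < t)
    (fx : 1 - t ^ 2 / 2 ≤ f x) (fy : 1 - t ^ 2 / 2 ≤ f y) :
    let a := ((1/2 : ℝ) • (x * star y + y * star x))⁺ * ((1/2 : ℝ) • (x + y)) *
      ((1/2 : ℝ) • (star x * y + star y * x))⁺
    ‖a‖ ≤ 1 ∧ 1 - t ^ 2 / 2 - 8 * t ≤ f a := by
  have pn : ∀ u v : A, ‖u‖ ≤ 1 → ‖v‖ ≤ 1 → ‖((1/2 : ℝ) • (u + v))‖ ≤ 1 := by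
    intro u v hu hv
    rw [norm_smul]
    have := norm_add_le u v
    norm_num
    linarith
  have mn : ∀ u v : A, ‖u‖ ≤ 1 → ‖v‖ ≤ 1 → ‖u * v‖ ≤ 1 := fun u v hu hv =>
    (norm_mul_le _ _).trans (mul_le_one₀ hu (norm_nonneg _) hv)
  have hx' : ‖star x‖ ≤ 1 := by rwa [norm_star]
  have hy' : ‖star y‖ ≤ 1 := by rwa [norm_star]
  intro a
  set p := ((1/2 : ℝ) • (x * star y + y * star x))⁺ with hp
  set q := ((1/2 : ℝ) • (star x * y + star y * x))⁺ with hq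
  have hpn : ‖p‖ ≤ 1 := (CStarAlgebra.norm_posPart_le _).trans
    (pn _ _ (mn _ _ hx hy') (mn _ _ hy hx'))
  have hqn : ‖q‖ ≤ 1 := (CStarAlgebra.norm_posPart_le _).trans
    (pn _ _ (mn _ _ hx' hy) (mn _ _ hy' hx))
  have hqs : star q = q := (cfcₙ_predicate (R := ℝ) (p := IsSelfAdjoint) _ _).star_eq
  set c := (1/2 : ℝ) • (x + y) with hc
  have hcn : ‖c‖ ≤ 1 := pn _ _ hx hy
  refine ⟨mn _ _ (mn _ _ hpn hcn) hqn, ?_⟩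
  have h1 := aux_left_pos f hf x y (c * q) hx hy (mn _ _ hcn hqn) t ht fx fy
  let f' : A →ₗ[ℝ] ℝ := f.comp (starLinearEquiv ℝ (A := A)).toLinearMap
  have hf' : ∀ a, f' a = f (star a) := fun a => rfl
  have h2 := aux_left_pos f' (fun a => by rw [hf', ← norm_star a]; exact hf _)
    (star x) (star y) (star c) hx' hy' (by rwa [norm_star]) t ht (by simpa [hf'] using fx)
      (by simpa [hf'] using fy)
  rw [star_star, star_star, ← hq, hf', hf', star_mul, star_star, hqs] at h2
  rw [← hp, ← mul_assoc] at h1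
  have h3 : f c = 1/2 * (f x + f y) := by rw [hc, map_smul, map_add, smul_eq_mul]
  linarith

/-- If `φ₁, φ₂` are two norm-one continuous linear functionals on a
C*-algebra `A` that are L-orthogonal (`‖φ₁ + φ₂‖ = ‖φ₁ - φ₂‖ = 2`), then for every `ε > 0`
there are norm-one orthogonal elements `a ⊥ b` in `A` with `Re φ₁(a) > 1 - ε` and
`Re φ₂(b) > 1 - ε`. -/
theorem l_orthogonal_functionals_almost_attain_on_orthogonal_elements
    {A : Type*} [NonUnitalCStarAlgebra A]
    (φ₁ φ₂ : A →L[ℂ] ℂ) (h1 : ‖φ₁‖ = 1) (h2 : ‖φ₂‖ = 1)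
    (hplus : ‖φ₁ + φ₂‖ = 2) (hminus : ‖φ₁ - φ₂‖ = 2) :
    ∀ ε > (0 : ℝ), ∃ a b : A, ‖a‖ = 1 ∧ ‖b‖ = 1 ∧
      a * star b = 0 ∧ star b * a = 0 ∧
      1 - ε < (φ₁ a).re ∧ 1 - ε < (φ₂ b).re := by
  intro ε hε
  -- real parts
  let R : (A →L[ℂ] ℂ) → (A →ₗ[ℝ] ℝ) := fun φ =>
    Complex.reLm.comp (φ.toLinearMap.restrictScalars ℝ)
  have hR : ∀ φ a, R φ a = (φ a).re := fun _ _ => rfl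
  have bd : ∀ φ : A →L[ℂ] ℂ, ‖φ‖ = 1 → ∀ a, R φ a ≤ ‖a‖ := by
    intro φ hφ a
    rw [hR]
    refine (Complex.re_le_norm _).trans ((φ.le_opNorm a).trans ?_)
    rw [hφ, one_mul]
  -- almost norming elements with positive real value
  have att : ∀ φ : A →L[ℂ] ℂ, ∀ r < ‖φ‖, ∃ x : A, ‖x‖ ≤ 1 ∧ r < (φ x).re := by
    intro φ r hr
    rcases lt_or_ge r 0 with h | h
    · exact ⟨0, by simp, by simpa using h⟩
    obtain ⟨x, hx, hrx⟩ := φ.exists_lt_apply_of_lt_opNorm hr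
    have hne : (φ x) ≠ 0 := by
      intro h0; rw [h0, norm_zero] at hrx; linarith
    have hn : (‖φ x‖ : ℂ) ≠ 0 := by simpa using hne
    refine ⟨((starRingEnd ℂ) (φ x) / ‖φ x‖) • x, ?_, ?_⟩
    · rw [norm_smul]
      have : ‖(starRingEnd ℂ) (φ x) / (‖φ x‖ : ℂ)‖ = 1 := by
        rw [norm_div, RCLike.norm_conj, Complex.norm_real, norm_norm]
        exact div_self (by simpa using hne)
      rw [this, one_mul]; exact hx.le
    · have : φ (((starRingEnd ℂ) (φ x) / ‖φ x‖) • x) = (‖φ x‖ : ℂ) := by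
        rw [map_smul, smul_eq_mul, div_mul_eq_mul_div, mul_comm, Complex.mul_conj']
        field_simp
      rw [this, Complex.ofReal_re]; exact hrx
  obtain ⟨t, ht, ht1, htε⟩ : ∃ t : ℝ, 0 < t ∧ t ^ 2 / 2 + 8 * t < 1 ∧ t ^ 2 / 2 + 8 * t < ε := by
    refine ⟨min (1/10) (ε / 10), by positivity, ?_, ?_⟩
    · nlinarith [min_le_left (1/10) (ε / 10), show 0 < min (1/10) (ε / 10) by positivity]
    · nlinarith [min_le_left (1/10) (ε / 10), min_le_right (1/10) (ε / 10),
        show 0 < min (1/10) (ε / 10) by positivity]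
  have ht2 : 0 < t ^ 2 / 2 := by positivity
  obtain ⟨x, hx, fx⟩ := att (φ₁ + φ₂) (2 - t ^ 2 / 2) (by linarith)
  obtain ⟨y, hy, fy⟩ := att (φ₁ - φ₂) (2 - t ^ 2 / 2) (by linarith)
  have hy' : ‖-y‖ ≤ 1 := by rwa [norm_neg]
  have b1x := bd φ₁ h1 x
  have b2x := bd φ₂ h2 x
  have b1y := bd φ₁ h1 y
  have b2y := bd φ₂ h2 (-y)
  simp only [hR, map_neg, Complex.neg_re, add_apply,
    sub_apply, Complex.add_re, Complex.sub_re] at fx fy b1x b2x b1y b2y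
  obtain ⟨an, fa⟩ := aux_both (R φ₁) (bd φ₁ h1) x y hx hy t ht
    (by rw [hR]; linarith) (by rw [hR]; linarith)
  obtain ⟨bn, fb⟩ := aux_both (R φ₂) (bd φ₂ h2) x (-y) hx hy' t ht
    (by rw [hR]; linarith) (by rw [hR, map_neg, Complex.neg_re]; linarith)
  have e1 : (1/2 : ℝ) • (x * star (-y) + -y * star x)
      = -((1/2 : ℝ) • (x * star y + y * star x)) := by
    simp only [star_neg, mul_neg, neg_mul]; module
  have e2 : (1/2 : ℝ) • (star x * (-y) + star (-y) * x)
      = -((1/2 : ℝ) • (star x * y + star y * x)) := by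
    simp only [star_neg, mul_neg, neg_mul]; module
  rw [e1, e2, CFC.posPart_neg, CFC.posPart_neg] at bn fb
  set h := (1/2 : ℝ) • (x * star y + y * star x)
  set k := (1/2 : ℝ) • (star x * y + star y * x)
  set c := (1/2 : ℝ) • (x + y)
  set d := (1/2 : ℝ) • (x + -y)
  have hs : star h⁻ = h⁻ := (cfcₙ_predicate (R := ℝ) (p := IsSelfAdjoint) _ _).star_eq
  have ks : star k⁻ = k⁻ := (cfcₙ_predicate (R := ℝ) (p := IsSelfAdjoint) _ _).star_eq
  have o1 : (h⁺ * c * k⁺) * star (h⁻ * d * k⁻) = 0 := by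
    rw [star_mul, ks, mul_assoc (h⁺ * c), ← mul_assoc k⁺, CFC.posPart_mul_negPart, zero_mul,
      mul_zero]
  have o2 : star (h⁻ * d * k⁻) * (h⁺ * c * k⁺) = 0 := by
    rw [star_mul, star_mul, hs, mul_assoc h⁺, ← mul_assoc (star k⁻), mul_assoc _ h⁻,
      ← mul_assoc h⁻, CFC.negPart_mul_posPart, zero_mul, mul_zero]
  set a := h⁺ * c * k⁺
  set b := h⁻ * d * k⁻
  rw [hR] at fa fb
  have nrm : ∀ φ : A →L[ℂ] ℂ, ∀ u : A, ‖u‖ ≤ 1 → 1 - t ^ 2 / 2 - 8 * t ≤ (φ u).re →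
      ‖(‖u‖⁻¹ : ℂ) • u‖ = 1 ∧ 1 - ε < (φ ((‖u‖⁻¹ : ℂ) • u)).re := by
    intro φ u hu hφ
    have hu0 : u ≠ 0 := by
      rintro rfl; simp at hφ; linarith
    have hpos : 0 < ‖u‖ := norm_pos_iff.2 hu0
    constructor
    · rw [norm_smul, norm_inv, Complex.norm_real, norm_norm]
      exact inv_mul_cancel₀ hpos.ne'
    · rw [map_smul, smul_eq_mul, ← Complex.ofReal_inv, Complex.re_ofReal_mul]
      have : 1 ≤ ‖u‖⁻¹ := (one_le_inv₀ hpos).2 hu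
      nlinarith
  obtain ⟨na, ra⟩ := nrm φ₁ a an fa
  obtain ⟨nb, rb⟩ := nrm φ₂ b bn fb
  refine ⟨_, _, na, nb, ?_, ?_, ra, rb⟩
  · rw [star_smul, smul_mul_smul_comm, o1, smul_zero]
  · rw [star_smul, smul_mul_smul_comm, o2, smul_zero]
end

section
/- For every ε > 0 there exists δ > 0 such that the following holds for every C*-algebra A: whenever φ₁ and φ₂ are continuous linear functionals on A with ‖φ₁‖ ≤ 1, ‖φ₂‖ ≤ 1, ‖φ₁ + φ₂‖ ≥ 2(1 − δ) and ‖φ₁ − φ₂‖ ≥ 2(1 − δ), there exist elements a, b in A with ‖a‖ = ‖b‖ = 1, a ⊥ b (that is, a·b* = 0 and b*·a = 0), Re φ₁(a) > 1 − ε and Re φ₂(b) > 1 − ε. -/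
universe u

namespace LOrth

section Unital

variable {B : Type u} [CStarAlgebra B] [PartialOrder B] [StarOrderedRing B]

lemma norm_sq_le_of_mul_star {x : B} {r : ℝ} (hr : 0 ≤ r)
    (h : x * star x ≤ algebraMap ℝ B r) : ‖x‖ ^ 2 ≤ r := by
  rw [sq, ← CStarRing.norm_self_mul_star]
  exact (CStarAlgebra.norm_le_iff_le_algebraMap _ hr (mul_star_self_nonneg x)).2 h

lemma left_norm {p q : B} (h : p * star p + q * star q ≤ 1) (t : ℝ) :
    ‖p + t • q‖ ^ 2 ≤ 1 + t ^ 2 := by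
  apply norm_sq_le_of_mul_star (by positivity)
  have e : (p + t • q) * star (p + t • q) + (t • p - q) * star (t • p - q)
      = (1 + t ^ 2) • (p * star p + q * star q) := by
    simp only [star_add, star_sub, star_smul, mul_add, add_mul, mul_sub, sub_mul, smul_mul_assoc,
      mul_smul_comm, star_trivial]
    module
  calc (p + t • q) * star (p + t • q)
      ≤ (p + t • q) * star (p + t • q) + (t • p - q) * star (t • p - q) :=
        le_add_of_nonneg_right (mul_star_self_nonneg _)
    _ = (1 + t ^ 2) • (p * star p + q * star q) := e
    _ ≤ (1 + t ^ 2) • (1 : B) := smul_le_smul_of_nonneg_left h (by positivity)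
    _ = _ := (Algebra.algebraMap_eq_smul_one _).symm

lemma mul_star_le_one {z : B} (hz : ‖z‖ ≤ 1) : z * star z ≤ 1 := by
  rw [← CStarAlgebra.norm_le_one_iff_of_nonneg _ (mul_star_self_nonneg z),
    CStarRing.norm_self_mul_star]
  nlinarith [norm_nonneg z]

lemma contr {w z : B} (hz : ‖z‖ ≤ 1) : (w * z) * star (w * z) ≤ w * star w := by
  have := star_right_conjugate_le_conjugate (mul_star_le_one hz) w
  simpa [mul_assoc] using this

lemma left_norm' {p w z : B} (h : p * star p + w * star w ≤ 1) (hz : ‖z‖ ≤ 1) (t : ℝ) :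
    ‖p + t • (w * z)‖ ^ 2 ≤ 1 + t ^ 2 :=
  left_norm ((add_le_add le_rfl (contr hz)).trans h) t

lemma right_norm' {p w z : B} (h : star p * p + star w * w ≤ 1) (hz : ‖z‖ ≤ 1) (t : ℝ) :
    ‖p + t • (z * w)‖ ^ 2 ≤ 1 + t ^ 2 := by
  have := left_norm' (p := star p) (w := star w) (z := star z) (by simpa using h)
    (by simpa using hz) t
  rw [← norm_star]
  simpa using this

lemma fun_bound {φ : B →L[ℂ] ℂ} (hφ : ‖φ‖ ≤ 1) {p q : B} {δ t : ℝ} (ht : 0 < t)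
    (hp : 1 - δ ≤ (φ p).re) (h : ‖p + t • q‖ ^ 2 ≤ 1 + t ^ 2) :
    (φ q).re ≤ δ / t + t / 2 := by
  have h1 : ‖p + t • q‖ ≤ 1 + t ^ 2 / 2 := by
    apply le_of_sq_le_sq _ (by positivity)
    nlinarith [sq_nonneg (t ^ 2)]
  have h2 : (φ (p + t • q)).re ≤ 1 + t ^ 2 / 2 := by
    refine (Complex.re_le_norm _).trans ((φ.le_opNorm _).trans ?_)
    nlinarith [norm_nonneg (p + t • q)]
  have h3 : (φ (p + t • q)).re = (φ p).re + t * (φ q).re := by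
    have : t • q = (t : ℂ) • q := (Complex.coe_smul t q).symm
    rw [this]
    simp
  have : t * (φ q).re ≤ t * (δ / t + t / 2) := by
    have : t * (δ / t + t / 2) = δ + t ^ 2 / 2 := by field_simp
    linarith
  exact le_of_mul_le_mul_left this ht

/-- one-sided cut off functions -/
lemma cutoff (d : B) (hd : IsSelfAdjoint d) (hn : ‖d‖ ≤ 1) :
    ∃ h k g l : B, star h = h ∧ star k = k ∧ h * k = 0 ∧ k * h = 0 ∧ ‖h‖ ≤ 1 ∧ ‖k‖ ≤ 1 ∧
      ‖g‖ ≤ 1 ∧ ‖l‖ ≤ 1 ∧ 1 - h = (1 - d) * g ∧ 1 - h = g * (1 - d) ∧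
      1 - k = (1 + d) * l ∧ 1 - k = l * (1 + d) := by
  have hspec : ∀ x ∈ spectrum ℝ d, |x| ≤ 1 := fun x hx => by
    rcases subsingleton_or_nontrivial B with hB | hB
    · simp [spectrum.of_subsingleton] at hx
    · exact (spectrum.norm_le_norm_of_mem hx).trans hn
  have cg : Continuous fun x : ℝ => 1 / (1 + max (-x) 0) := by
    refine Continuous.div (by fun_prop) (by fun_prop) fun x => ?_
    have := le_max_right (-x) 0
    positivity
  have cl : Continuous fun x : ℝ => 1 / (1 + max x 0) := by
    refine Continuous.div (by fun_prop) (by fun_prop) fun x => ?_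
    have := le_max_right x 0
    positivity
  have one_sub : ∀ f : ℝ → ℝ, Continuous f → 1 - cfc f d = cfc (fun x => 1 - f x) d := by
    intro f hf
    rw [cfc_sub (fun _ => 1) f d (by fun_prop) (by fun_prop), cfc_const_one ℝ d]
  have e1 : 1 - d = cfc (fun x : ℝ => 1 - x) d := by
    rw [cfc_sub (fun _ => 1) (fun x => x) d, cfc_const_one ℝ d, cfc_id' ℝ d]
  have e2 : 1 + d = cfc (fun x : ℝ => 1 + x) d := by
    rw [cfc_add (a := d) (fun _ => 1) (fun x => x), cfc_const_one ℝ d, cfc_id' ℝ d]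
  have k1 : ∀ x : ℝ, 1 - max x 0 = (1 - x) * (1 / (1 + max (-x) 0)) := by
    intro x
    rcases le_total x 0 with hx | hx
    · have : 1 + -x ≠ 0 := by linarith
      rw [max_eq_right hx, max_eq_left (by linarith)]
      field_simp
      ring
    · rw [max_eq_left hx, max_eq_right (by linarith)]
      simp
  have k2 : ∀ x : ℝ, 1 - max (-x) 0 = (1 + x) * (1 / (1 + max x 0)) := by
    intro x
    have := k1 (-x)
    simpa using this
  have hz : ∀ x : ℝ, max x 0 * max (-x) 0 = 0 := by
    intro x
    rcases le_total x 0 with hx | hx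
    · simp [max_eq_right hx]
    · simp [max_eq_right (neg_nonpos.2 hx)]
  refine ⟨cfc (fun x : ℝ => max x 0) d, cfc (fun x : ℝ => max (-x) 0) d,
    cfc (fun x : ℝ => 1 / (1 + max (-x) 0)) d, cfc (fun x : ℝ => 1 / (1 + max x 0)) d,
    cfc_predicate (R := ℝ) _ d, cfc_predicate (R := ℝ) _ d, ?_, ?_, ?_, ?_, ?_, ?_, ?_, ?_, ?_, ?_⟩
  · rw [← cfc_mul _ _ d (by fun_prop) (by fun_prop)]
    simp only [hz]
    exact cfc_const_zero ℝ d
  · rw [← cfc_mul _ _ d (by fun_prop) (by fun_prop)]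
    simp only [mul_comm (max (-_) (0 : ℝ)), hz]
    exact cfc_const_zero ℝ d
  · refine norm_cfc_le zero_le_one fun x hx => ?_
    have := abs_le.1 (hspec x hx)
    rw [Real.norm_of_nonneg (le_max_right _ _)]
    exact max_le this.2 zero_le_one
  · refine norm_cfc_le zero_le_one fun x hx => ?_
    have := abs_le.1 (hspec x hx)
    rw [Real.norm_of_nonneg (le_max_right _ _)]
    exact max_le (by linarith) zero_le_one
  · refine norm_cfc_le zero_le_one fun x hx => ?_
    have := le_max_right (-x) 0
    rw [Real.norm_of_nonneg (by positivity)]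
    exact div_le_one_of_le₀ (by linarith) (by positivity)
  · refine norm_cfc_le zero_le_one fun x hx => ?_
    have := le_max_right x 0
    rw [Real.norm_of_nonneg (by positivity)]
    exact div_le_one_of_le₀ (by linarith) (by positivity)
  · rw [one_sub _ (by fun_prop), e1, ← cfc_mul _ _ d (by fun_prop) cg.continuousOn]
    simp only [k1]
  · rw [one_sub _ (by fun_prop), e1, ← cfc_mul _ _ d cg.continuousOn (by fun_prop)]
    simp only [k1, mul_comm]
  · rw [one_sub _ (by fun_prop), e2, ← cfc_mul _ _ d (by fun_prop) cl.continuousOn]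
    simp only [k2]
  · rw [one_sub _ (by fun_prop), e2, ← cfc_mul _ _ d cl.continuousOn (by fun_prop)]
    simp only [k2, mul_comm]

lemma sq_one_sub {p : B} (hp : p * star p ≤ 1) :
    p * star p + (1 - p * star p) * star (1 - p * star p) ≤ 1 := by
  set c := p * star p with hc
  have hcs : star c = c := by simp [hc]
  have hc0 : 0 ≤ c := mul_star_self_nonneg p
  have h1 : 0 ≤ 1 - c := sub_nonneg.2 hp
  have hcom : Commute c (1 - c) := by
    simp [commute_iff_eq, mul_sub, sub_mul]
  have h2 : 0 ≤ c * (1 - c) := hcom.mul_nonneg hc0 h1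
  rw [star_sub, star_one, hcs, ← sub_nonneg]
  convert h2 using 1
  noncomm_ring

lemma norm_mul3 {x y z : B} (hx : ‖x‖ ≤ 1) (hy : ‖y‖ ≤ 1) (hz : ‖z‖ ≤ 1) : ‖x * y * z‖ ≤ 1 :=
  (norm_mul_le _ _).trans (mul_le_one₀ ((norm_mul_le _ _).trans
    (mul_le_one₀ hx (norm_nonneg _) hy)) (norm_nonneg _) hz)

lemma norm_mul2 {x y : B} (hx : ‖x‖ ≤ 1) (hy : ‖y‖ ≤ 1) : ‖x * y‖ ≤ 1 :=
  (norm_mul_le _ _).trans (mul_le_one₀ hx (norm_nonneg _) hy)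

/-- main estimate -/
lemma main_est {φ : B →L[ℂ] ℂ} (hφ : ‖φ‖ ≤ 1) {p v : B} {δ t : ℝ} (ht : 0 < t)
    (hu : ‖p‖ ≤ 1) (hv : ‖v‖ ≤ 1)
    (hp : 1 - δ ≤ (φ p).re) (hl : p * star p + v * star v ≤ 1) (hr : star p * p + star v * v ≤ 1)
    {h' g' h g : B} (hh' : ‖h'‖ ≤ 1) (hg' : ‖g'‖ ≤ 1) (hg : ‖g‖ ≤ 1)
    (e' : 1 - h' = (1 - (p * star p - v * star v)) * g')
    (e : 1 - h = g * (1 - (star p * p - star v * v))) :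
    1 - δ - 4 * (δ / t + t / 2) ≤ (φ (h' * p * h)).re := by
  have hvs : ‖star v‖ ≤ 1 := by rwa [norm_star]
  have hus : ‖star p‖ ≤ 1 := by rwa [norm_star]
  have b1 : (φ ((1 - p * star p) * (g' * p))).re ≤ δ / t + t / 2 :=
    fun_bound hφ ht hp (left_norm' (sq_one_sub (mul_star_le_one hu)) (norm_mul2 hg' hu) t)
  have b2 : (φ (v * (star v * g' * p))).re ≤ δ / t + t / 2 :=
    fun_bound hφ ht hp (left_norm' hl (norm_mul3 hvs hg' hu) t)
  have b3 : (φ ((h' * p * g) * (1 - star p * p))).re ≤ δ / t + t / 2 := by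
    refine fun_bound hφ ht hp (right_norm' ?_ (norm_mul3 hh' hu hg) t)
    have := sq_one_sub (mul_star_le_one hus)
    simpa using this
  have b4 : (φ ((h' * p * g * star v) * v)).re ≤ δ / t + t / 2 :=
    fun_bound hφ ht hp (right_norm' hr (norm_mul2 (norm_mul3 hh' hu hg) hvs) t)
  have key : h' * p * h = p - (1 - p * star p) * (g' * p) - v * (star v * g' * p)
      - (h' * p * g) * (1 - star p * p) - (h' * p * g * star v) * v := by
    calc h' * p * h = p - (1 - h') * p - h' * p * (1 - h) := by noncomm_ring
      _ = _ := by rw [e', e]; noncomm_ring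
  rw [key]
  simp only [map_sub, Complex.sub_re]
  linarith

lemma unital {φ₁ φ₂ : B →L[ℂ] ℂ} (h₁ : ‖φ₁‖ ≤ 1) (h₂ : ‖φ₂‖ ≤ 1) {p v : B} {δ t : ℝ} (ht : 0 < t)
    (hadd : ‖p + v‖ ≤ 1) (hsub : ‖p - v‖ ≤ 1)
    (hp : 1 - δ ≤ (φ₁ p).re) (hv : 1 - δ ≤ (φ₂ v).re) :
    ∃ h' h k' k : B, ‖h' * p * h‖ ≤ 1 ∧ ‖k' * v * k‖ ≤ 1 ∧
      (h' * p * h) * star (k' * v * k) = 0 ∧ star (k' * v * k) * (h' * p * h) = 0 ∧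
      1 - δ - 4 * (δ / t + t / 2) ≤ (φ₁ (h' * p * h)).re ∧
      1 - δ - 4 * (δ / t + t / 2) ≤ (φ₂ (k' * v * k)).re := by
  have gen : ∀ x y : B, ‖x + y‖ ≤ 1 → ‖x - y‖ ≤ 1 → x * star x + y * star y ≤ 1 := by
    intro x y h1 h2
    have := add_le_add (mul_star_le_one h1) (mul_star_le_one h2)
    have e : (x + y) * star (x + y) + (x - y) * star (x - y)
        = (2 : ℝ) • (x * star x + y * star y) := by
      simp only [star_add, star_sub, mul_add, add_mul, mul_sub, sub_mul]
      module
    rw [e] at this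
    have h3 := smul_le_smul_of_nonneg_left this (show (0 : ℝ) ≤ 1 / 2 by norm_num)
    have e2 : (1 / 2 : ℝ) • ((1 : B) + 1) = 1 := by module
    have e3 : (1 / 2 : ℝ) • (2 : ℝ) • (x * star x + y * star y) = x * star x + y * star y := by
      module
    rwa [e2, e3] at h3
  have hl := gen p v hadd hsub
  have hr : star p * p + star v * v ≤ 1 := by
    have := gen (star p) (star v) (by rwa [← star_add, norm_star]) (by rwa [← star_sub, norm_star])
    simpa using this
  have hcontr : ∀ x y : B, x * star x + y * star y ≤ 1 → ‖x‖ ≤ 1 := by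
    intro x y h
    have := norm_sq_le_of_mul_star (x := x) (r := 1) zero_le_one
      (by simpa using (le_add_of_nonneg_right (mul_star_self_nonneg y)).trans h)
    exact (sq_le_one_iff₀ (norm_nonneg _)).1 this
  have hpn : ‖p‖ ≤ 1 := hcontr p v hl
  have hvn : ‖v‖ ≤ 1 := hcontr v p (by rwa [add_comm])
  have dn : ∀ x y : B, x * star x + y * star y ≤ 1 → ‖x * star x - y * star y‖ ≤ 1 := by
    intro x y h
    have hs : IsSelfAdjoint (x * star x - y * star y) :=
      (IsSelfAdjoint.mul_star_self x).sub (IsSelfAdjoint.mul_star_self y)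
    have hx := mul_star_self_nonneg x
    have hy := mul_star_self_nonneg y
    set c := x * star x
    set e := y * star y
    have h1 : 0 ≤ 1 - (c - e) := by
      have : 1 - (c - e) = (1 - (c + e)) + (e + e) := by abel
      rw [this]
      exact add_nonneg (sub_nonneg.2 h) (add_nonneg hy hy)
    have h2 : 0 ≤ 1 + (c - e) := by
      have : 1 + (c - e) = (1 - (c + e)) + (c + c) := by abel
      rw [this]
      exact add_nonneg (sub_nonneg.2 h) (add_nonneg hx hx)
    have hcom : Commute (1 - (c - e)) (1 + (c - e)) := by
      rw [commute_iff_eq]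
      noncomm_ring
    have h3 := hcom.mul_nonneg h1 h2
    refine (sq_le_one_iff₀ (norm_nonneg _)).1 (norm_sq_le_of_mul_star zero_le_one ?_)
    rw [hs.star_eq, map_one, ← sub_nonneg]
    convert h3 using 1
    noncomm_ring
  obtain ⟨h', k', g', l', sh', sk', hk', kh', nh', nk', ng', nl', a1', a2', a3', a4'⟩ :=
    cutoff (p * star p - v * star v)
      ((IsSelfAdjoint.mul_star_self p).sub (IsSelfAdjoint.mul_star_self v)) (dn _ _ hl)
  obtain ⟨h, k, g, l, sh, sk, hk, kh, nh, nk, ng, nl, a1, a2, a3, a4⟩ :=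
    cutoff (star p * p - star v * v)
      ((IsSelfAdjoint.star_mul_self p).sub (IsSelfAdjoint.star_mul_self v))
      (by simpa using dn (star p) (star v) (by simpa using hr))
  refine ⟨h', h, k', k, norm_mul3 nh' hpn nh, norm_mul3 nk' hvn nk, ?_, ?_, ?_, ?_⟩
  · calc (h' * p * h) * star (k' * v * k) = h' * p * (h * k) * star v * star k' := by
          simp [sk, mul_assoc]
      _ = 0 := by simp [hk]
  · calc star (k' * v * k) * (h' * p * h) = star k * star v * (k' * h') * p * h := by
          simp [sk', mul_assoc]
      _ = 0 := by simp [kh']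
  · exact main_est h₁ ht hpn hvn hp hl hr nh' ng' ng a1' a2
  · refine main_est h₂ ht hvn hpn hv (by rwa [add_comm]) (by rwa [add_comm]) nk' nl' nl ?_ ?_
    · rw [a3']; congr 1; abel
    · rw [a4]; congr 1; abel

end Unital

lemma exists_ext {A : Type u} [NonUnitalCStarAlgebra A] (φ : A →L[ℂ] ℂ) (hφ : ‖φ‖ ≤ 1) :
    ∃ ψ : Unitization ℂ A →L[ℂ] ℂ, ‖ψ‖ ≤ 1 ∧ ∀ a : A, ψ (a : Unitization ℂ A) = φ a := by
  let i : A →ₗᵢ[ℂ] Unitization ℂ A :=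
    { toLinearMap := Unitization.inrHom ℂ ℂ A, norm_map' := fun a => Unitization.norm_inr (𝕜 := ℂ) a }
  let f : StrongDual ℂ (LinearMap.range i.toLinearMap) :=
    φ.comp (i.equivRange.symm : _ →L[ℂ] A)
  obtain ⟨ψ, h1, h2⟩ := exists_extension_norm_eq _ f
  refine ⟨ψ, ?_, fun a => ?_⟩
  · rw [h2]
    refine ContinuousLinearMap.opNorm_le_bound _ zero_le_one fun x => ?_
    refine (φ.le_opNorm _).trans ?_
    have : ‖i.equivRange.symm x‖ = ‖x‖ := i.equivRange.symm.norm_map x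
    exact mul_le_mul hφ this.le (norm_nonneg _) zero_le_one
  · have := h1 (i.equivRange a)
    have h3 : f (i.equivRange a) = φ a := by
      change φ (i.equivRange.symm (i.equivRange a)) = φ a
      simp
    rw [h3] at this
    exact this

lemma exists_re {A : Type u} [NonUnitalCStarAlgebra A] (φ : A →L[ℂ] ℂ) {r : ℝ} (hr : r < ‖φ‖) :
    ∃ x : A, ‖x‖ ≤ 1 ∧ r < (φ x).re := by
  obtain ⟨x, hx, h⟩ := φ.exists_lt_apply_of_lt_opNorm hr
  obtain ⟨c, hc, hc'⟩ := RCLike.exists_norm_eq_mul_self (φ x)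
  refine ⟨c • x, ?_, ?_⟩
  · rw [norm_smul, hc, one_mul]; exact hx.le
  · rw [map_smul, smul_eq_mul, ← hc']
    simpa using h

lemma normalize {A : Type u} [NonUnitalCStarAlgebra A] (φ : A →L[ℂ] ℂ) {a : A} {r : ℝ}
    (hr : 0 ≤ r) (ha : ‖a‖ ≤ 1) (h : r < (φ a).re) :
    ∃ s : ℝ, ‖(s : ℂ) • a‖ = 1 ∧ r < (φ ((s : ℂ) • a)).re := by
  have ha0 : a ≠ 0 := by
    rintro rfl
    simp at h
    linarith
  have hpos : 0 < ‖a‖ := norm_pos_iff.2 ha0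
  refine ⟨‖a‖⁻¹, ?_, ?_⟩
  · rw [norm_smul]
    simp [hpos.ne']
  · have : (φ (((‖a‖⁻¹ : ℝ) : ℂ) • a)).re = ‖a‖⁻¹ * (φ a).re := by
      rw [map_smul, smul_eq_mul, Complex.re_ofReal_mul]
    rw [this]
    have := (one_le_inv₀ hpos).2 ha
    nlinarith

lemma re_le_one {A : Type u} [NonUnitalCStarAlgebra A] (φ : A →L[ℂ] ℂ) (hφ : ‖φ‖ ≤ 1) {a : A}
    (ha : ‖a‖ ≤ 1) : |(φ a).re| ≤ 1 :=
  (Complex.abs_re_le_norm _).trans ((φ.le_opNorm _).trans (mul_le_one₀ hφ (norm_nonneg _) ha))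

end LOrth

open LOrth in
/-- Quantitative version of L-orthogonality for pairs of functionals on
C*-algebras: for every `ε > 0` there is `δ > 0`, uniform over all C*-algebras `A`, such that
whenever `‖φ₁‖ ≤ 1`, `‖φ₂‖ ≤ 1`, `‖φ₁ + φ₂‖ ≥ 2(1 - δ)` and `‖φ₁ - φ₂‖ ≥ 2(1 - δ)`,
there are norm-one orthogonal elements `a ⊥ b` in `A` with `Re φ₁(a) > 1 - ε` and
`Re φ₂(b) > 1 - ε`. -/
theorem quantitative_l_orthogonality_pairs :
    ∀ ε > (0 : ℝ), ∃ δ > (0 : ℝ),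
      ∀ (A : Type u) [inst : NonUnitalCStarAlgebra A] (φ₁ φ₂ : A →L[ℂ] ℂ),
        ‖φ₁‖ ≤ 1 → ‖φ₂‖ ≤ 1 →
        2 * (1 - δ) ≤ ‖φ₁ + φ₂‖ → 2 * (1 - δ) ≤ ‖φ₁ - φ₂‖ →
        ∃ a b : A, ‖a‖ = 1 ∧ ‖b‖ = 1 ∧
          a * star b = 0 ∧ star b * a = 0 ∧
          1 - ε < (φ₁ a).re ∧ 1 - ε < (φ₂ b).re := by
  intro ε hε
  obtain ⟨η, hη, hη1, hηε⟩ : ∃ η : ℝ, 0 < η ∧ η ≤ 1 ∧ η ≤ ε :=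
    ⟨min 1 ε, lt_min one_pos hε, min_le_left _ _, min_le_right _ _⟩
  refine ⟨η ^ 2 / 1024, by positivity, ?_⟩
  intro A _ φ₁ φ₂ h₁ h₂ hs hd
  have hη2 : 0 < η ^ 2 := by positivity
  obtain ⟨x, hx, hx'⟩ := exists_re (φ₁ + φ₂) (r := 2 * (1 - 2 * (η ^ 2 / 1024))) (by linarith)
  obtain ⟨y, hy, hy'⟩ := exists_re (φ₁ - φ₂) (r := 2 * (1 - 2 * (η ^ 2 / 1024))) (by linarith)
  simp only [add_apply, sub_apply, Complex.add_re,
    Complex.sub_re] at hx' hy'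
  have x1 := abs_le.1 (re_le_one φ₁ h₁ hx)
  have x2 := abs_le.1 (re_le_one φ₂ h₂ hx)
  have y1 := abs_le.1 (re_le_one φ₁ h₁ hy)
  have y2 := abs_le.1 (re_le_one φ₂ h₂ hy)
  obtain ⟨ψ₁, n₁, e₁⟩ := exists_ext φ₁ h₁
  obtain ⟨ψ₂, n₂, e₂⟩ := exists_ext φ₂ h₂
  set p : A := ((1 / 2 : ℝ) : ℂ) • (x + y) with hp
  set v : A := ((1 / 2 : ℝ) : ℂ) • (x - y) with hv
  have epv : p + v = x := by rw [hp, hv]; push_cast; module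
  have emv : p - v = y := by rw [hp, hv]; push_cast; module
  have hp1 : 1 - η ^ 2 / 256 ≤ (φ₁ p).re := by
    rw [hp, map_smul, smul_eq_mul, Complex.re_ofReal_mul, map_add, Complex.add_re]
    linarith
  have hv1 : 1 - η ^ 2 / 256 ≤ (φ₂ v).re := by
    rw [hv, map_smul, smul_eq_mul, Complex.re_ofReal_mul, map_sub, Complex.sub_re]
    linarith
  letI : PartialOrder (Unitization ℂ A) := CStarAlgebra.spectralOrder _
  haveI : StarOrderedRing (Unitization ℂ A) := CStarAlgebra.spectralOrderedRing _
  obtain ⟨h', h, k', k, na, nb, o1, o2, r1, r2⟩ :=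
    unital (B := Unitization ℂ A) n₁ n₂ (p := (p : Unitization ℂ A)) (v := (v : Unitization ℂ A))
      (δ := η ^ 2 / 256) (t := η / 8) (by positivity)
      (by rw [← Unitization.inr_add, epv, Unitization.norm_inr]; exact hx)
      (by rw [← Unitization.inr_sub, emv, Unitization.norm_inr]; exact hy)
      (by rw [e₁]; exact hp1) (by rw [e₂]; exact hv1)
  have hcalc : 1 - η < 1 - η ^ 2 / 256 - 4 * (η ^ 2 / 256 / (η / 8) + η / 8 / 2) := by
    have : η ^ 2 / 256 / (η / 8) = η / 32 := by field_simp; norm_num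
    rw [this]
    nlinarith
  have hin : ∀ (s t : Unitization ℂ A) (w : A), ∃ a : A, s * (w : Unitization ℂ A) * t = a := by
    intro s t w
    refine ⟨(s * (w : Unitization ℂ A) * t).snd, ?_⟩
    ext <;> simp
  obtain ⟨a, ea⟩ := hin h' h p
  obtain ⟨b, eb⟩ := hin k' k v
  rw [ea, eb] at o1 o2
  rw [ea] at na
  rw [eb] at nb
  rw [ea, e₁] at r1
  rw [eb, e₂] at r2
  rw [Unitization.norm_inr] at na nb
  rw [← Unitization.inr_star, ← Unitization.inr_mul] at o1 o2
  have o1' : a * star b = 0 := Unitization.inr_injective (R := ℂ) (by simpa using o1)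
  have o2' : star b * a = 0 := Unitization.inr_injective (R := ℂ) (by simpa using o2)
  obtain ⟨s, s1, s2⟩ := normalize φ₁ (r := 1 - η) (by linarith) na (by linarith)
  obtain ⟨t, t1, t2⟩ := normalize φ₂ (r := 1 - η) (by linarith) nb (by linarith)
  refine ⟨(s : ℂ) • a, (t : ℂ) • b, s1, t1, ?_, ?_, by linarith, by linarith⟩
  · simp [star_smul, smul_mul_assoc, mul_smul_comm, o1']
  · simp [star_smul, smul_mul_assoc, mul_smul_comm, o2']
end

section
/- For every ε > 0 and every natural number n ≥ 1 there exists δ = δ(n, ε) > 0 such that the following holds for every C*-algebra A: whenever φ₁, …, φₙ are continuous linear functionals on A satisfying ∑_{j=1}^n |α_j| ≥ ‖∑_{j=1}^n α_j φ_j‖ ≥ (1 − δ) ∑_{j=1}^n |α_j| for all complex numbers α₁, …, αₙ, then (i) there exist pairwise orthogonal elements a₁, …, aₙ in A (a_i·a_j* = 0 and a_j*·a_i = 0 for i ≠ j) with ‖a_j‖ = 1 and Re φ_j(a_j) > 1 − ε for every j, and (ii) there exist functionals φ̃₁, …, φ̃ₙ on A with ‖φ̃_j‖ = 1 and ‖φ_j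 − φ̃_j‖ < ε for every j, which span ℓ1(n) isometrically, i.e. ‖∑_{j=1}^n α_j φ̃_j‖ = ∑_{j=1}^n |α_j| for all complex numbers α₁, …, αₙ. -/
universe u

section Core
variable {U : Type*} [CStarAlgebra U] [PartialOrder U] [StarOrderedRing U]

theorem core_norm_row (a z : U) (ha : ‖a‖ ≤ 1) :
    ‖a + (z - a * star a * z)‖ ^ 2 ≤ 1 + ‖z‖ ^ 2 := by
  set c : U := 1 - a * star a with hc
  set r : ℝ := ‖z‖ ^ 2 with hr
  have hcs : star c = c := by simp [hc]
  have e1 : a + (z - a * star a * z) = a + c * z := by rw [hc]; noncomm_ring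
  have h1 : z * star z ≤ r • (1 : U) := by
    have := CStarAlgebra.mul_star_le_algebraMap_norm_sq (a := z)
    rwa [Algebra.algebraMap_eq_smul_one] at this
  have h2 : star z * z ≤ r • (1 : U) := by
    have := CStarAlgebra.star_mul_le_algebraMap_norm_sq (a := z)
    rwa [Algebra.algebraMap_eq_smul_one] at this
  have h3 : star a * a ≤ 1 := by
    have := CStarAlgebra.star_mul_le_algebraMap_norm_sq (a := a)
    refine this.trans ?_
    rw [← map_one (algebraMap ℝ U)]
    exact algebraMap_mono U (by nlinarith [norm_nonneg a])
  have p1 : 0 ≤ (a * star z - c) * star (a * star z - c) := mul_star_self_nonneg _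
  have p2 : 0 ≤ a * (r • (1 : U) - star z * z) * star a :=
    star_right_conjugate_nonneg (sub_nonneg.2 h2) a
  have p3 : 0 ≤ c * (r • (1 : U) - z * star z) * star c :=
    star_right_conjugate_nonneg (sub_nonneg.2 h1) c
  have p4 : 0 ≤ a * (1 - star a * a) * star a :=
    star_right_conjugate_nonneg (sub_nonneg.2 h3) a
  have r0 : 0 ≤ r := by positivity
  have p5 : 0 ≤ (1 + r) • (a * (1 - star a * a) * star a) := smul_nonneg (by positivity) p4
  have key : (1 + r) • (1 : U) - (a + c * z) * star (a + c * z) =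
      (a * star z - c) * star (a * star z - c) + a * (r • (1 : U) - star z * z) * star a
      + c * (r • (1 : U) - z * star z) * star c
      + (1 + r) • (a * (1 - star a * a) * star a) := by
    have q : (1 : U) = a * star a + c * c + a * (1 - star a * a) * star a := by
      rw [hc]; noncomm_ring
    conv_lhs => rw [q]
    simp only [hcs, star_add, star_sub, star_mul, star_star, mul_add, add_mul, mul_sub, sub_mul,
      mul_smul_comm, smul_mul_assoc, mul_one, mul_assoc]
    module
  have hle : (a + c * z) * star (a + c * z) ≤ algebraMap ℝ U (1 + r) := by
    rw [Algebra.algebraMap_eq_smul_one, ← sub_nonneg, key]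
    positivity
  have := (CStarAlgebra.norm_le_iff_le_algebraMap _ (by positivity)
    (mul_star_self_nonneg (a + c * z))).2 hle
  rw [CStarRing.norm_self_mul_star] at this
  rw [e1, sq]; exact this

theorem core_left (Φ : U →ₗ[ℂ] ℂ) (hΦ : ∀ z, ‖Φ z‖ ≤ ‖z‖) (a : U) (ha : ‖a‖ ≤ 1) {s : ℝ}
    (hs : 0 < s) (h : 1 - s ^ 2 / 2 ≤ (Φ a).re) (z : U) :
    ‖Φ (z - a * star a * z)‖ ≤ s * ‖z‖ := by
  rcases eq_or_ne z 0 with rfl | hz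
  · simp
  have hz' : 0 < ‖z‖ := norm_pos_iff.2 hz
  set v := Φ (z - a * star a * z) with hv
  rcases eq_or_ne v 0 with h0 | h0
  · rw [h0]; simp; positivity
  have hv' : 0 < ‖v‖ := norm_pos_iff.2 h0
  set w : ℂ := (s / (‖z‖ * ‖v‖) : ℝ) * star v with hw
  have nw : ‖w‖ = s / ‖z‖ := by
    rw [hw, norm_mul, norm_star, Complex.norm_real, Real.norm_of_nonneg (by positivity)]
    field_simp
  have k := core_norm_row a (w • z) ha
  have n1 : ‖w • z‖ = s := by rw [norm_smul, nw]; field_simp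
  have e : Φ (a + (w • z - a * star a * (w • z))) = Φ a + ((s * ‖v‖ / ‖z‖ : ℝ) : ℂ) := by
    rw [mul_smul_comm, ← smul_sub, map_add, map_smul, ← hv, smul_eq_mul, hw, mul_assoc]
    congr 1
    have : star v * v = ((‖v‖ ^ 2 : ℝ) : ℂ) := by
      rw [mul_comm]; simpa using Complex.mul_conj' v
    rw [this, ← Complex.ofReal_mul]
    congr 1
    field_simp
  have k2 := hΦ (a + (w • z - a * star a * (w • z)))
  have k3 := Complex.re_le_norm (Φ (a + (w • z - a * star a * (w • z))))
  rw [e] at k2 k3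
  rw [Complex.add_re, Complex.ofReal_re] at k3
  rw [n1] at k
  have k4 : ‖a + (w • z - a * star a * (w • z))‖ ≤ 1 + s ^ 2 / 2 :=
    abs_le_of_sq_le_sq' (by nlinarith [sq_nonneg (s^2)]) (by positivity) |>.2
  have k5 : s * ‖v‖ / ‖z‖ ≤ s ^ 2 := by linarith
  rw [div_le_iff₀ hz'] at k5
  nlinarith

/-- bump functions -/
noncomputable def bumpG (l t : ℝ) : ℝ := 1 - (t - l) * ((t - l) / max 1 ((t - l) ^ 2))

noncomputable def bumpF (l t : ℝ) : ℝ := max 0 (min 1 (2 - |t - l|))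

theorem bumpR_cont (l : ℝ) : Continuous fun t : ℝ => (t - l) / max 1 ((t - l) ^ 2) := by
  refine Continuous.div (by fun_prop) (by fun_prop) fun t => ?_
  have : (1 : ℝ) ≤ max 1 ((t - l) ^ 2) := le_max_left _ _
  positivity

theorem bumpG_cont (l : ℝ) : Continuous (bumpG l) := by
  unfold bumpG
  exact continuous_const.sub ((by fun_prop : Continuous fun t : ℝ => t - l).mul (bumpR_cont l))

theorem bumpF_cont (l : ℝ) : Continuous (bumpF l) := by
  unfold bumpF; fun_prop

theorem bumpR_le (l t : ℝ) : ‖(t - l) / max 1 ((t - l) ^ 2)‖ ≤ 1 := by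
  have h1 : (1 : ℝ) ≤ max 1 ((t - l) ^ 2) := le_max_left _ _
  have h2 : (t - l) ^ 2 ≤ max 1 ((t - l) ^ 2) := le_max_right _ _
  rw [Real.norm_eq_abs, abs_div, abs_of_pos (by positivity : 0 < max 1 ((t - l) ^ 2)),
    div_le_one (by positivity)]
  rcases le_total |t - l| 1 with h | h
  · linarith
  · have h4 : |t - l| ^ 2 ≤ max 1 ((t - l) ^ 2) := by rw [sq_abs]; exact h2
    nlinarith

theorem bumpG_mem (l t : ℝ) : 0 ≤ bumpG l t ∧ bumpG l t ≤ 1 := by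
  have h1 : (1 : ℝ) ≤ max 1 ((t - l) ^ 2) := le_max_left _ _
  have h2 : (t - l) ^ 2 ≤ max 1 ((t - l) ^ 2) := le_max_right _ _
  have e : bumpG l t = 1 - (t - l) ^ 2 / max 1 ((t - l) ^ 2) := by unfold bumpG; ring
  rw [e]
  constructor
  · rw [sub_nonneg, div_le_one (by positivity)]; exact h2
  · have : 0 ≤ (t - l) ^ 2 / max 1 ((t - l) ^ 2) := by positivity
    linarith

theorem bumpG_zero (l t : ℝ) (h : 1 ≤ |t - l|) : bumpG l t = 0 := by
  have h3 : 1 ≤ (t - l) ^ 2 := by rw [← sq_abs]; nlinarith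
  have e : bumpG l t = 1 - (t - l) ^ 2 / max 1 ((t - l) ^ 2) := by unfold bumpG; ring
  rw [e, max_eq_right h3, div_self (by positivity), sub_self]

theorem bumpF_mem (l t : ℝ) : 0 ≤ bumpF l t ∧ bumpF l t ≤ 1 := by
  unfold bumpF; simp

theorem bumpF_one (l t : ℝ) (h : |t - l| ≤ 1) : bumpF l t = 1 := by
  unfold bumpF
  rw [min_eq_left (by linarith), max_eq_right (by norm_num)]

theorem bumpF_zero (l t : ℝ) (h : 2 ≤ |t - l|) : bumpF l t = 0 := by
  unfold bumpF
  exact max_eq_left ((min_le_right _ _).trans (by linarith))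

theorem bumpFG (l t : ℝ) : bumpF l t * bumpG l t = bumpG l t := by
  rcases le_total |t - l| 1 with h | h
  · rw [bumpF_one l t h, one_mul]
  · rw [bumpG_zero l t h, mul_zero]

theorem bumpFF (l m t : ℝ) (h : 4 ≤ |l - m|) : bumpF l t * bumpF m t = 0 := by
  rcases le_total 2 |t - l| with h1 | h1
  · rw [bumpF_zero l t h1, zero_mul]
  · rw [bumpF_zero m t, mul_zero]
    have : |l - m| ≤ |t - l| + |t - m| := by
      rw [abs_sub_comm t l]; exact abs_sub_le l t m
    linarith

theorem core_bump (Φ : U →ₗ[ℂ] ℂ) (H : U) (hH : IsSelfAdjoint H) (l C : ℝ) (hC : 0 ≤ C)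
    (h : ∀ z, ‖Φ (H * z - (l : ℂ) • z)‖ ≤ C * ‖z‖) (z : U) :
    ‖Φ (z - cfc (bumpG l) H * z)‖ ≤ C * ‖z‖ := by
  set R : U := cfc (fun t : ℝ => (t - l) / max 1 ((t - l) ^ 2)) H with hR
  have e : cfc (bumpG l) H = 1 - (H - algebraMap ℝ U l) * R := by
    unfold bumpG
    have c1 := (bumpR_cont l).continuousOn (s := spectrum ℝ H)
    have c2 : ContinuousOn (fun t : ℝ => t - l) (spectrum ℝ H) := by fun_prop
    rw [cfc_sub (fun _ : ℝ => (1 : ℝ)) (fun t : ℝ => (t - l) * ((t - l) / max 1 ((t - l) ^ 2))) H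
      continuousOn_const (c2.mul c1), cfc_const_one ℝ H, cfc_mul _ _ H c2 c1,
      cfc_sub (fun t : ℝ => t) (fun _ : ℝ => l) H, cfc_id' ℝ H, cfc_const l H]
  have e2 : z - cfc (bumpG l) H * z = H * (R * z) - (l : ℂ) • (R * z) := by
    rw [e, Algebra.algebraMap_eq_smul_one, Complex.coe_smul]
    simp only [sub_mul, one_mul, smul_mul_assoc, mul_assoc]
    abel
  rw [e2]
  refine (h _).trans ?_
  have : ‖R‖ ≤ 1 := norm_cfc_le zero_le_one fun t _ => bumpR_le l t
  have := norm_mul_le R z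
  nlinarith [norm_nonneg z, mul_le_mul_of_nonneg_right ‹‖R‖ ≤ 1› (norm_nonneg z)]

theorem core_package {n : ℕ} (Φ : Fin n → U →ₗ[ℂ] ℂ) (hΦ : ∀ k z, ‖Φ k z‖ ≤ ‖z‖)
    (x : U) (y : Fin n → U) (hx : ‖x‖ ≤ 1) (hy : ∀ j, ‖y j‖ ≤ 1) {s : ℝ} (hs : 0 < s)
    (h1 : ∀ k, 1 - s ^ 2 / 2 ≤ (Φ k x).re) (h2 : ∀ k, 1 - s ^ 2 / 2 ≤ (Φ k (y k)).re)
    (h3 : ∀ k j, k ≠ j → 1 - s ^ 2 / 2 ≤ -(Φ k (y j)).re) :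
    ∃ H : U, IsSelfAdjoint H ∧ ∀ k z,
      ‖Φ k (z - cfc (bumpG (4 * (k : ℕ))) H * z)‖ ≤ (8 * n ^ 2 * s) * ‖z‖ := by
  set m : Fin n → U := fun j => (1 / 2 : ℂ) • (x + y j) with hm
  set m' : Fin n → U := fun j => (1 / 2 : ℂ) • (x - y j) with hm'
  have nm : ∀ j, ‖m j‖ ≤ 1 := fun j => by
    rw [hm, norm_smul]
    have := norm_add_le x (y j)
    norm_num; linarith [hy j]
  have nm' : ∀ j, ‖m' j‖ ≤ 1 := fun j => by
    rw [hm', norm_smul]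
    have := norm_sub_le x (y j)
    norm_num; linarith [hy j]
  have hd : ∀ k z, ‖Φ k (m k * star (m k) * z - z)‖ ≤ s * ‖z‖ := fun k z => by
    rw [← norm_neg, ← map_neg, neg_sub]
    refine core_left (Φ k) (hΦ k) (m k) (nm k) hs ?_ z
    simp only [hm, map_smul, map_add, smul_eq_mul]
    norm_num
    linarith [h1 k, h2 k]
  have ho : ∀ k j, k ≠ j → ∀ z, ‖Φ k (m j * star (m j) * z)‖ ≤ 2 * s * ‖z‖ := fun k j hkj z => by
    have a1 := core_left (Φ k) (hΦ k) (m' j) (nm' j) hs (by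
      simp only [hm', map_smul, map_sub, smul_eq_mul]
      norm_num
      linarith [h1 k, h3 k j hkj]) z
    have a2 := core_left (Φ k) (hΦ k) x hx hs (h1 k) z
    have a3 := core_left (Φ k) (hΦ k) (-(y j)) (by simpa using hy j) hs (by
      simpa using h3 k j hkj) z
    have e : m j * star (m j) * z = (z - m' j * star (m' j) * z) - (1 / 2 : ℂ) • ((z - x * star x * z) +
        (z - -(y j) * star (-(y j)) * z)) := by
      have hstar : star (1 / 2 : ℂ) = 1 / 2 := by simp
      simp only [hm, hm', star_smul, hstar, star_add, star_sub, star_neg, neg_mul_neg,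
        smul_mul_assoc, mul_smul_comm, mul_add, add_mul, mul_sub, sub_mul]
      module
    rw [e, map_sub, map_smul, map_add]
    refine (norm_sub_le _ _).trans ?_
    rw [norm_smul]
    have := norm_add_le (Φ k (z - x * star x * z)) (Φ k (z - -(y j) * star (-(y j)) * z))
    norm_num at this a1 a2 a3 ⊢
    linarith
  refine ⟨∑ j : Fin n, ((4 * (j : ℕ) : ℝ) : ℂ) • (m j * star (m j)), ?_, ?_⟩
  · rw [IsSelfAdjoint, star_sum]
    refine Finset.sum_congr rfl fun j _ => ?_
    simp
  · intro k z
    have hn : (0 : ℝ) ≤ 8 * n ^ 2 * s := by positivity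
    refine core_bump (Φ k) _ ?_ _ _ hn (fun z => ?_) z
    · rw [IsSelfAdjoint, star_sum]
      refine Finset.sum_congr rfl fun j _ => ?_
      simp
    have e : (∑ j : Fin n, ((4 * (j : ℕ) : ℝ) : ℂ) • (m j * star (m j))) * z
        - ((4 * (k : ℕ) : ℝ) : ℂ) • z = ∑ j : Fin n, ((4 * (j : ℕ) : ℝ) : ℂ) •
          (m j * star (m j) * z - if j = k then z else 0) := by
      simp only [smul_sub, Finset.sum_sub_distrib, Finset.sum_mul, smul_mul_assoc]
      congr 1
      simp
    rw [e, map_sum]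
    have bd : ∀ j ∈ (Finset.univ : Finset (Fin n)), ‖Φ k (((4 * (j : ℕ) : ℝ) : ℂ) •
          (m j * star (m j) * z - if j = k then z else 0))‖ ≤ 4 * n * (2 * s * ‖z‖) := by
      intro j _
      rw [map_smul, norm_smul, Complex.norm_real, Real.norm_of_nonneg (by positivity)]
      have hj : ((j : ℕ) : ℝ) ≤ n := by exact_mod_cast j.2.le
      refine mul_le_mul (by linarith) ?_ (norm_nonneg _) (by positivity)
      split_ifs with hjk
      · subst hjk
        refine (hd j z).trans ?_
        nlinarith [mul_nonneg hs.le (norm_nonneg z)]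
      · rw [sub_zero]; exact ho k j (Ne.symm hjk) z
    refine (norm_sum_le_of_le _ bd).trans ?_
    simp
    apply le_of_eq; ring

theorem four_le {n : ℕ} (i j : Fin n) (h : i ≠ j) :
    (4 : ℝ) ≤ |4 * ((i : ℕ) : ℝ) - 4 * ((j : ℕ) : ℝ)| := by
  have h1 : ((i : ℕ) : ℤ) - (j : ℕ) ≠ 0 := fun h2 => h (Fin.ext (by omega))
  have h2 := Int.one_le_abs h1
  have h3 : (1 : ℝ) ≤ |((i : ℕ) : ℝ) - ((j : ℕ) : ℝ)| := by exact_mod_cast h2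
  rw [← mul_sub, abs_mul]
  norm_num
  linarith

theorem bumpF_orth {n : ℕ} (H : U) (i j : Fin n) (h : i ≠ j) :
    cfc (bumpF (4 * (i : ℕ))) H * cfc (bumpF (4 * (j : ℕ))) H = 0 := by
  rw [← cfc_mul _ _ H (bumpF_cont _).continuousOn (bumpF_cont _).continuousOn]
  simp only [bumpFF _ _ _ (four_le i j h)]
  exact cfc_const_zero ℝ H

theorem bumpF_mul_G {n : ℕ} (H : U) (i : Fin n) :
    cfc (bumpF (4 * (i : ℕ))) H * cfc (bumpG (4 * (i : ℕ))) H = cfc (bumpG (4 * (i : ℕ))) H := by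
  rw [← cfc_mul _ _ H (bumpF_cont _).continuousOn (bumpG_cont _).continuousOn]
  simp only [bumpFG]

theorem bumpG_mul_F {n : ℕ} (H : U) (i : Fin n) :
    cfc (bumpG (4 * (i : ℕ))) H * cfc (bumpF (4 * (i : ℕ))) H = cfc (bumpG (4 * (i : ℕ))) H := by
  rw [← cfc_mul _ _ H (bumpG_cont _).continuousOn (bumpF_cont _).continuousOn]
  simp only [mul_comm (bumpG _ _), bumpFG]

/-- the adjoint functional -/
noncomputable def starFun (Φ : U →ₗ[ℂ] ℂ) : U →ₗ[ℂ] ℂ where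
  toFun z := star (Φ (star z))
  map_add' z w := by simp
  map_smul' c z := by simp

theorem starFun_apply (Φ : U →ₗ[ℂ] ℂ) (z : U) : starFun Φ z = star (Φ (star z)) := rfl

theorem core_orth {n : ℕ} (H K : U) (hH : IsSelfAdjoint H) (hK : IsSelfAdjoint K)
    (x : Fin n → U) (hx : ∀ k, ‖x k‖ ≤ 1) :
    ‖∑ k : Fin n, cfc (bumpF (4 * (k : ℕ))) H * x k * cfc (bumpF (4 * (k : ℕ))) K‖ ≤ 1 := by
  set f : Fin n → U := fun k => cfc (bumpF (4 * (k : ℕ))) H with hf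
  set f' : Fin n → U := fun k => cfc (bumpF (4 * (k : ℕ))) K with hf'
  have sf : ∀ k, star (f k) = f k := fun k => (cfc_predicate (R := ℝ) (p := IsSelfAdjoint) _ H).star_eq
  have sf' : ∀ k, star (f' k) = f' k := fun k => (cfc_predicate (R := ℝ) (p := IsSelfAdjoint) _ K).star_eq
  have of : ∀ i j, i ≠ j → f i * f j = 0 := fun i j hij => bumpF_orth H i j hij
  change ‖∑ k, f k * x k * f' k‖ ≤ 1
  set y := ∑ k, f k * x k * f' k with hy
  have e : star y * y = ∑ k, f' k * (star (f k * x k) * (f k * x k)) * f' k := by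
    rw [hy, star_sum, Finset.sum_mul_sum]
    refine Finset.sum_congr rfl fun i _ => ?_
    rw [Finset.sum_eq_single i]
    · simp only [star_mul, sf, sf', mul_assoc]
    · intro j _ hj
      have := of i j (Ne.symm hj)
      simp only [star_mul, sf, sf']
      calc f' i * (star (x i) * f i) * (f j * x j * f' j)
          = f' i * star (x i) * (f i * f j) * (x j * f' j) := by noncomm_ring
        _ = 0 := by rw [this]; simp
    · simp
  have nf : ∀ k, ‖f k‖ ≤ 1 := fun k => norm_cfc_le zero_le_one fun t _ => by
    rw [Real.norm_of_nonneg (bumpF_mem _ t).1]; exact (bumpF_mem _ t).2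
  have h1 : ∀ k, star (f k * x k) * (f k * x k) ≤ 1 := fun k => by
    refine CStarAlgebra.star_mul_le_algebraMap_norm_sq.trans ?_
    rw [← map_one (algebraMap ℝ U)]
    refine algebraMap_mono U ?_
    have : ‖f k * x k‖ ≤ 1 := (norm_mul_le _ _).trans
      (mul_le_one₀ (nf k) (norm_nonneg _) (hx k))
    nlinarith [norm_nonneg (f k * x k)]
  have h2 : star y * y ≤ ∑ k, f' k * f' k := by
    rw [e]
    refine Finset.sum_le_sum fun k _ => ?_
    have := star_right_conjugate_le_conjugate (h1 k) (f' k)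
    rwa [sf', mul_one] at this
  have h3 : ∑ k, f' k * f' k ≤ 1 := by
    have : ∀ k, f' k * f' k = cfc (fun t => bumpF (4 * (k : ℕ)) t * bumpF (4 * (k : ℕ)) t) K :=
      fun k => (cfc_mul _ _ K (bumpF_cont _).continuousOn (bumpF_cont _).continuousOn).symm
    simp only [this]
    rw [← cfc_sum_univ (fun (k : Fin n) t => bumpF (4 * (k : ℕ)) t * bumpF (4 * (k : ℕ)) t) K (fun i => ((bumpF_cont _).mul (bumpF_cont _)).continuousOn)]
    refine cfc_le_one _ _ fun t _ => ?_
    rw [Finset.sum_apply]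
    by_cases hh : ∃ k : Fin n, bumpF (4 * (k : ℕ)) t ≠ 0
    · obtain ⟨k, hk⟩ := hh
      rw [Finset.sum_eq_single k]
      · have := bumpF_mem (4 * (k : ℕ)) t
        nlinarith [this.1, this.2]
      · intro j _ hj
        have := bumpFF _ _ t (four_le j k hj)
        rcases mul_eq_zero.1 this with h | h
        · rw [h, zero_mul]
        · exact absurd h hk
      · simp
    · push Not at hh
      simp [hh]
  have h4 := (CStarAlgebra.norm_le_one_iff_of_nonneg _ (star_mul_self_nonneg y)).2 (h2.trans h3)
  rw [CStarRing.norm_star_mul_self] at h4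
  nlinarith [norm_nonneg y]
end Core

theorem exists_phase (v : ℂ) : ∃ θ : ℂ, ‖θ‖ ≤ 1 ∧ θ * v = (‖v‖ : ℂ) := by
  rcases eq_or_ne v 0 with rfl | h
  · exact ⟨0, by simp, by simp⟩
  · have hv : (‖v‖ : ℂ) ≠ 0 := by exact_mod_cast norm_ne_zero_iff.2 h
    refine ⟨star v / ‖v‖, ?_, ?_⟩
    · rw [norm_div, norm_star, Complex.norm_real, norm_norm]
      exact div_self_le_one _
    · have : star v * v = (‖v‖ : ℂ) ^ 2 := by
        rw [mul_comm]; simpa using Complex.mul_conj' v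
      rw [div_mul_eq_mul_div, this]; field_simp

section Main
variable {A : Type*} [NonUnitalCStarAlgebra A]

theorem inr_snd_ideal (u v : Unitization ℂ A) (x : A) :
    ((u * (x : Unitization ℂ A) * v).snd : Unitization ℂ A) = u * (x : Unitization ℂ A) * v := by
  ext <;> simp

theorem exists_ext (φ : A →L[ℂ] ℂ) (h : ‖φ‖ ≤ 1) : ∃ Φ : Unitization ℂ A →ₗ[ℂ] ℂ,
    (∀ z, ‖Φ z‖ ≤ ‖z‖) ∧ ∀ x : A, Φ (x : Unitization ℂ A) = φ x := by
  let p : Submodule ℂ (Unitization ℂ A) := LinearMap.range (Unitization.inrHom ℂ ℂ A)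
  have hp : ∀ u : p, ‖(u : Unitization ℂ A).snd‖ = ‖u‖ := by
    rintro ⟨_, x, rfl⟩
    simp [Unitization.norm_inr]
  let f : p →L[ℂ] ℂ := LinearMap.mkContinuous
    ((φ : A →ₗ[ℂ] ℂ) ∘ₗ (Unitization.sndHom ℂ ℂ A) ∘ₗ p.subtype) 1 (fun u => by
      refine (φ.le_of_opNorm_le h _).trans ?_
      exact (congrArg (fun t => 1 * t) (hp u)).le)
  obtain ⟨g, hg, hn⟩ := exists_extension_norm_eq p f
  have hf : ‖f‖ ≤ 1 := LinearMap.mkContinuous_norm_le _ zero_le_one _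
  refine ⟨g, fun z => ?_, fun x => ?_⟩
  · simpa using g.le_of_opNorm_le (hn.trans_le hf) z
  · exact hg ⟨_, x, rfl⟩

theorem core_main {n : ℕ} (φ : Fin n → A →L[ℂ] ℂ) (hφ : ∀ k, ‖φ k‖ ≤ 1)
    (x : A) (y : Fin n → A) (hx : ‖x‖ ≤ 1) (hy : ∀ j, ‖y j‖ ≤ 1) {s : ℝ} (hs : 0 < s)
    (h1 : ∀ k, 1 - s ^ 2 / 2 ≤ (φ k x).re) (h2 : ∀ k, 1 - s ^ 2 / 2 ≤ (φ k (y k)).re)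
    (h3 : ∀ k j, k ≠ j → 1 - s ^ 2 / 2 ≤ -(φ k (y j)).re) :
    (∃ a : Fin n → A,
      (∀ i j, i ≠ j → a i * star (a j) = 0 ∧ star (a j) * a i = 0) ∧
      (∀ j, ‖a j‖ ≤ 1) ∧
      (∀ j, 1 - s ^ 2 / 2 - 2 * (8 * n ^ 2 * s) ≤ (φ j (a j)).re)) ∧
    (∃ ψ : Fin n → A →L[ℂ] ℂ,
      (∀ j, ‖ψ j‖ ≤ 1) ∧
      (∀ j, ‖φ j - ψ j‖ ≤ 2 * (8 * n ^ 2 * s)) ∧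
      (∀ α : Fin n → ℂ, ∑ j, ‖α j‖ * ‖ψ j‖ ≤ ‖∑ j, α j • ψ j‖)) := by
  let _ : PartialOrder (Unitization ℂ A) := CStarAlgebra.spectralOrder _
  have _ : StarOrderedRing (Unitization ℂ A) := CStarAlgebra.spectralOrderedRing _
  choose Φ hΦ hΦφ using fun k => exists_ext (φ k) (hφ k)
  set C : ℝ := 8 * n ^ 2 * s with hC
  have hC0 : 0 ≤ C := by positivity
  obtain ⟨H, hH, gH⟩ := core_package Φ hΦ (x : Unitization ℂ A) (fun j => (y j : Unitization ℂ A))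
    (by rwa [Unitization.norm_inr]) (fun j => by rw [Unitization.norm_inr]; exact hy j) hs
    (fun k => by rw [hΦφ]; exact h1 k) (fun k => by rw [hΦφ]; exact h2 k)
    (fun k j hkj => by rw [hΦφ]; exact h3 k j hkj)
  obtain ⟨K, hK, gK⟩ := core_package (fun k => starFun (Φ k))
    (fun k z => by rw [starFun_apply, norm_star, ← norm_star z]; exact hΦ k _)
    (star (x : Unitization ℂ A)) (fun j => star (y j : Unitization ℂ A))
    (by rwa [norm_star, Unitization.norm_inr])
    (fun j => by rw [norm_star, Unitization.norm_inr]; exact hy j) hs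
    (fun k => by simpa [starFun_apply, hΦφ] using h1 k)
    (fun k => by simpa [starFun_apply, hΦφ] using h2 k)
    (fun k j hkj => by simpa [starFun_apply, hΦφ] using h3 k j hkj)
  set g : Fin n → Unitization ℂ A := fun k => cfc (bumpG (4 * (k : ℕ))) H with hg
  set g' : Fin n → Unitization ℂ A := fun k => cfc (bumpG (4 * (k : ℕ))) K with hg'
  set f : Fin n → Unitization ℂ A := fun k => cfc (bumpF (4 * (k : ℕ))) H with hf
  set f' : Fin n → Unitization ℂ A := fun k => cfc (bumpF (4 * (k : ℕ))) K with hf'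
  have sg : ∀ k, star (g k) = g k := fun k => (cfc_predicate (R := ℝ) (p := IsSelfAdjoint) _ H).star_eq
  have sg' : ∀ k, star (g' k) = g' k := fun k => (cfc_predicate (R := ℝ) (p := IsSelfAdjoint) _ K).star_eq
  have ng : ∀ k, ‖g k‖ ≤ 1 := fun k => norm_cfc_le zero_le_one fun t _ => by
    rw [Real.norm_of_nonneg (bumpG_mem _ t).1]; exact (bumpG_mem _ t).2
  have ng' : ∀ k, ‖g' k‖ ≤ 1 := fun k => norm_cfc_le zero_le_one fun t _ => by
    rw [Real.norm_of_nonneg (bumpG_mem _ t).1]; exact (bumpG_mem _ t).2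
  have gf : ∀ k, g k * f k = g k := fun k => bumpG_mul_F H k
  have fg' : ∀ k, f' k * g' k = g' k := fun k => bumpF_mul_G K k
  have fg : ∀ k, f k * g k = g k := fun k => bumpF_mul_G H k
  have gf' : ∀ k, g' k * f' k = g' k := fun k => bumpG_mul_F K k
  have of : ∀ i j, i ≠ j → f i * f j = 0 := fun i j hij => bumpF_orth H i j hij
  have of' : ∀ i j, i ≠ j → f' i * f' j = 0 := fun i j hij => bumpF_orth K i j hij
  have ogf : ∀ i j, i ≠ j → g i * f j = 0 := fun i j hij => by
    rw [← gf, mul_assoc, of i j hij, mul_zero]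
  have ogg : ∀ i j, i ≠ j → g i * g j = 0 := fun i j hij => by
    rw [← fg j, ← mul_assoc, ogf i j hij, zero_mul]
  have ogg' : ∀ i j, i ≠ j → g' i * g' j = 0 := fun i j hij => by
    rw [← gf' i, ← fg' j, mul_assoc, ← mul_assoc (f' i), of' i j hij, zero_mul, mul_zero]
  have gK' : ∀ k z, ‖Φ k (z - z * g' k)‖ ≤ C * ‖z‖ := fun k z => by
    have := gK k (star z)
    rw [starFun_apply, norm_star, norm_star, star_sub, star_mul, star_star] at this
    change ‖Φ k (z - z * star (g' k))‖ ≤ C * ‖z‖ at this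
    rwa [sg'] at this
  have gHK : ∀ k z, ‖Φ k (z - g k * z * g' k)‖ ≤ 2 * C * ‖z‖ := fun k z => by
    have e : z - g k * z * g' k = (z - g k * z) + (g k * z - g k * z * g' k) := by abel
    rw [e, map_add]
    refine (norm_add_le _ _).trans ?_
    have b1 := gH k z
    have b2 := gK' k (g k * z)
    have b3 : ‖g k * z‖ ≤ ‖z‖ := (norm_mul_le _ _).trans
      (mul_le_of_le_one_left (norm_nonneg _) (ng k))
    have b4 := mul_le_mul_of_nonneg_left b3 hC0
    change ‖Φ k (z - g k * z)‖ ≤ C * ‖z‖ at b1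
    linarith
  have nsand : ∀ k z, ‖g k * z * g' k‖ ≤ ‖z‖ := fun k z => by
    calc ‖g k * z * g' k‖ ≤ ‖g k‖ * ‖z‖ * ‖g' k‖ :=
          (norm_mul_le _ _).trans (by gcongr; exact norm_mul_le _ _)
      _ ≤ 1 * ‖z‖ * 1 := by gcongr; exact ng k; exact ng' k
      _ = ‖z‖ := by ring
  constructor
  · refine ⟨fun j => (g j * (x : Unitization ℂ A) * g' j).snd, fun i j hij => ⟨?_, ?_⟩,
      fun j => ?_, fun j => ?_⟩
    · apply Unitization.inr_injective (R := ℂ)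
      rw [Unitization.inr_mul, Unitization.inr_star, inr_snd_ideal, inr_snd_ideal,
        Unitization.inr_zero]
      simp only [star_mul, sg, sg']
      calc _ = g i * (x : Unitization ℂ A) * (g' i * g' j) * (star (x : Unitization ℂ A) * g j) := by
            noncomm_ring
        _ = 0 := by rw [ogg' i j hij]; simp
    · apply Unitization.inr_injective (R := ℂ)
      rw [Unitization.inr_mul, Unitization.inr_star, inr_snd_ideal, inr_snd_ideal,
        Unitization.inr_zero]
      simp only [star_mul, sg, sg']
      calc _ = g' j * star (x : Unitization ℂ A) * (g j * g i) * ((x : Unitization ℂ A) * g' i) := by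
            noncomm_ring
        _ = 0 := by rw [ogg j i hij.symm]; simp
    · rw [← Unitization.norm_inr (𝕜 := ℂ), inr_snd_ideal]
      exact (nsand j _).trans (by rwa [Unitization.norm_inr])
    · rw [← hΦφ, inr_snd_ideal]
      have b := gHK j (x : Unitization ℂ A)
      rw [map_sub] at b
      have b2 := (Complex.re_le_norm _).trans b
      rw [Complex.sub_re, hΦφ, Unitization.norm_inr] at b2
      have b3 : 2 * C * ‖x‖ ≤ 2 * C := by nlinarith
      linarith [h1 j]
  · let ψ : Fin n → A →L[ℂ] ℂ := fun j => LinearMap.mkContinuous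
      { toFun := fun z => Φ j (g j * (z : Unitization ℂ A) * g' j)
        map_add' := fun z w => by rw [Unitization.inr_add, mul_add, add_mul, map_add]
        map_smul' := fun c z => by
          rw [Unitization.inr_smul, mul_smul_comm, smul_mul_assoc, map_smul]; rfl } 1
      (fun z => by
        rw [one_mul, ← Unitization.norm_inr (𝕜 := ℂ) z]
        exact (hΦ j _).trans (nsand j _))
    have ψa : ∀ j z, ψ j z = Φ j (g j * (z : Unitization ℂ A) * g' j) := fun j z => rfl
    have key : ∀ (α : Fin n → ℂ) (w : Fin n → A), (∀ j, ‖w j‖ ≤ 1) →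
        ∑ j, ‖α j‖ * ‖ψ j (w j)‖ ≤ ‖∑ j, α j • ψ j‖ := by
      intro α w hw
      choose θ hθ1 hθ2 using fun j => exists_phase (α j * ψ j (w j))
      set Y : A := ∑ k, (f k * ((θ k • w k : A) : Unitization ℂ A) * f' k).snd with hY
      have eY : (Y : Unitization ℂ A) = ∑ k, f k * ((θ k • w k : A) : Unitization ℂ A) * f' k := by
        rw [hY]
        change Unitization.inrHom ℂ ℂ A _ = _
        rw [map_sum]
        exact Finset.sum_congr rfl fun k _ => inr_snd_ideal _ _ _
      have nY : ‖Y‖ ≤ 1 := by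
        rw [← Unitization.norm_inr (𝕜 := ℂ), eY]
        refine core_orth H K hH hK _ fun k => ?_
        rw [Unitization.norm_inr, norm_smul]
        exact mul_le_one₀ (hθ1 k) (norm_nonneg _) (hw k)
      have ev : ∀ j, ψ j Y = θ j * ψ j (w j) := fun j => by
        rw [← smul_eq_mul, ← map_smul, ψa, ψa, eY, Finset.mul_sum, Finset.sum_mul,
          Finset.sum_eq_single j]
        · congr 1
          calc _ = (g j * f j) * ((θ j • w j : A) : Unitization ℂ A) * (f' j * g' j) := by
                noncomm_ring
            _ = _ := by rw [gf, fg']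
        · intro k _ hk
          calc _ = (g j * f k) * ((θ k • w k : A) : Unitization ℂ A) * (f' k * g' j) := by
                noncomm_ring
            _ = _ := by rw [ogf j k hk.symm]; simp
        · simp
      have ev2 : (∑ j, α j • ψ j) Y = ((∑ j, ‖α j‖ * ‖ψ j (w j)‖ : ℝ) : ℂ) := by
        rw [_root_.sum_apply, Complex.ofReal_sum]
        refine Finset.sum_congr rfl fun j _ => ?_
        rw [_root_.smul_apply, ev, smul_eq_mul, ← norm_mul, ← hθ2]
        ring
      have := (∑ j, α j • ψ j).le_opNorm_of_le nY
      rw [ev2, Complex.norm_real, mul_one] at this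
      exact (le_abs_self _).trans this
    have nψ : ∀ j, ‖ψ j‖ ≤ 1 := fun j => LinearMap.mkContinuous_norm_le _ zero_le_one _
    refine ⟨ψ, nψ, fun j => ?_, fun α => ?_⟩
    · refine ContinuousLinearMap.opNorm_le_bound _ (by positivity) fun z => ?_
      rw [_root_.sub_apply, ψa, ← hΦφ, ← map_sub, ← Unitization.norm_inr (𝕜 := ℂ) z]
      exact gHK j _
    · refine le_of_forall_pos_le_add fun e he => ?_
      set S : ℝ := 1 + ∑ j, ‖α j‖ with hS
      have hS1 : 0 ≤ ∑ j, ‖α j‖ := Finset.sum_nonneg fun _ _ => norm_nonneg _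
      have hS0 : 0 < S := by positivity
      have : ∀ j, ∃ w : A, ‖w‖ ≤ 1 ∧ ‖ψ j‖ - e / S ≤ ‖ψ j w‖ := fun j => by
        obtain ⟨w, hw1, hw2⟩ := (ψ j).exists_lt_apply_of_lt_opNorm
          (r := ‖ψ j‖ - e / S) (by linarith [div_pos he hS0])
        exact ⟨w, hw1.le, hw2.le⟩
      choose w hw1 hw2 using this
      have k1 := key α w hw1
      have k2 : ∑ j, ‖α j‖ * (‖ψ j‖ - e / S) ≤ ∑ j, ‖α j‖ * ‖ψ j (w j)‖ :=
        Finset.sum_le_sum fun j _ => mul_le_mul_of_nonneg_left (hw2 j) (norm_nonneg _)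
      have k3 : ∑ j, ‖α j‖ * (‖ψ j‖ - e / S) = ∑ j, ‖α j‖ * ‖ψ j‖ - (∑ j, ‖α j‖) * (e / S) := by
        simp only [mul_sub, Finset.sum_sub_distrib, Finset.sum_mul]
      have k4 : (∑ j, ‖α j‖) * (e / S) ≤ e := by
        rw [mul_div_assoc', div_le_iff₀ hS0, hS]; nlinarith
      linarith
end Main

theorem exists_point {A : Type*} [NonUnitalCStarAlgebra A] {n : ℕ} (φ : Fin n → A →L[ℂ] ℂ)
    {δ : ℝ} (hδ : 0 < δ) (hφ : ∀ k, ‖φ k‖ ≤ 1) (α : Fin n → ℂ) (hα : ∀ j, ‖α j‖ = 1)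
    (h : (1 - δ) * ∑ j, ‖α j‖ ≤ ‖∑ j, α j • φ j‖) :
    ∃ x : A, ‖x‖ ≤ 1 ∧ ∀ k, 1 - (n + 1) * δ ≤ (α k * φ k x).re := by
  simp only [hα, Finset.sum_const, Finset.card_univ, Fintype.card_fin, nsmul_eq_mul, mul_one] at h
  obtain ⟨w, hw1, hw2⟩ := (∑ j, α j • φ j).exists_lt_apply_of_lt_opNorm
    (r := (1 - δ) * n - δ) (by linarith)
  obtain ⟨θ, hθ1, hθ2⟩ := exists_phase ((∑ j, α j • φ j) w)
  have hx : ‖θ • w‖ ≤ 1 := by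
    rw [norm_smul]; exact mul_le_one₀ hθ1 (norm_nonneg _) hw1.le
  refine ⟨θ • w, hx, fun k => ?_⟩
  have e : ∑ j, (α j * φ j (θ • w)).re = ‖(∑ j, α j • φ j) w‖ := by
    rw [← Complex.re_sum, ← Complex.ofReal_re ‖(∑ j, α j • φ j) w‖, ← hθ2, ← smul_eq_mul θ,
      ← map_smul]
    congr 1
    rw [_root_.sum_apply]
    rfl
  have b : ∀ j, (α j * φ j (θ • w)).re ≤ 1 := fun j => by
    refine (Complex.re_le_norm _).trans ?_
    rw [norm_mul, hα, one_mul]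
    simpa using ((φ j).le_opNorm_of_le hx).trans (by simpa using hφ j)
  have e2 : ∑ j, (1 - (α j * φ j (θ • w)).re) = n - ‖(∑ j, α j • φ j) w‖ := by
    rw [Finset.sum_sub_distrib, e]; simp
  have e3 := Finset.single_le_sum (f := fun j => 1 - (α j * φ j (θ • w)).re)
    (fun j _ => sub_nonneg.2 (b j)) (Finset.mem_univ k)
  linarith



/-- Quantitative perturbation of `ℓ₁(n)`-copies in duals of C*-algebras:
for every `ε > 0` and `n ≥ 1` there is `δ = δ(n, ε) > 0`, uniform over all C*-algebras,
such that if `φ₁, …, φₙ` span `ℓ₁(n)` `(1 - δ)`-isomorphically, then (i) there are pairwise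
orthogonal norm-one elements `a₁, …, aₙ` with `Re φⱼ(aⱼ) > 1 - ε`, and (ii) there are
norm-one functionals `φ̃₁, …, φ̃ₙ` with `‖φⱼ - φ̃ⱼ‖ < ε` spanning `ℓ₁(n)` isometrically. -/
theorem quantitative_l_orthogonality_n_functionals :
    ∀ ε > (0 : ℝ), ∀ n : ℕ, 1 ≤ n → ∃ δ > (0 : ℝ),
      ∀ (A : Type u) [inst : NonUnitalCStarAlgebra A] (φ : Fin n → A →L[ℂ] ℂ),
        (∀ α : Fin n → ℂ,
          ‖∑ j, α j • φ j‖ ≤ ∑ j, ‖α j‖ ∧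
          (1 - δ) * ∑ j, ‖α j‖ ≤ ‖∑ j, α j • φ j‖) →
        (∃ a : Fin n → A,
          (∀ i j, i ≠ j → a i * star (a j) = 0 ∧ star (a j) * a i = 0) ∧
          (∀ j, ‖a j‖ = 1) ∧
          (∀ j, 1 - ε < (φ j (a j)).re)) ∧
        (∃ ψ : Fin n → A →L[ℂ] ℂ,
          (∀ j, ‖ψ j‖ = 1) ∧
          (∀ j, ‖φ j - ψ j‖ < ε) ∧
          (∀ α : Fin n → ℂ, ‖∑ j, α j • ψ j‖ = ∑ j, ‖α j‖)) := by
  intro ε hε n hn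
  set e : ℝ := min ε (1 / 2) with he
  have he0 : 0 < e := lt_min hε (by norm_num)
  have he1 : e ≤ ε := min_le_left _ _
  have he2 : e ≤ 1 / 2 := min_le_right _ _
  have hn1 : (1 : ℝ) ≤ n := by exact_mod_cast hn
  set s : ℝ := e / (64 * n ^ 2) with hs
  have hs0 : 0 < s := by positivity
  have hCs : 8 * (n : ℝ) ^ 2 * s = e / 8 := by rw [hs]; field_simp; norm_num
  have hs1 : s ≤ e := div_le_self he0.le (by nlinarith)
  have hs2 : s ^ 2 / 2 ≤ e / 4 := by nlinarith
  have hs3 : 0 < s ^ 2 / 2 := by positivity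
  refine ⟨s ^ 2 / 2 / (n + 1), by positivity, ?_⟩
  intro A inst φ h
  have hδ : 0 < s ^ 2 / 2 / ((n : ℝ) + 1) := by positivity
  have hδn : ((n : ℝ) + 1) * (s ^ 2 / 2 / ((n : ℝ) + 1)) = s ^ 2 / 2 := by field_simp
  set δ : ℝ := s ^ 2 / 2 / ((n : ℝ) + 1) with hδd
  have hδ1 : δ ≤ s ^ 2 / 2 := by nlinarith
  have hsing : ∀ k, ‖φ k‖ ≤ 1 ∧ 1 - δ ≤ ‖φ k‖ := fun k => by
    have := h (Pi.single k 1)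
    have e1 : ∑ j, (Pi.single k (1 : ℂ) : Fin n → ℂ) j • φ j = φ k := by
      rw [Finset.sum_eq_single k]
      · simp
      · intro j _ hj; ext z; simp [hj]
      · simp
    have e2 : ∑ j, ‖(Pi.single k (1 : ℂ) : Fin n → ℂ) j‖ = 1 := by
      rw [Finset.sum_eq_single k]
      · simp
      · intro j _ hj; simp [hj]
      · simp
    rw [e1, e2, mul_one] at this
    exact this
  obtain ⟨x, hx, hx1⟩ := exists_point φ hδ (fun k => (hsing k).1) (fun _ => 1) (by simp) (h _).2
  have hY : ∀ j : Fin n, ∃ y : A, ‖y‖ ≤ 1 ∧ ∀ k, 1 - (n + 1) * δ ≤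
      ((if k = j then (1 : ℂ) else -1) * φ k y).re := fun j =>
    exists_point φ hδ (fun k => (hsing k).1) (fun k => if k = j then (1 : ℂ) else -1)
      (fun k => by split_ifs <;> simp) (h _).2
  choose y hy hy1 using hY
  rw [hδn] at hx1
  rw [hδn] at hy1
  obtain ⟨⟨a, ha1, ha2, ha3⟩, ψ, hψ1, hψ2, hψ3⟩ := core_main φ (fun k => (hsing k).1) x y hx hy hs0
    (fun k => by simpa using hx1 k) (fun k => by simpa using hy1 k k)
    (fun k j hkj => by simpa [hkj] using hy1 j k)
  rw [hCs] at ha3 hψ2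
  constructor
  · have hpos : ∀ j, 0 < ‖a j‖ := fun j => by
      rw [norm_pos_iff]
      intro h0
      have := ha3 j
      rw [h0] at this
      simp at this
      linarith
    refine ⟨fun j => ((‖a j‖⁻¹ : ℝ) : ℂ) • a j, fun i j hij => ?_, fun j => ?_, fun j => ?_⟩
    · obtain ⟨q1, q2⟩ := ha1 i j hij
      simp only [star_smul, smul_mul_assoc, mul_smul_comm, q1, q2, smul_zero, and_self]
    · rw [norm_smul, Complex.norm_real, norm_inv, norm_norm, inv_mul_cancel₀ (hpos j).ne']
    · rw [map_smul, smul_eq_mul, Complex.re_ofReal_mul]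
      have b1 : 1 ≤ ‖a j‖⁻¹ := (one_le_inv₀ (hpos j)).2 (ha2 j)
      have b2 := ha3 j
      have b3 : 0 ≤ (φ j (a j)).re := by linarith
      nlinarith
  · have low : ∀ j, 1 - δ - 2 * (e / 8) ≤ ‖ψ j‖ := fun j => by
      have := norm_sub_norm_le (φ j) (ψ j)
      linarith [hψ2 j, (hsing j).2]
    have hpos : ∀ j, 0 < ‖ψ j‖ := fun j => by linarith [low j]
    have nn : ∀ j, ‖((‖ψ j‖⁻¹ : ℝ) : ℂ) • ψ j‖ = 1 := fun j => by
      rw [norm_smul, Complex.norm_real, norm_inv, norm_norm, inv_mul_cancel₀ (hpos j).ne']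
    refine ⟨fun j => ((‖ψ j‖⁻¹ : ℝ) : ℂ) • ψ j, nn, fun j => ?_, fun α => ?_⟩
    · have e1 : φ j - ((‖ψ j‖⁻¹ : ℝ) : ℂ) • ψ j =
          (φ j - ψ j) - ((‖ψ j‖⁻¹ - 1 : ℝ) : ℂ) • ψ j := by
        ext z; simp; ring
      rw [e1]
      refine (norm_sub_le _ _).trans_lt ?_
      have b1 : 1 ≤ ‖ψ j‖⁻¹ := (one_le_inv₀ (hpos j)).2 (hψ1 j)
      rw [norm_smul, Complex.norm_real, Real.norm_of_nonneg (by linarith), sub_mul,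
        inv_mul_cancel₀ (hpos j).ne', one_mul]
      linarith [hψ2 j, low j]
    · apply le_antisymm
      · refine norm_sum_le_of_le _ fun j _ => ?_
        rw [norm_smul, nn, mul_one]
      · have := hψ3 (fun j => α j * ((‖ψ j‖⁻¹ : ℝ) : ℂ))
        simp only [mul_smul] at this
        refine le_trans (le_of_eq ?_) this
        refine Finset.sum_congr rfl fun j _ => ?_
        rw [norm_mul, Complex.norm_real, norm_inv, norm_norm, mul_assoc,
          inv_mul_cancel₀ (hpos j).ne', mul_one]
end

section
/- Let A be a C*-algebra, let 0 < r ≤ 1, and let (φ_m)_{m∈ℕ} be a sequence of continuous linear functionals on A with ‖φ_m‖ = 1 for all m, spanning ℓ1 r-isomorphically, i.e. ‖∑_m α_m φ_m‖ ≥ r ∑_m |α_m| for all finitely supported families of complex scalars (α_m). Then for every ε > 0 there exist a strictly increasing sequence (m_n) of natural numbers and a sequence (c_n) of pairwise orthogonal elements of A (c_n·c_k* = 0 and c_k*·c_n = 0 for n ≠ k) with ‖c_n‖ = 1 and Re φ_{m_n}(c_n) > r(1 − ε) for every n. -/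
namespace L1Orth

section order
variable {A : Type*} [NonUnitalCStarAlgebra A] [PartialOrder A] [StarOrderedRing A]

open scoped InnerProductSpace WithCStarModule in
/-- operator Cauchy-Schwarz inequality -/
lemma cauchy_schwarz {ι : Type*} [Fintype ι] (x z : ι → A) :
    ‖∑ i, x i * z i‖ ≤ √‖∑ i, x i * star (x i)‖ * √‖∑ i, star (z i) * z i‖ := by
  let X : C⋆ᵐᵒᵈ(A, ι → A) := (WithCStarModule.equiv A (ι → A)).symm x
  let Z : C⋆ᵐᵒᵈ(A, ι → A) := (WithCStarModule.equiv A (ι → A)).symm (fun i => star (z i))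
  have h := CStarModule.norm_inner_le (A := A) (C⋆ᵐᵒᵈ(A, ι → A)) (x := Z) (y := X)
  rw [WithCStarModule.pi_inner, WithCStarModule.pi_norm, WithCStarModule.pi_norm, mul_comm] at h
  simpa [X, Z, WithCStarModule.inner_def] using h

lemma left_contract (e x : A) (he : IsSelfAdjoint e) (h : 0 ≤ e + e - e * e) :
    ‖x - e * x‖ ≤ ‖x‖ := by
  have h1 : star (x - e * x) * (x - e * x) = star x * x - star x * (e + e - e * e) * x := by
    simp only [star_sub, star_mul, he.star_eq]
    noncomm_ring
  have h2 : ‖star (x - e * x) * (x - e * x)‖ ≤ ‖star x * x‖ := by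
    apply CStarAlgebra.norm_le_norm_of_nonneg_of_le (star_mul_self_nonneg _)
    rw [h1]
    exact sub_le_self _ (star_left_conjugate_nonneg h x)
  rw [CStarRing.norm_star_mul_self, CStarRing.norm_star_mul_self] at h2
  exact abs_le_of_sq_le_sq' (by nlinarith) (norm_nonneg _) |>.2

lemma right_contract (e x : A) (he : IsSelfAdjoint e) (h : 0 ≤ e + e - e * e) :
    ‖x - x * e‖ ≤ ‖x‖ := by
  have := left_contract e (star x) he h
  rw [← norm_star, star_sub, star_mul, he.star_eq]
  simpa using this

lemma alg1 (y s h : A) : (h * s - s) * (y * h - y)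
    = h * (s * y) * h - h * (s * y) - (s * y * h - s * y) := by
  noncomm_ring

lemma alg2 (y s k : A) : y * (k * s) + y * (k * s) - y * (k * s) * (y * (k * s))
    = y * (k + k - k * s * y * k) * s := by
  noncomm_ring

set_option maxHeartbeats 2000000 in
lemma fc (δ : ℝ) (hδ : 0 < δ) : ∃ K : ℝ, 0 ≤ K ∧ ∀ y : A, ‖y‖ ≤ 1 → ∃ w u c : A,
    ‖w‖ ≤ K ∧ c = y * u * y ∧ ‖c‖ ≤ 1 ∧ ‖c - y‖ ≤ δ ∧ (y * w) * c = c ∧ c * (w * y) = c ∧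
    IsSelfAdjoint (y * w) ∧ IsSelfAdjoint (w * y) ∧
    (∀ x, ‖x - y * w * x‖ ≤ ‖x‖) ∧ (∀ x, ‖x - x * (w * y)‖ ≤ ‖x‖) := by
  obtain ⟨η, hη, hηδ⟩ : ∃ η : ℝ, 0 < η ∧ 3 * η ≤ δ ^ 2 := ⟨δ ^ 2 / 3, by positivity, by linarith⟩
  let χ : ℝ → ℝ := fun t => max 0 (min 1 ((t - η) / η))
  let h : ℝ → ℝ := fun t => max 0 (min 1 ((t - 2 * η) / η))
  let k : ℝ → ℝ := fun t => χ t / max t η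
  let l : ℝ → ℝ := fun t => h t / max t η
  have hm : ∀ t, max t η ≠ 0 := fun t => (lt_of_lt_of_le hη (le_max_right _ _)).ne'
  have hχc : Continuous χ := by fun_prop
  have hhc : Continuous h := by fun_prop
  have hkc : Continuous k := hχc.div (by fun_prop) hm
  have hlc : Continuous l := hhc.div (by fun_prop) hm
  have χ0 : ∀ t ≤ η, χ t = 0 := fun t ht => by
    have : (t - η) / η ≤ 0 := div_nonpos_of_nonpos_of_nonneg (by linarith) hη.le
    exact max_eq_left ((min_le_right _ _).trans this)
  have h0 : ∀ t ≤ 2 * η, h t = 0 := fun t ht => by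
    have : (t - 2 * η) / η ≤ 0 := div_nonpos_of_nonpos_of_nonneg (by linarith) hη.le
    exact max_eq_left ((min_le_right _ _).trans this)
  have χ1 : ∀ t, 2 * η ≤ t → χ t = 1 := fun t ht => by
    have : 1 ≤ (t - η) / η := by rw [le_div_iff₀ hη]; linarith
    simp [χ, min_eq_left this]
  have h1 : ∀ t, 3 * η ≤ t → h t = 1 := fun t ht => by
    have : 1 ≤ (t - 2 * η) / η := by rw [le_div_iff₀ hη]; linarith
    simp [h, min_eq_left this]
  have χb : ∀ t, 0 ≤ χ t ∧ χ t ≤ 1 := fun t =>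
    ⟨le_max_left _ _, max_le zero_le_one (min_le_left _ _)⟩
  have hb : ∀ t, 0 ≤ h t ∧ h t ≤ 1 := fun t =>
    ⟨le_max_left _ _, max_le zero_le_one (min_le_left _ _)⟩
  have χh : ∀ t, χ t * h t = h t := fun t => by
    rcases le_total t (2 * η) with ht | ht
    · simp [h0 t ht]
    · simp [χ1 t ht]
  have kt : ∀ t, k t * t = χ t := fun t => by
    rcases le_total t η with ht | ht
    · simp [k, χ0 t ht]
    · simp only [k, max_eq_left ht]
      exact div_mul_cancel₀ _ (by linarith)
  have lt : ∀ t, l t * t = h t := fun t => by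
    rcases le_total t η with ht | ht
    · simp [l, h0 t (by linarith)]
    · simp only [l, max_eq_left ht]
      exact div_mul_cancel₀ _ (by linarith)
  have k0 : k 0 = 0 := by simp [k, χ0 0 hη.le]
  have l0 : l 0 = 0 := by simp [l, h0 0 (by linarith)]
  have hh0 : h 0 = 0 := h0 0 (by linarith)
  have hχ0 : χ 0 = 0 := χ0 0 hη.le
  have kb : ∀ t, 0 ≤ k t ∧ k t ≤ 1 / η := fun t => by
    refine ⟨div_nonneg (χb t).1 (hη.le.trans (le_max_right _ _)), ?_⟩
    exact div_le_div₀ zero_le_one (χb t).2 hη (le_max_right _ _)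
  refine ⟨1 / η, by positivity, fun y hy => ?_⟩
  set a := star y * y with ha
  have hsa : IsSelfAdjoint a := .star_mul_self y
  have ha0 : 0 ≤ a := star_mul_self_nonneg y
  have hspec : ∀ t ∈ quasispectrum ℝ a, 0 ≤ t ∧ t ≤ 1 := fun t ht => by
    refine ⟨quasispectrum_nonneg_of_nonneg a ha0 t ht, ?_⟩
    have h1 : ‖cfcₙ (id : ℝ → ℝ) a‖ ≤ 1 := by
      rw [cfcₙ_id ℝ a, ha, CStarRing.norm_star_mul_self]
      nlinarith [norm_nonneg y]
    have := (norm_cfcₙ_le_iff (id : ℝ → ℝ) a 1).1 h1 t ht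
    exact (le_abs_self t).trans this
  have ida : cfcₙ (fun t : ℝ => t) a = a := cfcₙ_id' ℝ a
  have mulc : ∀ f g : ℝ → ℝ, Continuous f → Continuous g → f 0 = 0 → g 0 = 0 →
      cfcₙ f a * cfcₙ g a = cfcₙ (fun t => f t * g t) a := fun f g hf hg hf0 hg0 =>
    (cfcₙ_mul f g a hf.continuousOn hf0 hg.continuousOn hg0).symm
  have mula : ∀ f : ℝ → ℝ, Continuous f → f 0 = 0 → cfcₙ f a * a = cfcₙ (fun t => f t * t) a :=
    fun f hf hf0 => by
      have := mulc f (fun t => t) hf continuous_id hf0 rfl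
      rwa [ida] at this
  have amul : ∀ f : ℝ → ℝ, Continuous f → f 0 = 0 → a * cfcₙ f a = cfcₙ (fun t => t * f t) a :=
    fun f hf hf0 => by
      have := mulc (fun t => t) f continuous_id hf rfl hf0
      rwa [ida] at this
  have addc : ∀ f g : ℝ → ℝ, Continuous f → Continuous g → f 0 = 0 → g 0 = 0 →
      cfcₙ f a + cfcₙ g a = cfcₙ (fun t => f t + g t) a := fun f g hf hg hf0 hg0 =>
    (cfcₙ_add f g a hf.continuousOn hf0 hg.continuousOn hg0).symm
  have subc : ∀ f g : ℝ → ℝ, Continuous f → Continuous g → f 0 = 0 → g 0 = 0 →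
      cfcₙ f a - cfcₙ g a = cfcₙ (fun t => f t - g t) a := fun f g hf hg hf0 hg0 =>
    (cfcₙ_sub f g a hf.continuousOn hf0 hg.continuousOn hg0).symm
  have ka : cfcₙ k a * a = cfcₙ χ a := by
    rw [mula k hkc k0]
    simp only [kt]
  have la : cfcₙ l a * a = cfcₙ h a := by
    rw [mula l hlc l0]
    simp only [lt]
  have hχa : cfcₙ h a * cfcₙ χ a = cfcₙ h a := by
    rw [mulc h χ hhc hχc hh0 hχ0]
    simp only [mul_comm (h _), χh]
  have χha : cfcₙ χ a * cfcₙ h a = cfcₙ h a := by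
    rw [mulc χ h hχc hhc hχ0 hh0]
    simp only [χh]
  have ksa : IsSelfAdjoint (cfcₙ k a) := cfcₙ_predicate k a
  have hsa' : IsSelfAdjoint (cfcₙ h a) := cfcₙ_predicate h a
  have χsa : IsSelfAdjoint (cfcₙ χ a) := cfcₙ_predicate χ a
  have wy : cfcₙ k a * star y * y = cfcₙ χ a := by rw [mul_assoc, ← ha, ka]
  refine ⟨cfcₙ k a * star y, cfcₙ l a * star y, y * cfcₙ h a, ?_, ?_, ?_, ?_, ?_, ?_, ?_, ?_, ?_, ?_⟩
  · have : ‖cfcₙ k a‖ ≤ 1 / η := norm_cfcₙ_le fun t _ => by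
      rw [Real.norm_of_nonneg (kb t).1]; exact (kb t).2
    calc _ ≤ ‖cfcₙ k a‖ * ‖star y‖ := norm_mul_le _ _
      _ ≤ (1 / η) * 1 := by rw [norm_star]; gcongr
      _ = _ := mul_one _
  · rw [mul_assoc, mul_assoc, ← ha, la]
  · have e1 : star (y * cfcₙ h a) * (y * cfcₙ h a) = cfcₙ (fun t => h t * t * h t) a := by
      rw [star_mul, hsa'.star_eq, mul_assoc, ← mul_assoc (star y), ← ha, ← mul_assoc,
        mula h hhc hh0, mulc _ h (by fun_prop) hhc (by simp) hh0]
    have e2 : ‖cfcₙ (fun t => h t * t * h t) a‖ ≤ 1 := norm_cfcₙ_le fun t ht => by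
      have hs := hspec t ht
      have hp := hb t
      have hn : 0 ≤ h t * t * h t := mul_nonneg (mul_nonneg hp.1 hs.1) hp.1
      rw [Real.norm_of_nonneg hn]
      exact mul_le_one₀ (mul_le_one₀ hp.2 hs.1 hs.2) hp.1 hp.2
    rw [← e1, CStarRing.norm_star_mul_self] at e2
    exact abs_le_of_sq_le_sq' (by nlinarith) zero_le_one |>.2
  · have e1 : star (y * cfcₙ h a - y) * (y * cfcₙ h a - y)
        = cfcₙ (fun t => (h t * t * h t - h t * t) - (t * h t - t)) a := by
      rw [← subc _ _ (by fun_prop) (by fun_prop) (by simp) (by simp),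
        ← subc _ _ (by fun_prop) (by fun_prop) (by simp) (by simp),
        ← subc _ _ (by fun_prop) (by fun_prop) (by simp) (by simp),
        ← mulc _ h (by fun_prop) hhc (by simp) hh0, ← mula h hhc hh0, ← amul h hhc hh0, ida]
      rw [star_sub, star_mul, hsa'.star_eq, ha]
      exact alg1 _ _ _
    have e2 : ‖cfcₙ (fun t => (h t * t * h t - h t * t) - (t * h t - t)) a‖ ≤ δ ^ 2 :=
      norm_cfcₙ_le fun t ht => by
        have hs := hspec t ht
        have hp := hb t
        have e3 : (h t * t * h t - h t * t) - (t * h t - t) = t * (1 - h t) ^ 2 := by ring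
        rw [e3, Real.norm_of_nonneg (mul_nonneg hs.1 (sq_nonneg _))]
        rcases le_total t (3 * η) with h3 | h3
        · have : (1 - h t) ^ 2 ≤ 1 := by nlinarith
          nlinarith
        · rw [h1 t h3]
          nlinarith [sq_nonneg δ]
    rw [← e1, CStarRing.norm_star_mul_self] at e2
    exact abs_le_of_sq_le_sq' (by nlinarith) hδ.le |>.2
  · calc _ = y * ((cfcₙ k a * star y * y) * cfcₙ h a) := by simp only [mul_assoc]
      _ = _ := by rw [wy, χha]
  · rw [wy, mul_assoc, hχa]
  · rw [← mul_assoc]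
    exact ksa.conjugate y
  · rw [wy]
    exact χsa
  · intro x
    apply left_contract
    · rw [← mul_assoc]
      exact ksa.conjugate y
    · have : y * (cfcₙ k a * star y) + y * (cfcₙ k a * star y)
          - y * (cfcₙ k a * star y) * (y * (cfcₙ k a * star y))
          = y * (cfcₙ (fun t => k t + k t - χ t * k t) a) * star y := by
        rw [← subc _ _ (by fun_prop) (by fun_prop) (by simp [k0]) (by simp [k0]),
          ← addc _ _ hkc hkc k0 k0, ← mulc χ k hχc hkc hχ0 k0, ← wy]
        exact alg2 _ _ _
      rw [this]
      apply star_right_conjugate_nonneg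
      apply cfcₙ_nonneg
      intro t ht
      nlinarith [χb t, kb t]
  · intro x
    rw [wy]
    apply right_contract _ _ χsa
    have : cfcₙ χ a + cfcₙ χ a - cfcₙ χ a * cfcₙ χ a
      = cfcₙ (fun t => χ t + χ t - χ t * χ t) a := by
      rw [← subc _ _ (by fun_prop) (by fun_prop) (by simp [hχ0]) (by simp [hχ0]),
          ← addc _ _ hχc hχc hχ0 hχ0, ← mulc χ χ hχc hχc hχ0 hχ0]
    rw [this]
    apply cfcₙ_nonneg
    intro t ht
    nlinarith [χb t]

lemma sign_orth {ι : Type*} [Fintype ι] [DecidableEq ι] (i j : ι) :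
    ∑ σ : ι → ℤˣ, (((σ i : ℤ) : ℝ) * ((σ j : ℤ) : ℝ))
      = if i = j then (Fintype.card (ι → ℤˣ) : ℝ) else 0 := by
  split_ifs with hij
  · subst hij
    have : ∀ u : ℤˣ, ((u : ℤ) : ℝ) * ((u : ℤ) : ℝ) = 1 := fun u => by
      rcases Int.units_eq_one_or u with h | h <;> simp [h]
    simp [this]
  have h := Equiv.sum_comp (Equiv.mulLeft (Pi.mulSingle i (-1) : ι → ℤˣ))
    (fun σ : ι → ℤˣ => (((σ i : ℤ) : ℝ) * ((σ j : ℤ) : ℝ)))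
  simp [Pi.mulSingle_eq_of_ne (Ne.symm hij)] at h
  linarith

lemma norm_sign (u : ℤˣ) : ‖((u : ℤ) : ℝ)‖ = 1 := by
  rcases Int.units_eq_one_or u with h | h <;> simp [h]

/-- Rademacher averages -/
noncomputable def yavg {A ι : Type*} [NonUnitalCStarAlgebra A] [Fintype ι] [DecidableEq ι]
    (x : (ι → ℤˣ) → A) (i : ι) : A :=
  (Fintype.card (ι → ℤˣ) : ℝ)⁻¹ • ∑ σ, ((σ i : ℤ) : ℝ) • x σ

section avg
variable {ι : Type*} [Fintype ι] [DecidableEq ι]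

lemma norm_yavg_le (x : (ι → ℤˣ) → A) (hx : ∀ σ, ‖x σ‖ ≤ 1) (i : ι) : ‖yavg x i‖ ≤ 1 := by
  have h : ‖∑ σ : ι → ℤˣ, ((σ i : ℤ) : ℝ) • x σ‖ ≤ (Fintype.card (ι → ℤˣ) : ℝ) := by
    refine (norm_sum_le _ _).trans ?_
    calc _ ≤ ∑ σ : ι → ℤˣ, (1 : ℝ) := Finset.sum_le_sum fun σ _ => by
            rw [norm_smul, norm_sign, one_mul]; exact hx σ
      _ = _ := by simp
  rw [yavg, norm_smul, norm_inv, Real.norm_natCast]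
  have hD : (0 : ℝ) < Fintype.card (ι → ℤˣ) := by exact_mod_cast Fintype.card_pos
  rw [inv_mul_le_iff₀ hD]
  simpa using h

lemma avg_left (x : (ι → ℤˣ) → A) (hx : ∀ σ, ‖x σ‖ ≤ 1) (b : ι → A) (K : ℝ) (hK : 0 ≤ K)
    (hb : ∀ i, ‖b i‖ ≤ K) : ‖∑ i, yavg x i * b i‖ ≤ √(Fintype.card ι) * K := by
  set D : ℝ := (Fintype.card (ι → ℤˣ) : ℝ) with hDdef
  have hD : 0 < D := by rw [hDdef]; exact_mod_cast Fintype.card_pos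
  let S : (ι → ℤˣ) → A := fun σ => ∑ i, ((σ i : ℤ) : ℝ) • b i
  have h1 : ∑ i, yavg x i * b i = D⁻¹ • ∑ σ, x σ * S σ := by
    simp only [yavg, S, smul_mul_assoc, Finset.sum_mul, Finset.mul_sum, mul_smul_comm,
      ← Finset.smul_sum, ← hDdef]
    rw [Finset.sum_comm]
  have h2 : ‖∑ σ, x σ * star (x σ)‖ ≤ D := by
    refine (norm_sum_le _ _).trans ?_
    calc _ ≤ ∑ σ : ι → ℤˣ, (1 : ℝ) := Finset.sum_le_sum fun σ _ => by
            rw [CStarRing.norm_self_mul_star]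
            nlinarith [hx σ, norm_nonneg (x σ)]
      _ = _ := by simp [hDdef]
  have h3 : ∑ σ, star (S σ) * S σ = D • ∑ i, star (b i) * b i := by
    simp only [S, star_sum, star_smul, Finset.sum_mul_sum, smul_mul_smul_comm, star_trivial]
    rw [Finset.sum_comm, Finset.smul_sum]
    refine Finset.sum_congr rfl fun i _ => ?_
    rw [Finset.sum_comm]
    simp only [← Finset.sum_smul, sign_orth]
    simp [hDdef]
  have h4 : ‖∑ σ, star (S σ) * S σ‖ ≤ D * (Fintype.card ι * K ^ 2) := by
    rw [h3, norm_smul, Real.norm_of_nonneg hD.le]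
    gcongr
    refine (norm_sum_le _ _).trans ?_
    calc _ ≤ ∑ i : ι, K ^ 2 := Finset.sum_le_sum fun i _ => by
            rw [CStarRing.norm_star_mul_self]
            nlinarith [hb i, norm_nonneg (b i)]
      _ = _ := by simp
  rw [h1, norm_smul, norm_inv, Real.norm_of_nonneg hD.le, inv_mul_le_iff₀ hD]
  refine (cauchy_schwarz x S).trans ?_
  calc _ ≤ √D * √(D * (Fintype.card ι * K ^ 2)) := by gcongr
    _ = _ := by
      rw [Real.sqrt_mul hD.le, Real.sqrt_mul (by positivity), Real.sqrt_sq hK, ← mul_assoc,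
        Real.mul_self_sqrt hD.le]

lemma avg_right (x : (ι → ℤˣ) → A) (hx : ∀ σ, ‖x σ‖ ≤ 1) (b : ι → A) (K : ℝ) (hK : 0 ≤ K)
    (hb : ∀ i, ‖b i‖ ≤ K) : ‖∑ i, b i * yavg x i‖ ≤ √(Fintype.card ι) * K := by
  have h := avg_left (fun σ => star (x σ)) (by simpa using hx) (fun i => star (b i)) K hK
    (by simpa using hb)
  have h2 : star (∑ i, b i * yavg x i) = ∑ i, yavg (fun σ => star (x σ)) i * star (b i) := by
    simp [yavg, star_sum, star_smul]
  rwa [← h2, norm_star] at h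

end avg
end order

section main
variable {A : Type*} [NonUnitalCStarAlgebra A]

/-- The elements orthogonal to all elements of `C`. -/
def perp (C : Set A) : Submodule ℂ A where
  carrier := {x | ∀ c ∈ C, x * star c = 0 ∧ star c * x = 0}
  add_mem' hx hy c hc := by
    simp [add_mul, mul_add, hx c hc, hy c hc]
  zero_mem' c hc := by simp
  smul_mem' t x hx c hc := by
    simp [smul_mul_assoc, mul_smul_comm, hx c hc]

lemma perp_inner {C : Set A} {x z : A} (hx : x ∈ perp C) (hz : z ∈ perp C) (a : A) :
    x * a * z ∈ perp C := fun c hc => by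
  constructor
  · rw [mul_assoc, (hz c hc).1, mul_zero]
  · rw [mul_assoc, ← mul_assoc, (hx c hc).2, zero_mul]

/-- quantitative sign-spanning of `ℓ₁` on `perp C` -/
def Spans (C : Set A) (φ : ℕ → A →L[ℂ] ℂ) (r : ℝ) : Prop :=
  ∀ s : Finset ℕ, ∀ σ : ℕ → ℤˣ, ∃ x ∈ perp C, ‖x‖ ≤ 1 ∧
    r * s.card ≤ ∑ m ∈ s, ((σ m : ℤ) : ℝ) * (φ m x).re


lemma exists_good [PartialOrder A] [StarOrderedRing A] (φ : ℕ → A →L[ℂ] ℂ)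
    (hφ : ∀ m, ‖φ m‖ ≤ 1) (r δ K : ℝ) (hr : 0 ≤ r) (hδ : 0 < δ) (hK : 0 ≤ K) (N : ℕ)
    (hN : 2 * ((1 + δ) / δ) * K * √N < δ * N)
    (x : (Fin N → ℤˣ) → A) (hx : ∀ σ, ‖x σ‖ ≤ 1)
    (hsum : r * N ≤ ∑ i : Fin N, (φ i (yavg x i)).re)
    (w : Fin N → A) (hw : ∀ i, ‖w i‖ ≤ K) (ψ : A →L[ℂ] ℂ) (hψ : ‖ψ‖ ≤ 1) :
    ∃ i : Fin N, r - δ ≤ (φ i (yavg x i)).re ∧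
      (∀ z, ‖z‖ ≤ 1 → ‖ψ (yavg x i * w i * z)‖ ≤ δ) ∧
      (∀ z, ‖z‖ ≤ 1 → ‖ψ (z * (w i * yavg x i))‖ ≤ δ) := by
  by_contra! hcon
  set C0 := (1 + δ) / δ with hC0
  have hC0δ : C0 * δ = 1 + δ := div_mul_cancel₀ _ hδ.ne'
  have hC0p : 0 ≤ C0 := by positivity
  have key : ∀ i : Fin N, ∃ z z' : A, ‖z‖ ≤ 1 ∧ ‖z'‖ ≤ 1 ∧
      (φ i (yavg x i)).re ≤ r - δ + C0 * ((ψ (yavg x i * (w i * z))).re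
        + (ψ (z' * w i * yavg x i)).re) := by
    intro i
    have hle : (φ i (yavg x i)).re ≤ 1 := by
      calc _ ≤ ‖φ i (yavg x i)‖ := Complex.re_le_norm _
        _ ≤ ‖φ i‖ * ‖yavg x i‖ := (φ i).le_opNorm _
        _ ≤ 1 * 1 := by gcongr; exacts [hφ i, norm_yavg_le x hx i]
        _ = 1 := one_mul 1
    by_cases h1 : r - δ ≤ (φ i (yavg x i)).re
    · by_cases h2 : ∀ z, ‖z‖ ≤ 1 → ‖ψ (yavg x i * w i * z)‖ ≤ δ
      · obtain ⟨z, hz, hzδ⟩ := hcon i h1 h2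
        obtain ⟨u, hu, hu2⟩ := Complex.exists_norm_eq_mul_self (ψ (z * (w i * yavg x i)))
        refine ⟨0, u • z, by simp, by simpa [norm_smul, hu] using hz, ?_⟩
        have : ψ (u • z * w i * yavg x i) = (‖ψ (z * (w i * yavg x i))‖ : ℂ) := by
          rw [hu2, smul_mul_assoc, smul_mul_assoc, map_smul, mul_assoc, smul_eq_mul]
        rw [this]
        simp only [mul_zero, map_zero, Complex.zero_re, Complex.ofReal_re, zero_add]
        nlinarith
      · push Not at h2
        obtain ⟨z, hz, hzδ⟩ := h2
        obtain ⟨u, hu, hu2⟩ := Complex.exists_norm_eq_mul_self (ψ (yavg x i * w i * z))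
        refine ⟨u • z, 0, by simpa [norm_smul, hu] using hz, by simp, ?_⟩
        have : ψ (yavg x i * (w i * (u • z))) = (‖ψ (yavg x i * w i * z)‖ : ℂ) := by
          rw [hu2, mul_smul_comm, mul_smul_comm, map_smul, mul_assoc, smul_eq_mul]
        rw [this]
        simp only [zero_mul, map_zero, Complex.zero_re, Complex.ofReal_re, add_zero]
        nlinarith
    · exact ⟨0, 0, by simp, by simp, by simpa using (not_le.1 h1).le⟩
  choose z z' hz hz' hkey using key
  have e1 : ‖∑ i, yavg x i * (w i * z i)‖ ≤ √(Fintype.card (Fin N)) * K :=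
    avg_left x hx _ K hK fun i => by
      calc _ ≤ ‖w i‖ * ‖z i‖ := norm_mul_le _ _
        _ ≤ K * 1 := by gcongr; exacts [hw i, hz i]
        _ = K := mul_one K
  have e2 : ‖∑ i, z' i * w i * yavg x i‖ ≤ √(Fintype.card (Fin N)) * K :=
    avg_right x hx _ K hK fun i => by
      calc _ ≤ ‖z' i‖ * ‖w i‖ := norm_mul_le _ _
        _ ≤ 1 * K := by gcongr; exacts [hz' i, hw i]
        _ = K := one_mul K
  rw [Fintype.card_fin] at e1 e2
  have bd : ∀ v : A, (ψ v).re ≤ ‖v‖ := fun v =>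
    calc _ ≤ ‖ψ v‖ := Complex.re_le_norm _
      _ ≤ ‖ψ‖ * ‖v‖ := ψ.le_opNorm _
      _ ≤ 1 * ‖v‖ := by gcongr
      _ = ‖v‖ := one_mul _
  have e3 := (bd _).trans e1
  have e4 := (bd _).trans e2
  rw [map_sum, Complex.re_sum] at e3 e4
  have e5 : ∑ i : Fin N, (φ i (yavg x i)).re ≤ ∑ i : Fin N, (r - δ + C0 * ((ψ (yavg x i * (w i * z i))).re
        + (ψ (z' i * w i * yavg x i)).re)) := Finset.sum_le_sum fun i _ => hkey i
  rw [Finset.sum_add_distrib, ← Finset.mul_sum, Finset.sum_add_distrib] at e5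
  simp only [Finset.sum_const, Finset.card_univ, Fintype.card_fin, nsmul_eq_mul] at e5
  nlinarith [mul_le_mul_of_nonneg_left (add_le_add e3 e4) hC0p]

lemma step [PartialOrder A] [StarOrderedRing A] (C : Set A) (φ : ℕ → A →L[ℂ] ℂ)
    (hφ : ∀ m, ‖φ m‖ ≤ 1) (r δ : ℝ) (hr : 0 ≤ r) (hδ : 0 < δ) (hP : Spans C φ r) :
    ∃ (i : ℕ) (c : A) (k : ℕ → ℕ), StrictMono k ∧ (∀ j, i < k j) ∧ c ∈ perp C ∧ ‖c‖ ≤ 1 ∧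
      r - δ ≤ (φ i c).re ∧ Spans (insert c C) (fun j => φ (k j)) (r - δ) := by
  obtain ⟨d, hd, rfl⟩ : ∃ d, 0 < d ∧ δ = 2 * d := ⟨δ / 2, by positivity, by ring⟩
  obtain ⟨K, hK, hfc⟩ := fc (A := A) d hd
  obtain ⟨N, hN⟩ : ∃ N : ℕ, 2 * ((1 + d) / d) * K * √N < d * N := by
    set Q := 2 * ((1 + d) / d) * K with hQ
    have hQ0 : 0 ≤ Q := by positivity
    obtain ⟨N, hN⟩ := exists_nat_gt ((Q / d) ^ 2)
    refine ⟨N, ?_⟩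
    have h1 : Q / d < √N := Real.lt_sqrt (by positivity) |>.2 hN
    rw [div_lt_iff₀ hd] at h1
    have h0 : 0 < √(N : ℝ) := Real.sqrt_pos.2 (lt_of_le_of_lt (sq_nonneg _) hN)
    have h2 : √(N : ℝ) * √N = N := Real.mul_self_sqrt (Nat.cast_nonneg _)
    calc Q * √N < √N * d * √N := by gcongr
      _ = d * (√N * √N) := by ring
      _ = d * N := by rw [h2]
  have hx : ∀ σ : Fin N → ℤˣ, ∃ x ∈ perp C, ‖x‖ ≤ 1 ∧
      r * N ≤ ∑ i : Fin N, ((σ i : ℤ) : ℝ) * (φ i x).re := fun σ => by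
    obtain ⟨x, hx, hx1, hx2⟩ := hP (Finset.range N)
      (fun m => if h : m < N then σ ⟨m, h⟩ else 1)
    refine ⟨x, hx, hx1, ?_⟩
    rw [Finset.sum_range, Finset.card_range] at hx2
    simpa using hx2
  choose x hxC hx1 hx2 using hx
  have hyC : ∀ i, yavg x i ∈ perp C := fun i => by
    refine Submodule.smul_of_tower_mem _ _ (Submodule.sum_mem _ fun σ _ => ?_)
    exact Submodule.smul_of_tower_mem _ _ (hxC σ)
  have hsum : r * N ≤ ∑ i : Fin N, (φ i (yavg x i)).re := by
    set D : ℝ := (Fintype.card (Fin N → ℤˣ) : ℝ) with hDdef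
    have hD : 0 < D := by rw [hDdef]; exact_mod_cast Fintype.card_pos
    have h1 : ∑ i : Fin N, (φ i (yavg x i)).re
        = D⁻¹ * ∑ σ : Fin N → ℤˣ, ∑ i : Fin N, ((σ i : ℤ) : ℝ) * (φ i (x σ)).re := by
      rw [Finset.sum_comm, Finset.mul_sum]
      refine Finset.sum_congr rfl fun i _ => ?_
      have : ∀ (t : ℝ) (v : A), φ i (t • v) = t • φ i v := fun t v => by
        rw [← Complex.coe_smul, map_smul, Complex.coe_smul]
      rw [yavg, this, map_sum, Complex.smul_re, Complex.re_sum, ← hDdef, smul_eq_mul]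
      congr 1
      refine Finset.sum_congr rfl fun σ _ => ?_
      rw [this, Complex.smul_re, smul_eq_mul]
    rw [h1, le_inv_mul_iff₀ hD]
    calc D * (r * N) = ∑ σ : Fin N → ℤˣ, r * N := by simp [hDdef]
      _ ≤ _ := Finset.sum_le_sum fun σ _ => hx2 σ
  choose w u c hw hcu hc1 hcy hec hcf hesa hfsa hel hfr using
    fun i => hfc (yavg x i) (norm_yavg_le x hx1 i)
  choose I hI1 hI2 hI3 using fun m =>
    exists_good φ hφ r d K hr hd hK N hN x hx1 hsum w hw (φ m) (hφ m)
  obtain ⟨i, hi⟩ := Finite.exists_infinite_fiber I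
  have hinf : (I ⁻¹' {i}).Infinite := Set.infinite_coe_iff.1 hi
  obtain ⟨k, hk, hk2⟩ := Filter.extraction_of_frequently_atTop
    ((Nat.frequently_atTop_iff_infinite.2 hinf).and_eventually (Filter.eventually_gt_atTop (i : ℕ)))
  have hIk : ∀ j, I (k j) = i := fun j => (hk2 j).1
  refine ⟨i, c i, k, hk, fun j => (hk2 j).2, ?_, hc1 i, ?_, ?_⟩
  · rw [hcu i]
    exact perp_inner (hyC i) (hyC i) _
  · have h1 := hI1 (k 0)
    rw [hIk] at h1
    have h2 : ‖φ i (c i - yavg x i)‖ ≤ d := by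
      calc _ ≤ ‖φ i‖ * ‖c i - yavg x i‖ := (φ i).le_opNorm _
        _ ≤ 1 * d := by gcongr; exacts [hφ i, hcy i]
        _ = d := one_mul d
    have h3 := (abs_le.1 ((Complex.abs_re_le_norm _).trans h2)).1
    rw [map_sub, Complex.sub_re] at h3
    linarith
  · intro s τ
    obtain ⟨v, hvC, hv1, hv2⟩ := hP (s.map ⟨k, hk.injective⟩) (Function.extend k τ 1)
    rw [Finset.sum_map, Finset.card_map] at hv2
    simp only [Function.Embedding.coeFn_mk, hk.injective.extend_apply] at hv2
    set y := yavg x i with hy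
    let z := v - y * w i * v
    have hzC : z ∈ perp C := Submodule.sub_mem _ hvC (perp_inner (hyC i) hvC _)
    have hz1 : ‖z‖ ≤ 1 := (hel i v).trans hv1
    have hz'C : z - z * (w i * y) ∈ perp C := by
      refine Submodule.sub_mem _ hzC ?_
      rw [← mul_assoc]
      exact perp_inner hzC (hyC i) _
    have hsc1 : star (c i) * (y * w i) = star (c i) := by
      have := congrArg star (hec i)
      rwa [star_mul, (hesa i).star_eq] at this
    have hsc2 : w i * y * star (c i) = star (c i) := by
      have := congrArg star (hcf i)
      rwa [star_mul, (hfsa i).star_eq] at this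
    refine ⟨z - z * (w i * y), ?_, (hfr i z).trans hz1, ?_⟩
    · intro b hb
      rcases hb with rfl | hb
      · constructor
        · rw [sub_mul, mul_assoc, hsc2, sub_self]
        · have : star (c i) * z = 0 := by
            simp only [z]
            rw [mul_sub, ← mul_assoc, hsc1, sub_self]
          rw [mul_sub, ← mul_assoc, this, zero_mul, sub_zero]
      · exact hz'C b hb
    · have hj : ∀ j, ((τ j : ℤ) : ℝ) * (φ (k j) v).re - 2 * d
          ≤ ((τ j : ℤ) : ℝ) * (φ (k j) (z - z * (w i * y))).re := fun j => by
        have h1 := hI2 (k j) v hv1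
        have h2 := hI3 (k j) z hz1
        rw [hIk] at h1 h2
        have h3 := abs_le.1 ((Complex.abs_re_le_norm _).trans h1)
        have h4 := abs_le.1 ((Complex.abs_re_le_norm _).trans h2)
        have h5 : (φ (k j) (z - z * (w i * y))).re = (φ (k j) v).re
            - (φ (k j) (y * w i * v)).re - (φ (k j) (z * (w i * y))).re := by
          rw [map_sub, Complex.sub_re]
          simp only [z]
          rw [map_sub, Complex.sub_re]
        rw [h5]
        rcases Int.units_eq_one_or (τ j) with h | h <;> simp only [h] <;> push_cast <;> linarith
      have h6 := Finset.sum_le_sum fun j (_ : j ∈ s) => hj j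
      rw [Finset.sum_sub_distrib, Finset.sum_const, nsmul_eq_mul] at h6
      linarith

end main
end L1Orth

open L1Orth

theorem l1_r_isomorphic_subsequence_orthogonal_elements
    {A : Type*} [NonUnitalCStarAlgebra A]
    (r : ℝ) (hr0 : 0 < r) (hr1 : r ≤ 1)
    (φ : ℕ → A →L[ℂ] ℂ) (hnorm : ∀ m, ‖φ m‖ = 1)
    (hspan : ∀ s : Finset ℕ, ∀ α : ℕ → ℂ,
      r * ∑ m ∈ s, ‖α m‖ ≤ ‖∑ m ∈ s, α m • φ m‖) :
    ∀ ε > (0 : ℝ), ∃ m : ℕ → ℕ, StrictMono m ∧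
      ∃ c : ℕ → A,
        (∀ n k, n ≠ k → c n * star (c k) = 0 ∧ star (c k) * c n = 0) ∧
        (∀ n, ‖c n‖ = 1) ∧
        (∀ n, r * (1 - ε) < (φ (m n) (c n)).re) := by
  let _ : PartialOrder A := CStarAlgebra.spectralOrder A
  have _ : StarOrderedRing A := CStarAlgebra.spectralOrderedRing A
  intro ε hε
  obtain ⟨R, hR0, hRr, hRε⟩ : ∃ R : ℝ, 0 < R ∧ R < r ∧ r * (1 - ε) < R := by
    obtain ⟨R, h1, h2⟩ := exists_between (show max 0 (r * (1 - ε)) < r from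
      max_lt hr0 (by nlinarith))
    exact ⟨R, (le_max_left _ _).trans_lt h1, h2, (le_max_right _ _).trans_lt h1⟩
  let ρ : ℕ → ℝ := fun n => R + (r - R) / (n + 2)
  have hρR : ∀ n, R < ρ n := fun n => by
    have : 0 < (r - R) / ((n : ℝ) + 2) := div_pos (by linarith) (by positivity)
    simp only [ρ]; linarith
  have hρ0 : ρ 0 < r := by
    simp only [ρ]; push_cast; linarith
  have hρs : ∀ n, ρ (n + 1) < ρ n := fun n => by
    simp only [ρ]
    gcongr ?_ + ?_
    apply div_lt_div_of_pos_left (by linarith) (by positivity)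
    push_cast; linarith
  have hinit : Spans (∅ : Set A) φ (ρ 0) := by
    intro s σ
    rcases s.eq_empty_or_nonempty with rfl | hs
    · exact ⟨0, Submodule.zero_mem _, by simp, by simp⟩
    have h1 := hspan s (fun m => (((σ m : ℤ) : ℝ) : ℂ))
    simp only [Complex.norm_real, norm_sign, Finset.sum_const, nsmul_eq_mul, mul_one] at h1
    have hc : (0 : ℝ) < s.card := by exact_mod_cast hs.card_pos
    have h2 : ρ 0 * s.card < ‖∑ m ∈ s, (((σ m : ℤ) : ℝ) : ℂ) • φ m‖ :=
      lt_of_lt_of_le (by gcongr) h1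
    obtain ⟨v, hv1, hv2⟩ := ContinuousLinearMap.exists_lt_apply_of_lt_opNorm _ h2
    obtain ⟨u, hu, hu2⟩ := Complex.exists_norm_eq_mul_self
      ((∑ m ∈ s, (((σ m : ℤ) : ℝ) : ℂ) • φ m) v)
    refine ⟨u • v, fun c hc => absurd hc (Set.notMem_empty c), ?_, ?_⟩
    · rw [norm_smul, hu, one_mul]; exact hv1.le
    · have h3 : ∑ m ∈ s, ((σ m : ℤ) : ℝ) * (φ m (u • v)).re
          = ((∑ m ∈ s, (((σ m : ℤ) : ℝ) : ℂ) • φ m) (u • v)).re := by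
        simp only [sum_apply, Complex.re_sum, smul_apply,
          smul_eq_mul, Complex.re_ofReal_mul]
      rw [h3, map_smul, smul_eq_mul, ← hu2, Complex.ofReal_re]
      exact hv2.le
  let Good : ℕ → Set A × (ℕ → ℕ) → Prop := fun n p =>
    StrictMono p.2 ∧ Spans p.1 (fun j => φ (p.2 j)) (ρ n)
  have hstep : ∀ n (p : Set A × (ℕ → ℕ)), ∃ (q : Set A × (ℕ → ℕ)) (i : ℕ) (c : A) (k : ℕ → ℕ),
      Good n p → Good (n + 1) q ∧ c ∈ perp p.1 ∧ ‖c‖ ≤ 1 ∧ ρ (n + 1) ≤ (φ (p.2 i) c).re ∧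
        q.1 = insert c p.1 ∧ (∀ j, q.2 j = p.2 (k j)) ∧ ∀ j, i < k j := by
    intro n p
    by_cases hp : Good n p
    · obtain ⟨i, c, k, hk, hik, hc, hc1, hre, hS⟩ := step p.1 (fun j => φ (p.2 j))
        (fun m => (hnorm _).le) (ρ n) (ρ n - ρ (n + 1)) (hR0.trans (hρR n)).le
        (sub_pos.2 (hρs n)) hp.2
      rw [sub_sub_cancel] at hre hS
      exact ⟨(insert c p.1, fun j => p.2 (k j)), i, c, k, fun _ =>
        ⟨⟨hp.1.comp hk, hS⟩, hc, hc1, hre, rfl, fun _ => rfl, hik⟩⟩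
    · exact ⟨p, 0, 0, id, fun h => absurd h hp⟩
  choose q i c k H using hstep
  let p : ℕ → Set A × (ℕ → ℕ) := fun n => Nat.rec (∅, id) (fun n p => q n p) n
  have hp : ∀ n, Good n (p n) := fun n => by
    induction n with
    | zero => exact ⟨strictMono_id, hinit⟩
    | succ n ih => exact (H n (p n) ih).1
  have H' := fun n => (H n (p n) (hp n)).2
  let cc : ℕ → A := fun n => c n (p n)
  have hps : ∀ n, (p (n + 1)).1 = insert (cc n) (p n).1 := fun n => (H' n).2.2.2.1
  have hmono : Monotone fun n => (p n).1 := monotone_nat_of_le_succ fun n => by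
    rw [hps n]
    exact Set.subset_insert _ _
  have hre : ∀ n, R < (φ ((p n).2 (i n (p n))) (cc n)).re := fun n =>
    (hρR (n + 1)).trans_le (H' n).2.2.1
  have hlt : ∀ a b, a < b → cc b * star (cc a) = 0 ∧ star (cc a) * cc b = 0 := fun a b hab => by
    refine (H' b).1 (cc a) (hmono (Nat.succ_le_of_lt hab) ?_)
    show cc a ∈ (p (a + 1)).1
    rw [hps a]
    exact Set.mem_insert _ _
  have hort : ∀ a b, a ≠ b → cc a * star (cc b) = 0 ∧ star (cc b) * cc a = 0 := fun a b hab => by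
    rcases lt_or_gt_of_ne hab with h | h
    · have := hlt a b h
      have h1 := congrArg star this.1
      have h2 := congrArg star this.2
      rw [star_mul, star_star, star_zero] at h1 h2
      exact ⟨h1, h2⟩
    · exact hlt b a h
  have hpos : ∀ n, 0 < ‖cc n‖ := fun n => by
    rw [norm_pos_iff]
    intro h0
    have := hre n
    rw [h0] at this
    simp at this
    linarith
  refine ⟨fun n => (p n).2 (i n (p n)), strictMono_nat_of_lt_succ fun n => ?_,
    fun n => ((‖cc n‖⁻¹ : ℝ) : ℂ) • cc n, ?_, ?_, ?_⟩
  · show (p n).2 (i n (p n)) < (p (n + 1)).2 _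
    have := (H' n).2.2.2.2
    rw [show (p (n + 1)).2 _ = _ from this.1 _]
    exact (hp n).1 (this.2 _)
  · intro a b hab
    have := hort a b hab
    simp only [star_smul, smul_mul_smul_comm, this.1, this.2, smul_zero, and_self]
  · intro n
    rw [norm_smul, Complex.norm_real, norm_inv, norm_norm, inv_mul_cancel₀ (hpos n).ne']
  · intro n
    have h1 := hre n
    have h2 : 1 ≤ ‖cc n‖⁻¹ := (one_le_inv₀ (hpos n)).2 (H' n).2.1
    rw [map_smul, smul_eq_mul, Complex.re_ofReal_mul]
    nlinarith
end

section
/- Let A be a C*-algebra, let 0 < r ≤ 1, and let (φ_m)_{m∈ℕ} be a sequence of continuous linear functionals on A with ‖φ_m‖ = 1 for all m, spanning ℓ1 r-isomorphically. Then for all ε > 0 and ε' > 0 there exist a strictly increasing sequence (m_n) of natural numbers and a sequence (c_n) of pairwise orthogonal elements of A (c_n·c_k* = 0 and c_k*·c_n = 0 for n ≠ k) with ‖c_n‖ = 1, such that Re φ_{m_n}(c_n) > r(1 − ε) for every n, and such that for every n and every finite set F ⊆ ℕ with n ∉ F one has ∑_{k∈F} |φ_{m_n}(c_k)| < ε'.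 -/
namespace L1Simons

set_option linter.unusedSectionVars false

section order
variable {A : Type*} [NonUnitalCStarAlgebra A] [PartialOrder A] [StarOrderedRing A]

lemma cauchy_schwarz {ι : Type*} [Fintype ι] (u v : ι → A) :
    ‖∑ i, u i * v i‖ ^ 2 ≤ ‖∑ i, u i * star (u i)‖ * ‖∑ i, star (v i) * v i‖ := by
  let X : WithCStarModule A (ι → A) := (WithCStarModule.equiv A (ι → A)).symm (fun i => star (v i))
  let Y : WithCStarModule A (ι → A) := (WithCStarModule.equiv A (ι → A)).symm u
  have h := CStarModule.norm_inner_le (A := A) (WithCStarModule A (ι → A)) (x := X) (y := Y)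
  have h1 : inner A X Y = ∑ i, u i * v i := by
    rw [WithCStarModule.pi_inner]
    simp [X, Y, WithCStarModule.inner_def]
  have h2 : ‖X‖ ^ 2 = ‖∑ i, star (v i) * v i‖ := by
    rw [WithCStarModule.pi_norm_sq]
    simp [X, WithCStarModule.inner_def]
  have h3 : ‖Y‖ ^ 2 = ‖∑ i, u i * star (u i)‖ := by
    rw [WithCStarModule.pi_norm_sq]
    simp [Y, WithCStarModule.inner_def]
  rw [h1] at h
  rw [← h2, ← h3, ← mul_pow, mul_comm ‖Y‖]
  gcongr

lemma sum_norm_le {ι : Type*} [Fintype ι] (ψ : A →L[ℂ] ℂ) (hψ : ‖ψ‖ ≤ 1) (u v : ι → A) {M K : ℝ}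
    (hu : ‖∑ i, u i * star (u i)‖ ≤ M)
    (hv : ∀ w : ι → A, (∀ i, ‖w i‖ = ‖v i‖) → ‖∑ i, star (w i) * w i‖ ≤ K) :
    (∑ i, ‖ψ (u i * v i)‖) ^ 2 ≤ M * K := by
  have hl : ∀ z : ℂ, ∃ l : ℂ, ‖l‖ = 1 ∧ l * z = (‖z‖ : ℂ) := fun z => by
    obtain ⟨l, h1, h2⟩ := RCLike.exists_norm_eq_mul_self z
    exact ⟨l, h1, h2.symm⟩
  choose l hl1 hl2 using fun i => hl (ψ (u i * v i))
  have e : ψ (∑ i, u i * (l i • v i)) = ((∑ i, ‖ψ (u i * v i)‖ : ℝ) : ℂ) := by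
    simp only [mul_smul_comm, map_sum, map_smul, smul_eq_mul, hl2]
    push_cast; rfl
  have hn : 0 ≤ ∑ i, ‖ψ (u i * v i)‖ := Finset.sum_nonneg fun _ _ => norm_nonneg _
  have h1 : ∑ i, ‖ψ (u i * v i)‖ ≤ ‖∑ i, u i * (l i • v i)‖ := by
    have := ψ.le_of_opNorm_le hψ (∑ i, u i * (l i • v i))
    rw [e, Complex.norm_real, Real.norm_of_nonneg hn, one_mul] at this
    exact this
  calc _ ≤ ‖∑ i, u i * (l i • v i)‖ ^ 2 := by gcongr
    _ ≤ _ := cauchy_schwarz _ _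
    _ ≤ M * K := by
      have := hv (fun i => l i • v i) (fun i => by simp [norm_smul, hl1])
      gcongr
      exact (norm_nonneg _).trans hu

lemma norm_sum_le_card {ι : Type*} [Fintype ι] (x : ι → A) (hx : ∀ i, ‖x i‖ ≤ 1) :
    ‖∑ i, star (x i) * x i‖ ≤ Fintype.card ι := by
  calc _ ≤ ∑ i, ‖star (x i) * x i‖ := norm_sum_le _ _
    _ ≤ ∑ i : ι, (1:ℝ) := by
      gcongr with i
      rw [CStarRing.norm_star_mul_self]
      nlinarith [hx i, norm_nonneg (x i)]
    _ = _ := by simp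

/-- left version -/
lemma sum_left {ι : Type*} [Fintype ι] (ψ : A →L[ℂ] ℂ) (hψ : ‖ψ‖ ≤ 1) (g x : ι → A) {M : ℝ}
    (hg : ‖∑ i, g i * star (g i)‖ ≤ M) (hx : ∀ i, ‖x i‖ ≤ 1) :
    (∑ i, ‖ψ (g i * x i)‖) ^ 2 ≤ M * Fintype.card ι :=
  sum_norm_le ψ hψ g x hg fun w hw => norm_sum_le_card w fun i => (hw i).trans_le (hx i)

lemma sum_right {ι : Type*} [Fintype ι] (ψ : A →L[ℂ] ℂ) (hψ : ‖ψ‖ ≤ 1) (h x : ι → A) {M : ℝ}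
    (hh : ‖∑ i, star (h i) * h i‖ ≤ M) (hx : ∀ i, ‖x i‖ ≤ 1) :
    (∑ i, ‖ψ (x i * h i)‖) ^ 2 ≤ M * Fintype.card ι := by
  have hl : ∀ z : ℂ, ∃ l : ℂ, ‖l‖ = 1 ∧ l * z = (‖z‖ : ℂ) := fun z => by
    obtain ⟨l, h1, h2⟩ := RCLike.exists_norm_eq_mul_self z
    exact ⟨l, h1, h2.symm⟩
  choose l hl1 hl2 using fun i => hl (ψ (x i * h i))
  have e : ψ (∑ i, (l i • x i) * h i) = ((∑ i, ‖ψ (x i * h i)‖ : ℝ) : ℂ) := by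
    simp only [smul_mul_assoc, map_sum, map_smul, smul_eq_mul, hl2]
    push_cast; rfl
  have hn : 0 ≤ ∑ i, ‖ψ (x i * h i)‖ := Finset.sum_nonneg fun _ _ => norm_nonneg _
  have h1 : ∑ i, ‖ψ (x i * h i)‖ ≤ ‖∑ i, (l i • x i) * h i‖ := by
    have := ψ.le_of_opNorm_le hψ (∑ i, (l i • x i) * h i)
    rw [e, Complex.norm_real, Real.norm_of_nonneg hn, one_mul] at this
    exact this
  have h2 := norm_sum_le_card (fun i => star (l i • x i)) (fun i => by simpa [norm_smul, hl1] using hx i)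
  simp only [star_star] at h2
  calc _ ≤ ‖∑ i, (l i • x i) * h i‖ ^ 2 := by gcongr
    _ ≤ _ := cauchy_schwarz _ _
    _ ≤ Fintype.card ι * M := by gcongr
    _ = _ := mul_comm _ _

/-- pigeonhole -/
lemma pigeon {ι : Type*} [Fintype ι] (ψ : A →L[ℂ] ℂ) (hψ : ‖ψ‖ ≤ 1) (g h : ι → A) {M δ : ℝ}
    (hδ : 0 < δ)
    (hg : ‖∑ i, g i * star (g i)‖ ≤ M) (hh : ‖∑ i, star (h i) * h i‖ ≤ M)
    (hc : 4 * M < δ ^ 2 * Fintype.card ι) :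
    ∃ i, ∀ x, ‖x‖ ≤ 1 → ‖ψ (g i * x)‖ ≤ δ ∧ ‖ψ (x * h i)‖ ≤ δ := by
  by_contra! hcon
  choose x hx1 hx2 using hcon
  have h1 := sum_left ψ hψ g x hg hx1
  have h2 := sum_right ψ hψ h x hh hx1
  set N : ℝ := (Fintype.card ι : ℝ) with hN
  have hM : 0 ≤ M := (norm_nonneg _).trans hg
  have hN0 : 0 < N := by
    by_contra! hneg
    nlinarith [sq_nonneg δ]
  have h3 : δ * N ≤ ∑ i, ‖ψ (g i * x i)‖ + ∑ i, ‖ψ (x i * h i)‖ := by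
    rw [← Finset.sum_add_distrib]
    calc δ * N = ∑ i : ι, δ := by simp [hN, mul_comm]
      _ ≤ _ := by
        gcongr with i
        by_cases hi : ‖ψ (g i * x i)‖ ≤ δ
        · linarith [hx2 i hi, norm_nonneg (ψ (g i * x i))]
        · linarith [norm_nonneg (ψ (x i * h i))]
  set a := ∑ i, ‖ψ (g i * x i)‖
  set b := ∑ i, ‖ψ (x i * h i)‖
  have h4 : (δ * N) ^ 2 ≤ (a + b) ^ 2 := by gcongr
  have h5 : (δ * N) ^ 2 ≤ 4 * M * N := by nlinarith [sq_nonneg (a - b)]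
  have h6 : 4 * M * N < δ ^ 2 * N * N := by gcongr
  nlinarith

lemma cutoff (a : A) (ha : 0 ≤ a) {η : ℝ} (hη : 0 < η) :
    ∃ F H : A, star F = F ∧ star H = H ∧ H * F = F ∧ F * H = F ∧ ‖F‖ ≤ 1 ∧
      H * H ≤ η⁻¹ • a ∧ 0 ≤ H + H - H * H ∧ ‖a - a * F - F * a + F * a * F‖ ≤ 2 * η := by
  have hsa : IsSelfAdjoint a := .of_nonneg ha
  let f : ℝ → ℝ := fun t => max 0 (min 1 (t / η - 1))
  let k : ℝ → ℝ := fun t => max 0 (min 1 (t / η))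
  have hf : Continuous f := by fun_prop
  have hk : Continuous k := by fun_prop
  have hf0 : f 0 = 0 := by simp [f]
  have hk0 : k 0 = 0 := by simp [k]
  have hf1 : ∀ t, 0 ≤ f t ∧ f t ≤ 1 := fun t => ⟨le_max_left _ _, by simp [f]⟩
  have hk1 : ∀ t, 0 ≤ k t ∧ k t ≤ 1 := fun t => ⟨le_max_left _ _, by simp [k]⟩
  have hkf : ∀ t, k t * f t = f t := fun t => by
    rcases le_total (t / η) 1 with h | h
    · have : f t = 0 := by simp only [f]; rw [max_eq_left]; exact (min_le_right _ _).trans (by linarith)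
      simp [this]
    · have : k t = 1 := by simp [k, h]
      simp [this]
  have hspec : ∀ t ∈ quasispectrum ℝ a, 0 ≤ t := fun t ht => quasispectrum_nonneg_of_nonneg a ha t ht
  have e1 : cfcₙ k a * cfcₙ f a = cfcₙ f a := by
    rw [← cfcₙ_mul k f a hk.continuousOn hk0 hf.continuousOn hf0]
    simp only [hkf]
  have e2 : cfcₙ f a * cfcₙ k a = cfcₙ f a := by
    rw [← cfcₙ_mul f k a hf.continuousOn hf0 hk.continuousOn hk0]
    simp only [mul_comm (f _), hkf]
  have ea : cfcₙ (fun t : ℝ => t) a = a := cfcₙ_id' ℝ a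
  refine ⟨cfcₙ f a, cfcₙ k a, ?_, ?_, e1, e2, ?_, ?_, ?_, ?_⟩
  · exact (cfcₙ_predicate f a : IsSelfAdjoint _)
  · exact (cfcₙ_predicate k a : IsSelfAdjoint _)
  · exact norm_cfcₙ_le fun t _ => by rw [Real.norm_of_nonneg (hf1 t).1]; exact (hf1 t).2
  · rw [← cfcₙ_mul k k a hk.continuousOn hk0 hk.continuousOn hk0]
    conv_rhs => rw [← ea]
    rw [← cfcₙ_smul η⁻¹ (fun t : ℝ => t) a]
    refine cfcₙ_mono (fun t ht => ?_) (by fun_prop) (by fun_prop) (by simp [hk0]) (by simp)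
    have h1 : k t ≤ t / η := by
      simp only [k]
      exact max_le (div_nonneg (hspec t ht) hη.le) (min_le_right _ _)
    have : η⁻¹ • t = t / η := by simp [div_eq_inv_mul]
    rw [this]
    nlinarith [hk1 t]
  · rw [← cfcₙ_mul k k a hk.continuousOn hk0 hk.continuousOn hk0,
      ← cfcₙ_add k k a hk.continuousOn hk0 hk.continuousOn hk0,
      ← cfcₙ_sub (fun t => k t + k t) (fun t => k t * k t) a (by fun_prop) (by simp [hk0]) (by fun_prop) (by simp [hk0])]
    exact cfcₙ_nonneg fun t _ => by nlinarith [hk1 t]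
  · have e : a - a * cfcₙ f a - cfcₙ f a * a + cfcₙ f a * a * cfcₙ f a =
        cfcₙ (fun t => t - t * f t - f t * t + f t * t * f t) a := by
      rw [cfcₙ_add (fun t => t - t * f t - f t * t) (fun t => f t * t * f t) a (by fun_prop) (by simp) (by fun_prop) (by simp),
        cfcₙ_sub (fun t => t - t * f t) (fun t => f t * t) a (by fun_prop) (by simp) (by fun_prop) (by simp),
        cfcₙ_sub (fun t => t) (fun t => t * f t) a (by fun_prop) (by simp) (by fun_prop) (by simp),
        cfcₙ_mul (fun t => f t * t) f a (by fun_prop) (by simp) (by fun_prop) hf0,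
        cfcₙ_mul (fun t => t) f a (by fun_prop) (by simp) (by fun_prop) hf0,
        cfcₙ_mul f (fun t => t) a (by fun_prop) hf0 (by fun_prop) (by simp), ea]
    rw [e]
    refine norm_cfcₙ_le fun t ht => ?_
    have h0 := hspec t ht
    have e3 : t - t * f t - f t * t + f t * t * f t = t * (1 - f t) ^ 2 := by ring
    rw [e3, Real.norm_of_nonneg (by positivity)]
    rcases le_total (2 * η) t with h | h
    · have : f t = 1 := by
        have : 1 ≤ t / η - 1 := by
          rw [le_sub_iff_add_le, le_div_iff₀ hη]; linarith
        simp [f, this]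
      rw [this]; simp; positivity
    · calc t * (1 - f t) ^ 2 ≤ t * 1 := by
            gcongr
            nlinarith [hf1 t]
        _ ≤ 2 * η := by linarith

/-- `H` is contractive complement. -/
lemma norm_sub_mul_le {H : A} (hs : star H = H) (h : 0 ≤ H + H - H * H) (x : A) :
    ‖x - H * x‖ ≤ ‖x‖ := by
  have e : star (x - H * x) * (x - H * x) = star x * x - star x * (H + H - H * H) * x := by
    simp only [star_sub, star_mul, hs]
    noncomm_ring
  have h1 : star (x - H * x) * (x - H * x) ≤ star x * x := by
    rw [e]
    exact sub_le_self _ (star_left_conjugate_nonneg h x)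
  have h2 := CStarAlgebra.norm_le_norm_of_nonneg_of_le (star_mul_self_nonneg _) h1
  rw [CStarRing.norm_star_mul_self, CStarRing.norm_star_mul_self] at h2
  exact abs_le_of_sq_le_sq' (by nlinarith) (norm_nonneg _) |>.2

lemma norm_sub_mul_le' {H : A} (hs : star H = H) (h : 0 ≤ H + H - H * H) (x : A) :
    ‖x - x * H‖ ≤ ‖x‖ := by
  have := norm_sub_mul_le hs h (star x)
  rw [← norm_star (x - x * H), ← norm_star x]
  simpa [hs] using this

lemma mul_eq_zero_of_le {H a z : A} {η : ℝ} (hs : star H = H)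
    (h : H * H ≤ η⁻¹ • a) (hz : z * a = 0) : z * H = 0 := by
  have h1 : z * (H * H) * star z ≤ z * (η⁻¹ • a) * star z := star_right_conjugate_le_conjugate h z
  have h2 : z * (η⁻¹ • a) * star z = 0 := by
    rw [mul_smul_comm, hz]; simp
  have h3 : z * (H * H) * star z = (z * H) * star (z * H) := by
    simp [hs, mul_assoc]
  rw [h2, h3] at h1
  have h4 := le_antisymm h1 (mul_star_self_nonneg _)
  exact CStarRing.mul_star_self_eq_zero_iff _ |>.1 h4

lemma norm_sub_sq {y F : A} {η : ℝ} (hs : star F = F) {a : A} (ha : star y * y = a)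
    (h : ‖a - a * F - F * a + F * a * F‖ ≤ 2 * η) : ‖y - y * F‖ ^ 2 ≤ 2 * η := by
  have e : star (y - y * F) * (y - y * F) = a - a * F - F * a + F * a * F := by
    rw [← ha]
    simp only [star_sub, star_mul, hs]
    noncomm_ring
  rw [sq, ← CStarRing.norm_star_mul_self, e]
  exact h

end order


section step
variable {A : Type*} [NonUnitalCStarAlgebra A]

/-- The elements orthogonal to all members of `D`. -/
def Ann (D : Set A) : Submodule ℂ A where
  carrier := {x | ∀ d ∈ D, star d * x = 0 ∧ x * star d = 0}
  add_mem' := fun {x y} hx hy d hd => by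
    simp [mul_add, add_mul, hx d hd, hy d hd]
  zero_mem' := fun d _ => by simp
  smul_mem' := fun c x hx d hd => by
    simp [mul_smul_comm, smul_mul_assoc, hx d hd]

lemma mem_Ann {D : Set A} {x : A} : x ∈ Ann D ↔ ∀ d ∈ D, star d * x = 0 ∧ x * star d = 0 := Iff.rfl

/-- The functionals `φ m`, `m ∈ S`, restricted to `Ann D` span `ℓ₁` `ρ`-isomorphically. -/
def Spans (φ : ℕ → A →L[ℂ] ℂ) (D : Set A) (ρ : ℝ) (S : Set ℕ) : Prop :=
  ∀ s : Finset ℕ, (∀ m ∈ s, m ∈ S) → ∀ α : ℕ → ℂ, ∀ η > (0 : ℝ),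
    ∃ x ∈ Ann D, ‖x‖ ≤ 1 ∧ ρ * ∑ m ∈ s, ‖α m‖ - η ≤ ‖∑ m ∈ s, α m * φ m x‖

lemma hb {ι : Type*} [Fintype ι] (V : Submodule ℂ A) (ψ : ι → A →L[ℂ] ℂ) {ρ : ℝ} (hρ : 0 ≤ ρ)
    (hV : ∀ β : ι → ℂ, ∀ η > (0 : ℝ), ∃ x ∈ V, ‖x‖ ≤ 1 ∧ ρ * ∑ i, ‖β i‖ - η ≤ ‖∑ i, β i * ψ i x‖)
    (θ : ι → ℂ) (hθ : ∀ i, ‖θ i‖ ≤ 1) {η : ℝ} (hη : 0 < η) :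
    ∃ x ∈ V, ‖x‖ ≤ 1 ∧ ∀ i, ‖ψ i x - ρ * θ i‖ ≤ η := by
  classical
  let Φ : A →ₗ[ℂ] (ι → ℂ) := LinearMap.pi fun i => (ψ i : A →ₗ[ℂ] ℂ)
  let K : Set A := {x | x ∈ V ∧ ‖x‖ ≤ 1}
  have hK : Convex ℝ K := by
    intro x hx y hy a b ha hb hab
    refine ⟨V.add_mem ?_ ?_, ?_⟩
    · have := V.smul_mem (a : ℂ) hx.1
      simpa using this
    · have := V.smul_mem (b : ℂ) hy.1
      simpa using this
    · calc _ ≤ ‖a • x‖ + ‖b • y‖ := norm_add_le _ _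
        _ = a * ‖x‖ + b * ‖y‖ := by rw [norm_smul, norm_smul, Real.norm_of_nonneg ha, Real.norm_of_nonneg hb]
        _ ≤ a * 1 + b * 1 := by gcongr; exacts [hx.2, hy.2]
        _ = 1 := by linarith
  have hΦK : Convex ℝ (Set.image Φ K) := hK.linear_image (Φ.restrictScalars ℝ)
  have key : (fun i => (ρ : ℂ) * θ i) ∈ closure (Set.image Φ K) := by
    by_contra hcon
    obtain ⟨f, u, hfu, huf⟩ := RCLike.geometric_hahn_banach_closed_point (𝕜 := ℂ)
      hΦK.closure isClosed_closure hcon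
    let β : ι → ℂ := fun i => f (Pi.single i 1)
    have hf : ∀ v : ι → ℂ, f v = ∑ i, β i * v i := fun v => by
      conv_lhs => rw [← Finset.univ_sum_single v]
      rw [map_sum]
      refine Finset.sum_congr rfl fun i _ => ?_
      have : (Pi.single i (v i) : ι → ℂ) = v i • (Pi.single i 1 : ι → ℂ) := by
        rw [← Pi.single_smul]; simp
      rw [this, map_smul, smul_eq_mul, mul_comm]
    have h1 : RCLike.re (f (fun i => (ρ : ℂ) * θ i)) ≤ ρ * ∑ i, ‖β i‖ := by
      refine (RCLike.re_le_norm _).trans ?_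
      rw [hf, Finset.mul_sum]
      refine (norm_sum_le _ _).trans ?_
      gcongr with i
      rw [norm_mul, norm_mul, Complex.norm_real, Real.norm_of_nonneg hρ]
      have := hθ i
      calc ‖β i‖ * (ρ * ‖θ i‖) ≤ ‖β i‖ * (ρ * 1) := by gcongr
        _ = _ := by ring
    obtain ⟨x, hxV, hx1, hx2⟩ := hV β (ρ * ∑ i, ‖β i‖ - u) (by linarith)
    obtain ⟨l, hl1, hl2⟩ := RCLike.exists_norm_eq_mul_self (∑ i, β i * ψ i x)
    have h2 := hfu (Φ (l • x)) (subset_closure ⟨l • x, ⟨V.smul_mem _ hxV, by simpa [norm_smul, hl1] using hx1⟩, rfl⟩)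
    have h3 : f (Φ (l • x)) = (‖∑ i, β i * ψ i x‖ : ℂ) := by
      rw [map_smul, map_smul, hf, smul_eq_mul]
      exact hl2.symm
    rw [h3] at h2
    have h4 : (RCLike.re ((‖∑ i, β i * ψ i x‖ : ℝ) : ℂ) : ℝ) = ‖∑ i, β i * ψ i x‖ := RCLike.ofReal_re _
    rw [h4] at h2
    linarith
  obtain ⟨v, ⟨x, hx, rfl⟩, hd⟩ := Metric.mem_closure_iff.1 key η hη
  refine ⟨x, hx.1, hx.2, fun i => ?_⟩
  have := (dist_pi_lt_iff hη).1 hd i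
  rw [dist_comm, dist_eq_norm] at this
  exact this.le

lemma bessel {ι : Type*} [Fintype ι] [DecidableEq ι] (U : ι → ι → ℂ) (x : ι → A) (hx : ∀ i, ‖x i‖ ≤ 1)
    (hU : ∀ j l, ∑ k, star (U k j) * U k l = if j = l then (Fintype.card ι : ℂ) else 0) :
    ‖∑ k, star (∑ j, U k j • x j) * (∑ l, U k l • x l)‖ ≤ (Fintype.card ι : ℝ) ^ 2 := by
  have e : ∑ k, star (∑ j, U k j • x j) * (∑ l, U k l • x l)
      = (Fintype.card ι : ℂ) • ∑ j, star (x j) * x j := by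
    simp only [star_sum, star_smul, Finset.sum_mul, Finset.mul_sum, smul_mul_assoc, mul_smul_comm]
    rw [Finset.sum_comm, Finset.smul_sum]
    refine Finset.sum_congr rfl fun j _ => ?_
    simp only [Finset.smul_sum, smul_smul]
    rw [Finset.sum_comm]
    simp only [← Finset.sum_smul]
    have : ∀ l, ∑ k, U k j * star (U k l) = if l = j then (Fintype.card ι : ℂ) else 0 := fun l => by
      rw [← hU]; simp only [mul_comm]
    simp only [this]
    simp
  rw [e, norm_smul, Complex.norm_natCast, sq]
  gcongr
  calc _ ≤ ∑ i, ‖star (x i) * x i‖ := norm_sum_le _ _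
    _ ≤ ∑ i : ι, (1:ℝ) := by
      gcongr with i
      rw [CStarRing.norm_star_mul_self]
      nlinarith [hx i, norm_nonneg (x i)]
    _ = _ := by simp

/-- Quasi-orthogonal biorthogonal elements. -/
lemma biorth (N : ℕ) [NeZero N] (V : Submodule ℂ A) (ψ : ZMod N → A →L[ℂ] ℂ) {ρ : ℝ} (hρ : 0 ≤ ρ)
    (hV : ∀ β : ZMod N → ℂ, ∀ η > (0 : ℝ),
      ∃ x ∈ V, ‖x‖ ≤ 1 ∧ ρ * ∑ i, ‖β i‖ - η ≤ ‖∑ i, β i * ψ i x‖)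
    {η : ℝ} (hη : 0 < η) :
    ∃ y : ZMod N → A, (∀ k, y k ∈ V) ∧ (∀ k, ‖y k‖ ≤ 1) ∧ ‖∑ k, star (y k) * y k‖ ≤ 1 ∧
      ‖∑ k, y k * star (y k)‖ ≤ 1 ∧ ∀ k, ‖ψ k (y k) - ρ‖ ≤ η := by
  let χ : AddChar (ZMod N) ℂ := ZMod.stdAddChar
  have hχ1 : ∀ a, ‖χ a‖ = 1 := fun a => AddChar.norm_apply _ _
  have hχs : ∀ a, star (χ a) = χ (-a) := fun a => (AddChar.map_neg_eq_conj χ a).symm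
  choose x hxV hx1 hx2 using fun j : ZMod N => hb V ψ hρ hV (fun k => χ (k * j)) (fun k => (hχ1 _).le) hη
  have hN0 : (N : ℂ) ≠ 0 := Nat.cast_ne_zero.2 (NeZero.ne N)
  have hNr : (0 : ℝ) < N := Nat.cast_pos.2 (NeZero.pos N)
  have horth : ∀ b : ZMod N, ∑ k, χ (k * b) = if b = 0 then (N : ℂ) else 0 := fun b => by
    rw [AddChar.sum_mulShift b (ZMod.isPrimitive_stdAddChar N)]
    simp [ZMod.card]
  refine ⟨fun k => (N : ℂ)⁻¹ • ∑ j, χ (-(k * j)) • x j, fun k => ?_, fun k => ?_, ?_, ?_, fun k => ?_⟩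
  · exact V.smul_mem _ (V.sum_mem fun j _ => V.smul_mem _ (hxV j))
  · rw [norm_smul, norm_inv, Complex.norm_natCast, inv_mul_le_iff₀ hNr, mul_one]
    refine (norm_sum_le _ _).trans ?_
    calc _ ≤ ∑ j : ZMod N, (1 : ℝ) := by
          gcongr with j
          rw [norm_smul, hχ1, one_mul]; exact hx1 j
      _ = N := by simp [ZMod.card]
  · have h := bessel (fun k j => χ (-(k * j))) x hx1 (fun j l => by
      simp only [hχs, ← AddChar.map_add_eq_mul]
      have : ∀ k : ZMod N, - -(k * j) + -(k * l) = k * (j - l) := fun k => by ring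
      simp only [this, horth, sub_eq_zero, ZMod.card])
    have e : ∑ k : ZMod N, star ((N : ℂ)⁻¹ • ∑ j, χ (-(k * j)) • x j) * ((N : ℂ)⁻¹ • ∑ j, χ (-(k * j)) • x j)
        = ((N : ℂ)⁻¹ ^ 2) • ∑ k : ZMod N, star (∑ j, χ (-(k * j)) • x j) * (∑ j, χ (-(k * j)) • x j) := by
      rw [Finset.smul_sum]
      refine Finset.sum_congr rfl fun k _ => ?_
      rw [star_smul, smul_mul_smul_comm, sq]
      simp
    rw [e, norm_smul, norm_pow, norm_inv, Complex.norm_natCast, inv_pow, inv_mul_le_iff₀ (by positivity), mul_one]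
    simpa [ZMod.card] using h
  · have h := bessel (fun k j => χ (k * j)) (fun j => star (x j)) (fun j => by simpa using hx1 j) (fun j l => by
      simp only [hχs, ← AddChar.map_add_eq_mul]
      have : ∀ k : ZMod N, -(k * j) + k * l = k * (l - j) := fun k => by ring
      simp only [this, horth, sub_eq_zero, ZMod.card, eq_comm])
    have e : ∑ k : ZMod N, ((N : ℂ)⁻¹ • ∑ j, χ (-(k * j)) • x j) * star ((N : ℂ)⁻¹ • ∑ j, χ (-(k * j)) • x j)
        = ((N : ℂ)⁻¹ ^ 2) • ∑ k : ZMod N, star (∑ j, χ (k * j) • star (x j)) * (∑ j, χ (k * j) • star (x j)) := by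
      rw [Finset.smul_sum]
      refine Finset.sum_congr rfl fun k _ => ?_
      rw [star_smul, smul_mul_smul_comm, sq]
      simp [star_sum, star_smul, ← hχs]
    rw [e, norm_smul, norm_pow, norm_inv, Complex.norm_natCast, inv_pow, inv_mul_le_iff₀ (by positivity), mul_one]
    simpa [ZMod.card] using h
  · have e : ψ k ((N : ℂ)⁻¹ • ∑ j, χ (-(k * j)) • x j) - ρ
        = (N : ℂ)⁻¹ * ∑ j, χ (-(k * j)) * (ψ k (x j) - ρ * χ (k * j)) := by
      have h1 : ∀ j, χ (-(k * j)) * (ψ k (x j) - ρ * χ (k * j)) = χ (-(k * j)) * ψ k (x j) - ρ := fun j => by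
        have : χ (-(k * j)) * χ (k * j) = 1 := by rw [← AddChar.map_add_eq_mul]; simp
        linear_combination (-(ρ : ℂ)) * this
      simp only [h1, Finset.sum_sub_distrib, map_smul, map_sum, smul_eq_mul, mul_sub]
      simp [ZMod.card, hN0]
    rw [e, norm_mul, norm_inv, Complex.norm_natCast, inv_mul_le_iff₀ hNr]
    refine (norm_sum_le _ _).trans ?_
    calc _ ≤ ∑ j : ZMod N, η := by
          gcongr with j
          rw [norm_mul, hχ1, one_mul]; exact hx2 j k
      _ = N * η := by simp [ZMod.card]

end step

section main
variable {A : Type*} [NonUnitalCStarAlgebra A]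

lemma norm_sum_cut {ι : Type*} [Fintype ι] [PartialOrder A] [StarOrderedRing A] {η : ℝ} (hη : 0 < η)
    (H b : ι → A) (hle : ∀ i, H i * H i ≤ η⁻¹ • b i) (hs : ∀ i, star (H i) = H i)
    (hb : ‖∑ i, b i‖ ≤ 1) : ‖∑ i, H i * H i‖ ≤ η⁻¹ := by
  have h1 : 0 ≤ ∑ i, H i * H i := Finset.sum_nonneg fun i _ => by
    have := star_mul_self_nonneg (H i)
    rwa [hs] at this
  have h2 : ∑ i, H i * H i ≤ η⁻¹ • ∑ i, b i := by
    rw [Finset.smul_sum]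
    exact Finset.sum_le_sum fun i _ => hle i
  refine (CStarAlgebra.norm_le_norm_of_nonneg_of_le h1 h2).trans ?_
  rw [norm_smul, Real.norm_of_nonneg (by positivity)]
  exact mul_le_of_le_one_right (by positivity) hb

lemma step (φ : ℕ → A →L[ℂ] ℂ) (hφ : ∀ m, ‖φ m‖ ≤ 1) (D : Set A) {ρ : ℝ} (hρ : 0 ≤ ρ) {S : Set ℕ}
    (hS : S.Infinite) (hsp : Spans φ D ρ S) {δ : ℝ} (hδ : 0 < δ) :
    ∃ m ∈ S, ∃ c ∈ Ann D, ‖c‖ ≤ 1 ∧ ρ - δ ≤ (φ m c).re ∧ ∃ S' ⊆ S, S'.Infinite ∧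
      (∀ k ∈ S', m < k) ∧ Spans φ (insert c D) (ρ - δ) S' := by
  classical
  let _ : PartialOrder A := CStarAlgebra.spectralOrder A
  have : StarOrderedRing A := CStarAlgebra.spectralOrderedRing A
  obtain ⟨η, hη, hη2⟩ : ∃ η : ℝ, 0 < η ∧ 2 * η = (δ / 8) ^ 2 := ⟨δ ^ 2 / 128, by positivity, by ring⟩
  obtain ⟨N, hN⟩ := exists_nat_gt (4 * η⁻¹ / (δ / 2) ^ 2)
  have hN0 : 0 < N := by
    have : (0 : ℝ) < N := lt_trans (by positivity) hN
    exact_mod_cast this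
  have : NeZero N := ⟨hN0.ne'⟩
  rw [div_lt_iff₀' (by positivity)] at hN
  let e := hS.natEmbedding S
  let κ : ZMod N → ℕ := fun k => e k.val
  have hκ : Function.Injective κ := fun a b h =>
    ZMod.val_injective N (e.injective (Subtype.ext h))
  have hκS : ∀ k, κ k ∈ S := fun k => (e k.val).2
  obtain ⟨y, hyV, hy1, hya, hyb, hyρ⟩ := biorth N (Ann D) (fun k => φ (κ k)) hρ (by
    intro β η hη
    obtain ⟨x, hx, hx1, hx2⟩ := hsp (Finset.univ.image κ) (by simp [hκS])
      (fun m => β (Function.invFun κ m)) η hη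
    refine ⟨x, hx, hx1, ?_⟩
    rw [Finset.sum_image (fun a _ b _ h => hκ h), Finset.sum_image (fun a _ b _ h => hκ h)] at hx2
    simpa only [Function.leftInverse_invFun hκ _] using hx2) (half_pos hδ)
  choose Fa Ha sFa sHa HFa FHa nFa leHa posHa errFa using
    fun k => cutoff (star (y k) * y k) (star_mul_self_nonneg _) hη
  choose Fb Hb sFb sHb HFb FHb nFb leHb posHb errFb using
    fun k => cutoff (y k * star (y k)) (mul_star_self_nonneg _) hη
  have hSa := norm_sum_cut hη Ha _ leHa sHa hya
  have hSb := norm_sum_cut hη Hb _ leHb sHb hyb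
  have hpig : ∀ m, ∃ i, ∀ x, ‖x‖ ≤ 1 → ‖φ m (Hb i * x)‖ ≤ δ / 2 ∧ ‖φ m (x * Ha i)‖ ≤ δ / 2 := fun m =>
    pigeon (φ m) (hφ m) Hb Ha (half_pos hδ) (by simpa only [sHb] using hSb)
      (by simpa only [sHa] using hSa) (by simpa only [ZMod.card] using hN)
  choose i hi using hpig
  obtain ⟨j, hj⟩ : ∃ j, {m | m ∈ S ∧ i m = j}.Infinite := by
    by_contra! hcon
    refine hS ((Set.finite_iUnion hcon).subset fun m hm => ?_)
    exact Set.mem_iUnion.2 ⟨i m, hm, rfl⟩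
  -- annihilation facts
  have annb : ∀ d ∈ D, star d * Hb j = 0 := fun d hd =>
    mul_eq_zero_of_le (sHb j) (leHb j) (by rw [← mul_assoc, (hyV j d hd).1, zero_mul])
  have anna : ∀ d ∈ D, Ha j * star d = 0 := fun d hd => by
    have h1 : d * Ha j = 0 := mul_eq_zero_of_le (sHa j) (leHa j) (by
      have := congrArg star (hyV j d hd).2
      rw [star_mul, star_star, star_zero] at this
      rw [← mul_assoc, this, zero_mul])
    have := congrArg star h1
    rwa [star_mul, sHa, star_zero] at this
  set c := Fb j * y j * Fa j with hc
  have hyc : ‖y j - c‖ ≤ δ / 4 := by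
    have h1 : ‖y j - y j * Fa j‖ ≤ δ / 8 := by
      have := norm_sub_sq (sFa j) rfl (errFa j)
      rw [hη2] at this
      exact (abs_le_of_sq_le_sq' this (by positivity)).2
    have h2 : ‖y j - Fb j * y j‖ ≤ δ / 8 := by
      have := norm_sub_sq (y := star (y j)) (sFb j) (by rw [star_star]) (errFb j)
      rw [hη2, ← norm_star] at this
      have := (abs_le_of_sq_le_sq' this (by positivity)).2
      simpa [sFb] using this
    have e : y j - c = (y j - Fb j * y j) + Fb j * (y j - y j * Fa j) := by
      rw [hc]; noncomm_ring
    rw [e]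
    calc _ ≤ ‖y j - Fb j * y j‖ + ‖Fb j‖ * ‖y j - y j * Fa j‖ :=
          (norm_add_le _ _).trans (by gcongr; exact norm_mul_le _ _)
      _ ≤ δ / 8 + 1 * (δ / 8) := by gcongr; exact nFb j
      _ = δ / 4 := by ring
  have hc1 : ‖c‖ ≤ 1 := by
    calc ‖c‖ ≤ ‖Fb j‖ * ‖y j‖ * ‖Fa j‖ := (norm_mul_le _ _).trans (by gcongr; exact norm_mul_le _ _)
      _ ≤ 1 * 1 * 1 := by gcongr; exacts [nFb j, hy1 j, nFa j]
      _ = 1 := by norm_num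
  have hcV : c ∈ Ann D := fun d hd => by
    constructor
    · rw [hc, ← HFb j]
      simp only [← mul_assoc, annb d hd, zero_mul]
    · rw [hc, ← FHa j]
      simp only [mul_assoc, anna d hd, mul_zero]
  have hcb : star c * Hb j = star c := by
    rw [hc]; simp only [star_mul, sFa, sFb, mul_assoc, FHb]
  have hca : Ha j * star c = star c := by
    rw [hc]; simp only [star_mul, sFa, sFb, ← mul_assoc, HFa]
  refine ⟨κ j, hκS j, c, hcV, hc1, ?_, {m | m ∈ S ∧ i m = j} \ Set.Iic (κ j),
    fun m hm => hm.1.1, hj.sdiff (Set.finite_Iic _), fun k hk => not_le.1 hk.2, ?_⟩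
  · have h1 := hyρ j
    have h2 : ‖φ (κ j) (y j - c)‖ ≤ δ / 4 := by
      simpa using (φ (κ j)).le_of_opNorm_le_of_le (hφ _) hyc
    have h3 : ‖φ (κ j) c - ρ‖ ≤ δ := by
      have : φ (κ j) c - ρ = (φ (κ j) (y j) - ρ) - φ (κ j) (y j - c) := by rw [map_sub]; ring
      rw [this]
      refine (norm_sub_le _ _).trans ?_
      linarith
    have h4 := (Complex.abs_re_le_norm _).trans h3
    rw [Complex.sub_re, Complex.ofReal_re] at h4
    linarith [(abs_le.1 h4).1]
  · intro s hs α ξ hξ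
    obtain ⟨x, hxV, hx1, hx2⟩ := hsp s (fun m hm => (hs m hm).1.1) α ξ hξ
    set w := x - Hb j * x with hw
    have hw1 : ‖w‖ ≤ 1 := (norm_sub_mul_le (sHb j) (posHb j) x).trans hx1
    have hcw : star c * w = 0 := by
      rw [hw, mul_sub, ← mul_assoc, hcb, sub_self]
    refine ⟨w - w * Ha j, ?_, (norm_sub_mul_le' (sHa j) (posHa j) w).trans hw1, ?_⟩
    · intro d hd
      rcases Set.mem_insert_iff.1 hd with rfl | hd
      · constructor
        · rw [mul_sub, ← mul_assoc, hcw, zero_mul, sub_zero]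
        · rw [sub_mul, mul_assoc, hca, sub_self]
      · have hdw : star d * w = 0 := by
          rw [hw, mul_sub, ← mul_assoc, annb d hd, (hxV d hd).1, zero_mul, sub_zero]
        have hwd : w * star d = 0 := by
          rw [hw, sub_mul, mul_assoc, (hxV d hd).2, mul_zero, sub_zero]
        constructor
        · rw [mul_sub, ← mul_assoc, hdw, zero_mul, sub_zero]
        · rw [sub_mul, mul_assoc, anna d hd, hwd, mul_zero, sub_zero]
    · have hdiff : ‖∑ m ∈ s, α m * φ m x - ∑ m ∈ s, α m * φ m (w - w * Ha j)‖ ≤ δ * ∑ m ∈ s, ‖α m‖ := by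
        rw [← Finset.sum_sub_distrib, Finset.mul_sum]
        refine (norm_sum_le _ _).trans (Finset.sum_le_sum fun m hm => ?_)
        have him : i m = j := (hs m hm).1.2
        have e1 : α m * φ m x - α m * φ m (w - w * Ha j) = α m * (φ m (Hb j * x) + φ m (w * Ha j)) := by
          have : x = w + Hb j * x := by rw [hw]; abel
          conv_lhs => enter [1]; rw [this]
          simp only [map_sub, map_add]; ring
        rw [e1, norm_mul, mul_comm]
        gcongr
        have h1 := (hi m x hx1).1
        have h2 := (hi m w hw1).2
        rw [him] at h1 h2
        exact (norm_add_le _ _).trans (by linarith)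
      have := norm_sub_norm_le (∑ m ∈ s, α m * φ m x) (∑ m ∈ s, α m * φ m (w - w * Ha j))
      rw [sub_mul]
      linarith

/-- The sequence of orthogonal elements, before the Simons extraction. -/
lemma orth_seq (φ : ℕ → A →L[ℂ] ℂ) (hφ : ∀ m, ‖φ m‖ ≤ 1) {r t : ℝ} (hr : 0 ≤ t) (ht : t < r)
    (hsp : Spans φ ∅ r Set.univ) :
    ∃ m : ℕ → ℕ, StrictMono m ∧ ∃ c : ℕ → A,
        (∀ n k, n ≠ k → c n * star (c k) = 0 ∧ star (c k) * c n = 0) ∧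
        (∀ n, ‖c n‖ ≤ 1) ∧ (∀ n, t < (φ (m n) (c n)).re) := by
  let ρ : ℕ → ℝ := fun n => t + (r - t) * (1 / 2) ^ n
  have hpos : 0 < r - t := sub_pos.2 ht
  have hρ0 : ∀ n, t < ρ n := fun n => by
    have : 0 < (r - t) * (1 / 2) ^ n := by positivity
    simp only [ρ]; linarith
  let δ : ℕ → ℝ := fun n => (r - t) * (1 / 2) ^ (n + 1)
  have hδ0 : ∀ n, 0 < δ n := fun n => by simp only [δ]; positivity
  have hρδ : ∀ n, ρ n - δ n = ρ (n + 1) := fun n => by simp only [ρ, δ]; ring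
  let St := (n : ℕ) → {p : Set ℕ × Set A // p.1.Infinite ∧ Spans φ p.2 (ρ n) p.1}
  have hstep : ∀ n, ∀ p : {p : Set ℕ × Set A // p.1.Infinite ∧ Spans φ p.2 (ρ n) p.1},
      ∃ q : {p : Set ℕ × Set A // p.1.Infinite ∧ Spans φ p.2 (ρ (n + 1)) p.1}, ∃ m ∈ p.1.1,
        ∃ c ∈ Ann p.1.2, ‖c‖ ≤ 1 ∧ t < (φ m c).re ∧ q.1.1 ⊆ p.1.1 ∧ (∀ k ∈ q.1.1, m < k) ∧
          q.1.2 = insert c p.1.2 := by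
    rintro n ⟨⟨S, D⟩, hS, hD⟩
    obtain ⟨m, hm, c, hc, hc1, hre, S', hS', hinf, hlt, hsp'⟩ :=
      step φ hφ D (hr.trans (hρ0 n).le) hS hD (hδ0 n)
    rw [hρδ] at hre hsp'
    exact ⟨⟨⟨S', insert c D⟩, hinf, hsp'⟩, m, hm, c, hc, hc1, (hρ0 _).trans_le hre, hS', hlt, rfl⟩
  choose q m hm c hc hc1 hre hsub hlt hins using hstep
  let p0 : {p : Set ℕ × Set A // p.1.Infinite ∧ Spans φ p.2 (ρ 0) p.1} :=
    ⟨⟨Set.univ, ∅⟩, Set.infinite_univ, by simpa [ρ] using hsp⟩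
  let p : St := fun n => Nat.rec p0 (fun n p => q n p) n
  have hp : ∀ n, p (n + 1) = q n (p n) := fun n => rfl
  have hanti : Antitone fun n => (p n).1.1 := antitone_nat_of_succ_le fun n => by
    rw [hp]; exact hsub n (p n)
  have hmono : Monotone fun n => (p n).1.2 := monotone_nat_of_le_succ fun n => by
    rw [hp, hins]; exact Set.subset_insert _ _
  have hmem : ∀ n, c n (p n) ∈ (p (n + 1)).1.2 := fun n => by
    rw [hp, hins]; exact Set.mem_insert _ _
  have horth : ∀ k n, k < n → star (c k (p k)) * c n (p n) = 0 ∧ c n (p n) * star (c k (p k)) = 0 :=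
    fun k n hkn => hc n (p n) _ (hmono (Nat.succ_le_of_lt hkn) (hmem k))
  refine ⟨fun n => m n (p n), strictMono_nat_of_lt_succ fun n => ?_, fun n => c n (p n), ?_,
    fun n => hc1 n _, fun n => hre n _⟩
  · refine hlt n (p n) _ ?_
    rw [← hp]
    exact hm (n + 1) (p (n + 1))
  · intro n k hnk
    rcases lt_or_gt_of_ne hnk with h | h
    · obtain ⟨h1, h2⟩ := horth n k h
      have h1' := congrArg star h1
      have h2' := congrArg star h2
      simp only [star_mul, star_star, star_zero] at h1' h2'
      exact ⟨h2', h1'⟩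
    · exact (horth k n h).symm

/-- Orthogonal families behave like `ℓ∞`. -/
lemma norm_orth_pow (n : ℕ) : ∀ (F : Finset ℕ) (d : ℕ → A),
    (∀ i ∈ F, ∀ j ∈ F, i ≠ j → d i * star (d j) = 0 ∧ star (d j) * d i = 0) → (∀ i ∈ F, ‖d i‖ ≤ 1) →
    ‖∑ i ∈ F, d i‖ ^ (3 ^ n) ≤ F.card := by
  induction n with
  | zero =>
    intro F d _ h1
    simp only [pow_zero, pow_one]
    refine (norm_sum_le _ _).trans ((Finset.sum_le_sum h1).trans ?_)
    simp
  | succ n ih =>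
    intro F d ho h1
    have hcube : ∀ y : A, ‖y * star y * y‖ = ‖y‖ ^ 3 := fun y => by
      have hle : ‖y * star y * y‖ ≤ ‖y‖ ^ 3 := by
        calc _ ≤ ‖y‖ * ‖star y‖ * ‖y‖ := (norm_mul_le _ _).trans (by gcongr; exact norm_mul_le _ _)
          _ = _ := by rw [norm_star]; ring
      rcases eq_or_ne y 0 with rfl | hy
      · simp
      have hy0 : 0 < ‖y‖ := norm_pos_iff.2 hy
      have h4 : ‖y‖ ^ 4 ≤ ‖y‖ * ‖y * star y * y‖ := by
        calc ‖y‖ ^ 4 = ‖star (star y * y) * (star y * y)‖ := by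
              rw [CStarRing.norm_star_mul_self, CStarRing.norm_star_mul_self]; ring
          _ = ‖star y * (y * star y * y)‖ := by simp only [star_mul, star_star, mul_assoc]
          _ ≤ ‖star y‖ * ‖y * star y * y‖ := norm_mul_le _ _
          _ = _ := by rw [norm_star]
      refine le_antisymm hle (le_of_mul_le_mul_left ?_ hy0)
      calc ‖y‖ * ‖y‖ ^ 3 = ‖y‖ ^ 4 := by ring
        _ ≤ _ := h4
    have e : (∑ i ∈ F, d i) * star (∑ i ∈ F, d i) * (∑ i ∈ F, d i)
        = ∑ i ∈ F, d i * star (d i) * d i := by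
      rw [star_sum, Finset.sum_mul_sum, Finset.sum_mul]
      refine Finset.sum_congr rfl fun i hi => ?_
      rw [Finset.sum_eq_single_of_mem i hi (fun j hj hji => (ho i hi j hj hji.symm).1), Finset.mul_sum]
      rw [Finset.sum_eq_single_of_mem i hi]
      intro j hj hji
      rw [mul_assoc, (ho j hj i hi hji).2, mul_zero]
    have := ih F (fun i => d i * star (d i) * d i) (fun i hi j hj hij => by
      obtain ⟨h2, h3⟩ := ho i hi j hj hij
      constructor
      · simp only [star_mul, star_star, mul_assoc]
        rw [← mul_assoc (d i) (star (d j)), h2]; simp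
      · simp only [star_mul, star_star, mul_assoc]
        rw [← mul_assoc (star (d j)) (d i), h3]; simp)
      (fun i hi => by rw [hcube]; exact pow_le_one₀ (norm_nonneg _) (h1 i hi))
    rw [← e, hcube, ← pow_mul, mul_comm, ← pow_succ] at this
    exact this

lemma norm_orth (F : Finset ℕ) (d : ℕ → A)
    (ho : ∀ i ∈ F, ∀ j ∈ F, i ≠ j → d i * star (d j) = 0 ∧ star (d j) * d i = 0)
    (h1 : ∀ i ∈ F, ‖d i‖ ≤ 1) : ‖∑ i ∈ F, d i‖ ≤ 1 := by
  by_contra! hcon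
  obtain ⟨n, hn⟩ := pow_unbounded_of_one_lt (F.card : ℝ) hcon
  have h2 := norm_orth_pow n F d ho h1
  have h3 : n ≤ 3 ^ n := (Nat.lt_pow_self (by norm_num)).le
  have h4 := pow_le_pow_right₀ hcon.le h3
  linarith

lemma row_sum (ψ : A →L[ℂ] ℂ) (hψ : ‖ψ‖ ≤ 1) (F : Finset ℕ) (d : ℕ → A)
    (ho : ∀ i j, i ≠ j → d i * star (d j) = 0 ∧ star (d j) * d i = 0)
    (h1 : ∀ i, ‖d i‖ ≤ 1) : ∑ i ∈ F, ‖ψ (d i)‖ ≤ 1 := by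
  choose l hl1 hl2 using fun i => RCLike.exists_norm_eq_mul_self (ψ (d i))
  have h2 := norm_orth F (fun i => l i • d i) (fun i _ j _ hij => by
    obtain ⟨h2, h3⟩ := ho i j hij
    simp [smul_mul_assoc, mul_smul_comm, h2, h3]) (fun i _ => by simpa [norm_smul, hl1] using h1 i)
  have h3 := ψ.le_of_opNorm_le_of_le hψ h2
  have e : ψ (∑ i ∈ F, l i • d i) = ((∑ i ∈ F, ‖ψ (d i)‖ : ℝ) : ℂ) := by
    simp only [map_sum, map_smul, smul_eq_mul]
    push_cast
    exact Finset.sum_congr rfl fun i _ => (hl2 i).symm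
  rw [e, Complex.norm_real, Real.norm_of_nonneg (Finset.sum_nonneg fun _ _ => norm_nonneg _)] at h3
  simpa using h3

/-- The Rosenthal lemma. -/
lemma rosenthal (a : ℕ → ℕ → ℝ) {ε : ℝ} (hε : 0 < ε) (n : ℕ) :
    ∀ M : Set ℕ, M.Infinite →
      (∀ i ∈ M, ∀ F : Finset ℕ, (∀ j ∈ F, j ∈ M) → ∑ j ∈ F, a i j ≤ n * ε) →
      ∃ M' ⊆ M, M'.Infinite ∧ ∀ i ∈ M', ∀ F : Finset ℕ, (∀ j ∈ F, j ∈ M') → i ∉ F →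
        ∑ j ∈ F, a i j < ε := by
  induction n with
  | zero =>
    intro M hM h
    refine ⟨M, subset_rfl, hM, fun i hi F hF _ => (h i hi F hF).trans_lt (by simpa using hε)⟩
  | succ n ih =>
    intro M hM h
    let e := hM.natEmbedding M
    let Q : ℕ → Set ℕ := fun p => Set.range fun q => (e (Nat.pair p q) : ℕ)
    have hQinj : ∀ p, Function.Injective fun q => (e (Nat.pair p q) : ℕ) := fun p q q' hq => by
      have := e.injective (Subtype.ext hq)
      exact (Nat.pair_eq_pair.1 this).2
    have hQM : ∀ p, Q p ⊆ M := by
      rintro p _ ⟨q, rfl⟩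
      exact (e _).2
    have hQdisj : ∀ p p' x, x ∈ Q p → x ∈ Q p' → p = p' := by
      rintro p p' x ⟨q, rfl⟩ ⟨q', hq'⟩
      have := e.injective (Subtype.ext hq')
      exact (Nat.pair_eq_pair.1 this).1.symm
    by_cases hgood : ∃ p, ∀ i ∈ Q p, ∀ F : Finset ℕ, (∀ j ∈ F, j ∈ Q p) → i ∉ F → ∑ j ∈ F, a i j < ε
    · obtain ⟨p, hp⟩ := hgood
      exact ⟨Q p, hQM p, Set.infinite_range_of_injective (hQinj p), hp⟩
    · push Not at hgood
      choose k hk G hG hkG hsum using hgood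
      have hkinj : Function.Injective k := fun p p' hpp => hQdisj p p' (k p) (hk p) (hpp ▸ hk p')
      obtain ⟨M', hM', hinf, hfin⟩ := ih (Set.range k) (Set.infinite_range_of_injective hkinj) (by
        rintro _ ⟨p, rfl⟩ F hF
        have hdisj : Disjoint F (G p) := by
          rw [Finset.disjoint_left]
          intro j hjF hjG
          obtain ⟨p', rfl⟩ := hF j hjF
          have := hQdisj p p' _ (hG p _ hjG) (hk p')
          subst this
          exact hkG _ hjG
        have := h (k p) (hQM p (hk p)) (F ∪ G p) (fun j hj => by
          rcases Finset.mem_union.1 hj with hj | hj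
          · obtain ⟨p', rfl⟩ := hF j hj
            exact hQM _ (hk p')
          · exact hQM _ (hG p j hj))
        rw [Finset.sum_union hdisj] at this
        push_cast at this
        linarith [hsum p])
      exact ⟨M', hM'.trans (by rintro _ ⟨p, rfl⟩; exact hQM _ (hk p)), hinf, hfin⟩

end main

end L1Simons

/-- C*-algebra case of the infinite `ℓ₁`-copies theorem together with the
Simons extraction step: if a normalized sequence `(φ_m)` of functionals on a C*-algebra `A`
spans `ℓ₁` `r`-isomorphically (`0 < r ≤ 1`), then for all `ε, ε' > 0` there exist a
subsequence `(φ_{m_n})` and pairwise orthogonal norm-one elements `(c_n)` of `A` with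
`Re φ_{m_n}(c_n) > r (1 - ε)` and `∑_{k ∈ F} |φ_{m_n}(c_k)| < ε'` for every `n` and every
finite `F ⊆ ℕ` with `n ∉ F`. -/
theorem l1_r_isomorphic_subsequence_orthogonal_elements_simons
    {A : Type*} [NonUnitalCStarAlgebra A]
    (r : ℝ) (hr0 : 0 < r) (hr1 : r ≤ 1)
    (φ : ℕ → A →L[ℂ] ℂ) (hnorm : ∀ m, ‖φ m‖ = 1)
    (hspan : ∀ s : Finset ℕ, ∀ α : ℕ → ℂ,
      r * ∑ m ∈ s, ‖α m‖ ≤ ‖∑ m ∈ s, α m • φ m‖) :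
    ∀ ε > (0 : ℝ), ∀ ε' > (0 : ℝ), ∃ m : ℕ → ℕ, StrictMono m ∧
      ∃ c : ℕ → A,
        (∀ n k, n ≠ k → c n * star (c k) = 0 ∧ star (c k) * c n = 0) ∧
        (∀ n, ‖c n‖ = 1) ∧
        (∀ n, r * (1 - ε) < (φ (m n) (c n)).re) ∧
        (∀ n : ℕ, ∀ F : Finset ℕ, n ∉ F → ∑ k ∈ F, ‖φ (m n) (c k)‖ < ε') := by
  intro ε hε ε' hε'
  have hφ : ∀ m, ‖φ m‖ ≤ 1 := fun m => (hnorm m).le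
  have hsp : L1Simons.Spans φ ∅ r Set.univ := by
    intro s _ α η hη
    obtain ⟨x, hx1, hx2⟩ := (∑ m ∈ s, α m • φ m).exists_lt_apply_of_lt_opNorm
      (r := r * ∑ m ∈ s, ‖α m‖ - η) (by linarith [hspan s α])
    refine ⟨x, fun d hd => hd.elim, hx1.le, ?_⟩
    simpa [sum_apply] using hx2.le
  obtain ⟨m, hm, c, ho, hc1, hre⟩ := L1Simons.orth_seq φ hφ (r := r) (t := r * (1 - min ε (1 / 2)))
    (mul_nonneg hr0.le (by linarith [min_le_right ε (1 / 2)]))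
    (by nlinarith [lt_min hε (by norm_num : (0 : ℝ) < 1 / 2)]) hsp
  have ht0 : 0 ≤ r * (1 - min ε (1 / 2)) :=
    mul_nonneg hr0.le (by linarith [min_le_right ε (1 / 2)])
  have hcpos : ∀ n, 0 < ‖c n‖ := fun n => by
    rw [norm_pos_iff]
    intro h0
    have := hre n
    rw [h0, map_zero, Complex.zero_re] at this
    linarith
  let d : ℕ → A := fun n => ((‖c n‖⁻¹ : ℝ) : ℂ) • c n
  have hd1 : ∀ n, ‖d n‖ = 1 := fun n => by
    simp only [d, norm_smul, Complex.norm_real, norm_inv, norm_norm]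
    exact inv_mul_cancel₀ (hcpos n).ne'
  have hdo : ∀ n k, n ≠ k → d n * star (d k) = 0 ∧ star (d k) * d n = 0 := fun n k hnk => by
    obtain ⟨h1, h2⟩ := ho n k hnk
    simp [d, smul_mul_assoc, mul_smul_comm, h1, h2]
  have hdre : ∀ n, r * (1 - ε) < (φ (m n) (d n)).re := fun n => by
    have h1 : (φ (m n) (d n)).re = ‖c n‖⁻¹ * (φ (m n) (c n)).re := by
      simp only [d, map_smul, smul_eq_mul, Complex.re_ofReal_mul]
    have h2 : 1 ≤ ‖c n‖⁻¹ := (one_le_inv₀ (hcpos n)).2 (hc1 n)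
    have h3 : r * (1 - ε) ≤ r * (1 - min ε (1 / 2)) := by
      gcongr; exact min_le_left _ _
    rw [h1]
    nlinarith [hre n]
  obtain ⟨n, hn⟩ := exists_nat_gt (1 / ε')
  rw [div_lt_iff₀ hε'] at hn
  obtain ⟨M, -, hM, hfin⟩ := L1Simons.rosenthal (fun i j => ‖φ (m i) (d j)‖) hε' n
    Set.univ Set.infinite_univ (fun i _ F _ =>
      (L1Simons.row_sum (φ (m i)) (hφ _) F d hdo fun i => (hd1 i).le).trans hn.le)
  have he : StrictMono (Nat.nth (· ∈ M)) := Nat.nth_strictMono hM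
  have heM : ∀ n, Nat.nth (· ∈ M) n ∈ M := fun n => Nat.nth_mem_of_infinite hM n
  refine ⟨fun n => m (Nat.nth (· ∈ M) n), hm.comp he, fun n => d (Nat.nth (· ∈ M) n),
    fun n k hnk => hdo _ _ (he.injective.ne hnk), fun n => hd1 _, fun n => hdre _, fun n F hnF => ?_⟩
  have := hfin (Nat.nth (· ∈ M) n) (heM n) (F.map ⟨_, he.injective⟩)
    (fun j hj => by
      obtain ⟨k, _, rfl⟩ := Finset.mem_map.1 hj
      exact heM k)
    (fun h => by
      obtain ⟨k, hk, hkn⟩ := Finset.mem_map.1 h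
      exact hnF (he.injective hkn ▸ hk))
  simpa [Finset.sum_map] using this
end
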